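/- Let α ∈ [0, 1/2) and let 𝔙 ⊆ ∂H² be the visibility set of a well-behaved percolation Z from o, with dim_H 𝔙 = 1 − α a.s. on {𝔙 ≠ ∅}. Let L_o be the union of all hyperbolic lines through o contained in Z. Identifying lines through o with antipodal pairs of boundary points, the set of such lines corresponds to 𝔙 ∩ (−𝔙) where −𝔙 is the antipodal image of 𝔙. If the set of lines is nonempty with positive probability, then conditionally on nonemptiness, dim_H L_o = 2 − 2α almost surely. -/

import Mathlib

open MeasureTheory ENNReal Set ProbabilityTheory

/-- The Effros-type σ-algebra on the closed subsets of a topological space. -/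
def effrosSigma (X : Type*) [TopologicalSpace X] : MeasurableSpace (Set X) :=
  MeasurableSpace.generateFrom {T | ∃ K : Set X, IsCompact K ∧ T = {s | (s ∩ K).Nonempty}}

/-- The antipodal map on the unit circle of directions. -/
def antipode (θ : Metric.sphere (0 : EuclideanSpace ℝ (Fin 2)) 1) :
    Metric.sphere (0 : EuclideanSpace ℝ (Fin 2)) 1 :=
  ⟨-θ.1, by simp [θ.2]⟩

namespace PL
open UpperHalfPlane

/-! ### Part 1: geometry -/

lemma hq_pos (a b : ℝ) : 0 < √(1 + a^2 + b^2) - a := by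
  have : |a| < √(1 + a^2 + b^2) := by
    apply Real.lt_sqrt_of_sq_lt
    rw [sq_abs]; nlinarith [sq_nonneg b]
  linarith [le_abs_self a]

/-- The point of the upper half plane with hyperboloid coordinates `(a, b)`. -/
noncomputable def hq (a b : ℝ) : ℍ :=
  ⟨⟨b / (√(1 + a^2 + b^2) - a), 1 / (√(1 + a^2 + b^2) - a)⟩,
    by simpa using hq_pos a b⟩

lemma cosh_dist_hq (a b c d : ℝ) : Real.cosh (dist (hq a b) (hq c d)) =
    √(1 + a^2 + b^2) * √(1 + c^2 + d^2) - a * c - b * d := by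
  rw [UpperHalfPlane.cosh_dist]
  have e1 : ((hq a b : ℍ) : ℂ) =
    ⟨b / (√(1 + a^2 + b^2) - a), 1 / (√(1 + a^2 + b^2) - a)⟩ := rfl
  have e2 : ((hq c d : ℍ) : ℂ) =
    ⟨d / (√(1 + c^2 + d^2) - c), 1 / (√(1 + c^2 + d^2) - c)⟩ := rfl
  have e3 : (hq a b).im = 1 / (√(1 + a^2 + b^2) - a) := rfl
  have e4 : (hq c d).im = 1 / (√(1 + c^2 + d^2) - c) := rfl
  rw [e1, e2, e3, e4, Complex.dist_eq_re_im, Real.sq_sqrt (by positivity)]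
  have h1 := hq_pos a b
  have h2 := hq_pos c d
  have s1 : √(1 + a^2 + b^2)^2 = 1 + a^2 + b^2 := Real.sq_sqrt (by positivity)
  have s2 : √(1 + c^2 + d^2)^2 = 1 + c^2 + d^2 := Real.sq_sqrt (by positivity)
  set A := √(1 + a^2 + b^2)
  set C := √(1 + c^2 + d^2)
  have n1 : A - a ≠ 0 := h1.ne'
  have n2 : C - c ≠ 0 := h2.ne'
  simp only
  field_simp
  linear_combination (-(C - c)^2) * s1 - (A - a)^2 * s2

/-- First hyperboloid coordinate. -/
noncomputable def x1 (z : ℍ) : ℝ := (z.re^2 + z.im^2 - 1) / (2 * z.im)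
/-- Second hyperboloid coordinate. -/
noncomputable def x2 (z : ℍ) : ℝ := z.re / z.im

lemma continuous_x1 : Continuous x1 := by
  unfold x1
  apply Continuous.div
  · have := UpperHalfPlane.continuous_re; have := UpperHalfPlane.continuous_im; fun_prop
  · have := UpperHalfPlane.continuous_im; fun_prop
  · intro z; have := z.im_pos; positivity

lemma continuous_x2 : Continuous x2 := by
  unfold x2
  apply Continuous.div UpperHalfPlane.continuous_re UpperHalfPlane.continuous_im
  intro z; exact z.im_pos.ne'

lemma hq_x (z : ℍ) : hq (x1 z) (x2 z) = z := by
  have h := z.im_pos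
  have e : √(1 + (x1 z)^2 + (x2 z)^2) = (z.re^2 + z.im^2 + 1) / (2 * z.im) := by
    rw [Real.sqrt_eq_iff_mul_self_eq (by positivity) (by positivity)]
    unfold x1 x2; field_simp; ring
  have e2 : √(1 + (x1 z)^2 + (x2 z)^2) - x1 z = 1 / z.im := by
    rw [e]; unfold x1; field_simp; ring
  apply UpperHalfPlane.ext_re_im
  · change (x2 z) / (√(1 + (x1 z)^2 + (x2 z)^2) - x1 z) = _
    rw [e2]; unfold x2; field_simp
  · change 1 / (√(1 + (x1 z)^2 + (x2 z)^2) - x1 z) = _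
    rw [e2]; simp

lemma x1_hq (a b : ℝ) : x1 (hq a b) = a := by
  have h1 := hq_pos a b
  have s1 : √(1 + a^2 + b^2)^2 = 1 + a^2 + b^2 := Real.sq_sqrt (by positivity)
  unfold x1
  change ((b / (√(1 + a^2 + b^2) - a))^2 + (1 / (√(1 + a^2 + b^2) - a))^2 - 1) / (2 * (1 / (√(1 + a^2 + b^2) - a))) = a
  set A := √(1 + a^2 + b^2)
  have n1 : A - a ≠ 0 := h1.ne'
  field_simp
  linear_combination (-1) * s1

lemma x2_hq (a b : ℝ) : x2 (hq a b) = b := by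
  have h1 := hq_pos a b
  unfold x2
  change (b / (√(1 + a^2 + b^2) - a)) / (1 / (√(1 + a^2 + b^2) - a)) = b
  field_simp

lemma continuous_hq : Continuous fun x : ℝ × ℝ => hq x.1 x.2 := by
  rw [UpperHalfPlane.isEmbedding_coe.continuous_iff]
  change Continuous fun x : ℝ × ℝ => ((⟨x.2 / (√(1 + x.1^2 + x.2^2) - x.1), 1 / (√(1 + x.1^2 + x.2^2) - x.1)⟩ : ℂ))
  have h : Continuous fun x : ℝ × ℝ => ((x.2 / (√(1 + x.1^2 + x.2^2) - x.1), 1 / (√(1 + x.1^2 + x.2^2) - x.1)) : ℝ × ℝ) := by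
    have : ∀ x : ℝ × ℝ, √(1 + x.1^2 + x.2^2) - x.1 ≠ 0 := fun x => (hq_pos x.1 x.2).ne'
    fun_prop (disch := assumption)
  exact Complex.equivRealProdCLM.symm.continuous.comp h

lemma dist_eq_of_cosh {z w z' w' : ℍ} (h : Real.cosh (dist z w) = Real.cosh (dist z' w')) :
    dist z w = dist z' w' := by
  have h1 := Real.cosh_le_cosh.1 h.le
  have h2 := Real.cosh_le_cosh.1 h.ge
  rw [abs_of_nonneg dist_nonneg, abs_of_nonneg dist_nonneg] at h1 h2
  exact le_antisymm h1 h2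

/-- Rotation about `I`. -/
noncomputable def rotI (β : ℝ) (z : ℍ) : ℍ :=
  hq (x1 z * Real.cos β - x2 z * Real.sin β) (x1 z * Real.sin β + x2 z * Real.cos β)

lemma rotI_rotI (β γ : ℝ) (z : ℍ) : rotI β (rotI γ z) = rotI (γ + β) z := by
  unfold rotI
  rw [x1_hq, x2_hq, Real.cos_add, Real.sin_add]
  congr 1 <;> ring

lemma rotI_zero (z : ℍ) : rotI 0 z = z := by
  unfold rotI; simp [hq_x]

lemma isometry_rotI (β : ℝ) : Isometry (rotI β) := by
  refine Isometry.of_dist_eq fun z w => dist_eq_of_cosh ?_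
  conv_rhs => rw [← hq_x z, ← hq_x w]
  unfold rotI
  rw [cosh_dist_hq, cosh_dist_hq]
  have h : ∀ a b : ℝ, 1 + (a * Real.cos β - b * Real.sin β)^2 + (a * Real.sin β + b * Real.cos β)^2
    = 1 + a^2 + b^2 := fun a b => by
    linear_combination (a^2 + b^2) * Real.sin_sq_add_cos_sq β
  rw [h, h]
  linear_combination (-(x1 z * x1 w + x2 z * x2 w)) * Real.sin_sq_add_cos_sq β

/-- Rotation as an isometric equivalence. -/
noncomputable def rotE (β : ℝ) : ℍ ≃ᵢ ℍ :=
  IsometryEquiv.mk' (rotI β) (rotI (-β)) (fun z => by rw [rotI_rotI]; simp [rotI_zero]) (isometry_rotI β)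

/-- Affine isometry. -/
noncomputable def affE (x : ℝ) (a : {a : ℝ // 0 < a}) : ℍ ≃ᵢ ℍ :=
  IsometryEquiv.mk' (fun z => x +ᵥ (a • z)) (fun z => a⁻¹ • ((-x) +ᵥ z))
    (fun z => by simp) ((isometry_real_vadd x).comp (isometry_pos_mul a))

lemma affE_I (o : ℍ) : affE o.re ⟨o.im, o.im_pos⟩ I = o := by
  change o.re +ᵥ ((⟨o.im, o.im_pos⟩ : {a : ℝ // 0 < a}) • I) = o
  apply UpperHalfPlane.ext_re_im <;> simp

/-- Polar coordinates around `I`. -/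
noncomputable def pI (φ t : ℝ) : ℍ := hq (Real.sinh t * Real.cos φ) (Real.sinh t * Real.sin φ)

lemma sqrt_pI (φ t : ℝ) :
    √(1 + (Real.sinh t * Real.cos φ)^2 + (Real.sinh t * Real.sin φ)^2) = Real.cosh t := by
  rw [Real.sqrt_eq_iff_mul_self_eq (by positivity) (Real.cosh_pos t).le]
  nlinarith [Real.cosh_sq t, Real.sin_sq_add_cos_sq φ, congrArg (Real.sinh t ^2 * ·) (Real.sin_sq_add_cos_sq φ)]

lemma cosh_dist_pI (φ ψ s t : ℝ) : Real.cosh (dist (pI φ s) (pI ψ t)) =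
    Real.cosh s * Real.cosh t - Real.sinh s * Real.sinh t * Real.cos (φ - ψ) := by
  unfold pI
  rw [cosh_dist_hq, sqrt_pI, sqrt_pI, Real.cos_sub]; ring

lemma pI_zero_zero (φ : ℝ) : pI φ 0 = I := by
  unfold pI
  apply UpperHalfPlane.ext_re_im
  · change Real.sinh 0 * Real.sin φ / (√(1 + (Real.sinh 0 * Real.cos φ)^2 + (Real.sinh 0 * Real.sin φ)^2) - Real.sinh 0 * Real.cos φ) = _
    simp
  · change 1 / (√(1 + (Real.sinh 0 * Real.cos φ)^2 + (Real.sinh 0 * Real.sin φ)^2) - Real.sinh 0 * Real.cos φ) = _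
    simp

lemma pI_zero_angle (t : ℝ) : pI 0 t = (⟨Real.exp t, Real.exp_pos t⟩ : {a : ℝ // 0 < a}) • I := by
  have h : √(1 + (Real.sinh t * Real.cos 0)^2 + (Real.sinh t * Real.sin 0)^2) = Real.cosh t := sqrt_pI 0 t
  have h2 : Real.cosh t - Real.sinh t = Real.exp (-t) := Real.cosh_sub_sinh t
  unfold pI
  apply UpperHalfPlane.ext_re_im
  · change Real.sinh t * Real.sin 0 / (√(1 + (Real.sinh t * Real.cos 0)^2 + (Real.sinh t * Real.sin 0)^2) - Real.sinh t * Real.cos 0) = _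
    simp
  · change 1 / (√(1 + (Real.sinh t * Real.cos 0)^2 + (Real.sinh t * Real.sin 0)^2) - Real.sinh t * Real.cos 0) = _
    rw [h]; simp [h2, Real.exp_neg]

lemma surj_pI (z : ℍ) : ∃ φ t : ℝ, 0 ≤ t ∧ z = pI φ t := by
  set c : ℂ := ⟨x1 z, x2 z⟩
  refine ⟨c.arg, Real.arsinh ‖c‖, Real.arsinh_nonneg_iff.2 (norm_nonneg _), ?_⟩
  unfold pI
  rw [Real.sinh_arsinh, Complex.norm_mul_cos_arg, Complex.norm_mul_sin_arg]
  exact (hq_x z).symm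

/-- Polar coordinates around `o` with the facts about them which we use. -/
structure Polar (o : ℍ) where
  p : ℝ → ℝ → ℍ
  C : ℍ → ℝ
  S : ℍ → ℝ
  cont : Continuous fun x : ℝ × ℝ => p x.1 x.2
  zero : ∀ φ, p φ 0 = o
  cosh_dist : ∀ φ ψ s t, Real.cosh (dist (p φ s) (p ψ t)) =
    Real.cosh s * Real.cosh t - Real.sinh s * Real.sinh t * Real.cos (φ - ψ)
  surj : ∀ z, ∃ φ t : ℝ, 0 ≤ t ∧ z = p φ t
  contC : Continuous C
  contS : Continuous S
  C_p : ∀ φ t, C (p φ t) = Real.sinh t * Real.cos φ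
  S_p : ∀ φ t, S (p φ t) = Real.sinh t * Real.sin φ
  rot : ∀ β, ∃ Φ : ℍ ≃ᵢ ℍ, ∀ φ t, Φ (p φ t) = p (φ + β) t
  trans : ∀ s, ∃ Φ : ℍ ≃ᵢ ℍ, ∀ t, Φ (p 0 t) = p 0 (t + s)
  move : ∀ z, ∃ Φ : ℍ ≃ᵢ ℍ, Φ z = o

theorem exists_polar (o : ℍ) : Nonempty (Polar o) := by
  set Ψ := affE o.re ⟨o.im, o.im_pos⟩ with hΨ
  have hΨI : Ψ I = o := affE_I o
  refine ⟨⟨fun φ t => Ψ (pI φ t), fun z => x1 (Ψ.symm z), fun z => x2 (Ψ.symm z), ?_, ?_, ?_, ?_, ?_, ?_,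
    ?_, ?_, ?_, ?_, ?_⟩⟩
  · refine Ψ.continuous.comp (continuous_hq.comp (f := fun x : ℝ × ℝ =>
      (Real.sinh x.2 * Real.cos x.1, Real.sinh x.2 * Real.sin x.1)) ?_)
    have := Real.continuous_sinh
    fun_prop
  · intro φ; simp only [pI_zero_zero, hΨI]
  · intro φ ψ s t; rw [Ψ.dist_eq, cosh_dist_pI]
  · intro z
    obtain ⟨φ, t, ht, h⟩ := surj_pI (Ψ.symm z)
    exact ⟨φ, t, ht, by rw [← h]; simp⟩
  · exact continuous_x1.comp Ψ.symm.continuous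
  · exact continuous_x2.comp Ψ.symm.continuous
  · intro φ t; simp [pI, x1_hq]
  · intro φ t; simp [pI, x2_hq]
  · intro β
    refine ⟨(Ψ.symm.trans (rotE β)).trans Ψ, fun φ t => ?_⟩
    change Ψ (rotI β (Ψ.symm (Ψ (pI φ t)))) = _
    congr 1
    rw [IsometryEquiv.symm_apply_apply]
    unfold rotI pI
    rw [x1_hq, x2_hq, Real.cos_add, Real.sin_add]
    congr 1 <;> ring
  · intro s
    refine ⟨(Ψ.symm.trans (affE 0 ⟨Real.exp s, Real.exp_pos s⟩)).trans Ψ, fun t => ?_⟩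
    change Ψ ((0 : ℝ) +ᵥ ((⟨Real.exp s, Real.exp_pos s⟩ : {a : ℝ // 0 < a}) • (Ψ.symm (Ψ (pI 0 t))))) = _
    congr 1
    rw [IsometryEquiv.symm_apply_apply, pI_zero_angle, pI_zero_angle, zero_vadd, smul_smul]
    congr 1
    ext; simp [Real.exp_add, mul_comm]
  · intro z
    refine ⟨(affE z.re ⟨z.im, z.im_pos⟩).symm.trans Ψ, ?_⟩
    change Ψ ((affE z.re ⟨z.im, z.im_pos⟩).symm z) = o
    rw [← hΨI]; congr 1
    rw [IsometryEquiv.symm_apply_eq, affE_I]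

end PL

namespace PL
open UpperHalfPlane

lemma le_of_cosh_le {d a : ℝ} (hd : 0 ≤ d) (h : Real.cosh a ≤ Real.cosh d) : |a| ≤ d := by
  have := Real.cosh_le_cosh.1 h
  rwa [abs_of_nonneg hd] at this

lemma sinh_le_mul {d D : ℝ} (h0 : 0 ≤ d) (h1 : d ≤ D) : Real.sinh d ≤ Real.cosh D * d := by
  have := Convex.norm_image_sub_le_of_norm_deriv_le (f := Real.sinh) (s := Icc 0 D) (C := Real.cosh D)
    (x := 0) (y := d) (fun x _ => Real.differentiable_sinh x) (fun x hx => by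
      rw [Real.deriv_sinh, Real.norm_eq_abs, abs_of_pos (Real.cosh_pos x), Real.cosh_le_cosh,
        abs_of_nonneg hx.1, abs_of_nonneg (hx.1.trans hx.2)]
      exact hx.2) (convex_Icc _ _) ⟨le_rfl, h0.trans h1⟩ ⟨h0, h1⟩
  simp only [Real.sinh_zero, sub_zero, Real.norm_eq_abs, abs_of_nonneg h0] at this
  exact (le_abs_self _).trans this

namespace Polar
variable {o : ℍ} (X : Polar o)

lemma eq_of_coords {φ s ψ t : ℝ} (h1 : Real.sinh s * Real.cos φ = Real.sinh t * Real.cos ψ)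
    (h2 : Real.sinh s * Real.sin φ = Real.sinh t * Real.sin ψ) : X.p φ s = X.p ψ t := by
  have hs : Real.sinh s ^2 = Real.sinh t ^ 2 := by
    have e : ∀ x y : ℝ, Real.sinh x ^2 = (Real.sinh x * Real.cos y)^2 + (Real.sinh x * Real.sin y)^2 := by
      intro x y
      linear_combination (-(Real.sinh x ^2)) * Real.sin_sq_add_cos_sq y
    rw [e s φ, e t ψ, h1, h2]
  have hc : Real.cosh s = Real.cosh t := by
    have h3 : Real.cosh s ^2 = Real.cosh t ^2 := by rw [Real.cosh_sq, Real.cosh_sq, hs]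
    exact (pow_left_inj₀ (Real.cosh_pos s).le (Real.cosh_pos t).le two_ne_zero).1 h3
  have : Real.cosh (dist (X.p φ s) (X.p ψ t)) = 1 := by
    rw [X.cosh_dist, Real.cos_sub, hc]
    have e1 : Real.sinh s * Real.sinh t * (Real.cos φ * Real.cos ψ + Real.sin φ * Real.sin ψ) = Real.sinh t ^2 := by
      calc _ = (Real.sinh s * Real.cos φ) * (Real.sinh t * Real.cos ψ) + (Real.sinh s * Real.sin φ) * (Real.sinh t * Real.sin ψ) := by ring
        _ = _ := by
          rw [h1, h2]
          linear_combination (Real.sinh t ^2) * Real.sin_sq_add_cos_sq ψ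
    rw [e1]; linarith [Real.cosh_sq t]
  rw [← dist_eq_zero]
  have h5 := Real.cosh_le_cosh.1 (this.le.trans_eq Real.cosh_zero.symm)
  simpa using h5

lemma neg (φ t : ℝ) : X.p φ (-t) = X.p (φ + Real.pi) t := by
  apply X.eq_of_coords <;> simp [Real.sinh_neg, Real.cos_add_pi, Real.sin_add_pi]

lemma sub_pi (φ t : ℝ) : X.p (φ - Real.pi) t = X.p φ (-t) := by
  apply X.eq_of_coords <;> simp [Real.sinh_neg, Real.cos_sub_pi, Real.sin_sub_pi]

lemma add_two_pi (φ t : ℝ) : X.p (φ + 2 * Real.pi) t = X.p φ t := by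
  apply X.eq_of_coords <;> simp

lemma dist_same (φ s t : ℝ) : dist (X.p φ s) (X.p φ t) = |s - t| := by
  have : Real.cosh (dist (X.p φ s) (X.p φ t)) = Real.cosh (s - t) := by
    rw [X.cosh_dist, Real.cosh_sub]; simp
  have h1 := le_of_cosh_le dist_nonneg this.ge
  have h2 := Real.cosh_le_cosh.1 this.le
  rw [abs_of_nonneg dist_nonneg] at h2
  exact le_antisymm h2 h1

lemma dist_o (φ t : ℝ) : dist o (X.p φ t) = |t| := by
  have := X.dist_same φ 0 t
  rwa [X.zero φ, zero_sub, abs_neg] at this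

lemma dist_ge (φ ψ s t : ℝ) : |(|s| - |t|)| ≤ dist (X.p φ s) (X.p ψ t) := by
  rw [← X.dist_o φ s, ← X.dist_o ψ t, dist_comm o, dist_comm o]
  exact abs_dist_sub_le _ _ _

lemma sinh_dist_ge (φ ψ s t : ℝ) :
    |Real.sinh s * Real.sin (φ - ψ)| ≤ Real.sinh (dist (X.p φ s) (X.p ψ t)) := by
  have h := X.cosh_dist φ ψ s t
  set d := dist (X.p φ s) (X.p ψ t)
  have hd : 0 ≤ d := dist_nonneg
  apply abs_le_of_sq_le_sq _ (Real.sinh_nonneg_iff.2 hd)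
  have := Real.cosh_sq d
  have h3 : Real.sinh d ^2 = Real.cosh d ^2 - 1 := by linarith
  rw [h3, h]
  nlinarith [Real.cosh_sq s, Real.cosh_sq t, Real.sin_sq_add_cos_sq (φ - ψ),
    congrArg (Real.sinh s ^ 2 * ·) (Real.sin_sq_add_cos_sq (φ - ψ)),
    sq_nonneg (Real.cosh s * Real.sinh t - Real.sinh s * Real.cosh t * Real.cos (φ - ψ)),
    congrArg (Real.cosh s ^ 2 * ·) (Real.cosh_sq t),
    congrArg ((Real.sinh s * Real.cos (φ - ψ)) ^ 2 * ·) (Real.cosh_sq t)]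

/-- points on opposite sides -/
lemma dist_opp {φ ψ s t : ℝ} (hc : 0 ≤ Real.cos (φ - ψ)) (hs : s ≤ 0) (ht : 0 ≤ t) :
    max (-s) t ≤ dist (X.p φ s) (X.p ψ t) := by
  have h : Real.cosh s * Real.cosh t ≤ Real.cosh (dist (X.p φ s) (X.p ψ t)) := by
    rw [X.cosh_dist]
    have : Real.sinh s * Real.sinh t * Real.cos (φ - ψ) ≤ 0 := by
      apply mul_nonpos_of_nonpos_of_nonneg _ hc
      exact mul_nonpos_of_nonpos_of_nonneg (Real.sinh_nonpos_iff.2 hs) (Real.sinh_nonneg_iff.2 ht)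
    linarith
  have h1 := le_of_cosh_le dist_nonneg ((le_mul_of_one_le_right (Real.cosh_pos s).le (Real.one_le_cosh t)).trans h)
  have h2 := le_of_cosh_le dist_nonneg ((le_mul_of_one_le_left (Real.cosh_pos t).le (Real.one_le_cosh s)).trans h)
  rw [abs_of_nonpos hs] at h1
  rw [abs_of_nonneg ht] at h2
  exact max_le h1 h2

lemma dist_arc (φ ψ t : ℝ) : dist (X.p φ t) (X.p ψ t) ≤ |Real.sinh t| * |φ - ψ| := by
  have h := X.cosh_dist φ ψ t t
  set d := dist (X.p φ t) (X.p ψ t)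
  have hd : 0 ≤ d := dist_nonneg
  have h1 : Real.cosh d = 1 + 2 * Real.sinh (d/2)^2 := by
    have := Real.cosh_two_mul (d/2)
    rw [show 2 * (d/2) = d by ring] at this
    linarith [Real.cosh_sq (d/2)]
  have h2 : Real.cos (φ - ψ) = 1 - 2 * Real.sin ((φ - ψ)/2)^2 := by
    have := Real.cos_two_mul ((φ - ψ)/2)
    rw [show 2 * ((φ - ψ)/2) = φ - ψ by ring] at this
    linarith [Real.sin_sq_add_cos_sq ((φ - ψ)/2)]
  have h3 : Real.sinh (d/2)^2 = (Real.sinh t * Real.sin ((φ - ψ)/2))^2 := by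
    rw [h1, h2] at h
    nlinarith [Real.cosh_sq t]
  have h4 : Real.sinh (d/2) ≤ |Real.sinh t * Real.sin ((φ - ψ)/2)| := abs_le_of_sq_le_sq' (by rw [h3, sq_abs]) (abs_nonneg _) |>.2
  have h5 : d / 2 ≤ Real.sinh (d/2) := Real.self_le_sinh_iff.2 (by positivity)
  have h6 : |Real.sin ((φ - ψ)/2)| ≤ |(φ - ψ)/2| := Real.abs_sin_le_abs
  rw [abs_mul] at h4
  rw [abs_div, abs_two] at h6
  nlinarith [abs_nonneg (Real.sinh t), mul_le_mul_of_nonneg_left h6 (abs_nonneg (Real.sinh t))]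

lemma sin_lower {x : ℝ} (h : |x| ≤ Real.pi / 2) : 2 / Real.pi * |x| ≤ |Real.sin x| := by
  rcases le_total 0 x with hx | hx
  · rw [abs_of_nonneg hx] at h ⊢
    exact (Real.mul_le_sin hx h).trans (le_abs_self _)
  · rw [abs_of_nonpos hx] at h ⊢
    have := Real.mul_le_sin (x := -x) (by linarith) h
    rw [Real.sin_neg] at this
    exact this.trans (neg_le_abs _)

lemma sin_lower' {x : ℝ} (h : |x| ≤ 3 / 2) : |x| / 2 ≤ |Real.sin x| := by
  have hpi := Real.pi_gt_three
  have := sin_lower (x := x) (by linarith)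
  have h2 : (1:ℝ)/2 ≤ 2 / Real.pi := by
    rw [div_le_div_iff₀ (by norm_num) Real.pi_pos]; linarith [Real.pi_lt_four]
  nlinarith [abs_nonneg x]

/-- lower Lipschitz bound for the polar coordinates in the annulus `1 ≤ t ≤ 2`. -/
lemma lower_lip {φ ψ s t : ℝ} (h : |φ - ψ| ≤ 3/2) (hs : s ∈ Icc (1:ℝ) 2) (ht : t ∈ Icc (1:ℝ) 2) :
    |φ - ψ| ≤ 2 * Real.cosh 4 * dist (X.p φ s) (X.p ψ t) ∧ |s - t| ≤ dist (X.p φ s) (X.p ψ t) := by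
  constructor
  · have h1 := X.sinh_dist_ge φ ψ s t
    have hd : dist (X.p φ s) (X.p ψ t) ≤ 4 := by
      have := dist_triangle (X.p φ s) o (X.p ψ t)
      rw [X.dist_o, dist_comm _ o, X.dist_o, abs_of_nonneg (by linarith [hs.1]), abs_of_nonneg (by linarith [ht.1])] at this
      linarith [hs.2, ht.2]
    have h2 := sinh_le_mul dist_nonneg hd
    have h3 := sin_lower' h
    have h4 : 1 ≤ Real.sinh s := hs.1.trans (Real.self_le_sinh_iff.2 (by linarith [hs.1]))
    rw [abs_mul, abs_of_nonneg (by linarith)] at h1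
    nlinarith [abs_nonneg (Real.sin (φ - ψ))]
  · have := X.dist_ge φ ψ s t
    rwa [abs_of_nonneg (show 0 ≤ s by linarith [hs.1]), abs_of_nonneg (show 0 ≤ t by linarith [ht.1])] at this

lemma classify {g : ℝ → ℍ} (h0 : g 0 = o)
    (hg : ∀ s t : ℝ, 0 ≤ s → 0 ≤ t → dist (g s) (g t) = |s - t|) :
    ∃ φ, ∀ t, 0 ≤ t → g t = X.p φ t := by
  have key : ∀ t, 0 ≤ t → ∃ φ, g t = X.p φ t := by
    intro t ht
    obtain ⟨φ, t', ht', h⟩ := X.surj (g t)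
    refine ⟨φ, ?_⟩
    have := hg 0 t le_rfl ht
    rw [h0, h, X.dist_o, zero_sub, abs_neg, abs_of_nonneg ht, abs_of_nonneg ht'] at this
    rw [h, this]
  obtain ⟨φ, hφ⟩ := key 1 zero_le_one
  refine ⟨φ, fun t ht => ?_⟩
  obtain ⟨ψ, hψ⟩ := key t ht
  rw [hψ]
  have h1 := hg 1 t zero_le_one ht
  have h2 := X.cosh_dist φ ψ 1 t
  rw [← hφ, ← hψ, h1, Real.cosh_abs, Real.cosh_sub] at h2
  rcases eq_or_lt_of_le ht with rfl | ht
  · rw [X.zero, X.zero]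
  have hp : 0 < Real.sinh 1 * Real.sinh t :=
    mul_pos (Real.sinh_pos_iff.2 one_pos) (Real.sinh_pos_iff.2 ht)
  have hc : Real.cos (φ - ψ) = 1 := by
    have : Real.sinh 1 * Real.sinh t * (Real.cos (φ - ψ) - 1) = 0 := by linarith
    rcases mul_eq_zero.1 this with h | h
    · exact absurd h hp.ne'
    · linarith
  obtain ⟨n, hn⟩ := (Real.cos_eq_one_iff _).1 hc
  have : φ = ψ + n * (2 * Real.pi) := by linarith
  rw [this]
  apply X.eq_of_coords <;> simp

lemma geodesic {γ : ℝ → ℍ} (hγ : Isometry γ) (φ a : ℝ) :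
    ∃ Φ : ℍ ≃ᵢ ℍ, ∀ t, 0 ≤ t → Φ (γ t) = X.p φ (a + t) := by
  obtain ⟨Φ₁, h₁⟩ := X.move (γ 0)
  obtain ⟨ψ, hψ⟩ := X.classify (g := fun t => Φ₁ (γ t)) h₁ (fun s t _ _ => by
    rw [Φ₁.dist_eq, hγ.dist_eq, Real.dist_eq])
  obtain ⟨Φ₂, h₂⟩ := X.rot (-ψ)
  obtain ⟨Φ₃, h₃⟩ := X.trans a
  obtain ⟨Φ₄, h₄⟩ := X.rot φ
  refine ⟨((Φ₁.trans Φ₂).trans Φ₃).trans Φ₄, fun t ht => ?_⟩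
  change Φ₄ (Φ₃ (Φ₂ (Φ₁ (γ t)))) = _
  rw [hψ t ht, h₂, add_neg_cancel, h₃, h₄, zero_add, add_comm]

lemma cont_left (t : ℝ) : Continuous fun φ => X.p φ t := X.cont.comp (by fun_prop : Continuous fun φ : ℝ => (φ, t))
lemma cont_right (φ : ℝ) : Continuous fun t => X.p φ t := X.cont.comp (by fun_prop : Continuous fun t : ℝ => (φ, t))

end Polar
end PL

set_option linter.unusedSectionVars false
set_option linter.unusedSimpArgs false
namespace PL
open UpperHalfPlane

/-! ### Part 2: percolation framework -/

/-- Effros measurable predicates on closed sets depending only on the part in `A`. -/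
def EM (A : Set ℍ) (Q : Set ℍ → Prop) : Prop :=
  ∃ T : Set (Set ℍ), MeasurableSet[effrosSigma ℍ] T ∧ ∀ s, IsClosed s → (Q s ↔ s ∩ A ∈ T)

/-- Increasing Effros measurable predicates on closed sets depending only on the part in `A`. -/
def EInc (A : Set ℍ) (Q : Set ℍ → Prop) : Prop :=
  ∃ T : Set (Set ℍ), MeasurableSet[effrosSigma ℍ] T ∧ IsUpperSet T ∧
    ∀ s, IsClosed s → (Q s ↔ s ∩ A ∈ T)

lemma EInc.em {A : Set ℍ} {Q : Set ℍ → Prop} (h : EInc A Q) : EM A Q := by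
  obtain ⟨T, h1, _, h3⟩ := h
  exact ⟨T, h1, h3⟩

lemma meas_hit {K : Set ℍ} (hK : IsCompact K) :
    MeasurableSet[effrosSigma ℍ] {s : Set ℍ | (s ∩ K).Nonempty} :=
  MeasurableSpace.measurableSet_generateFrom ⟨K, hK, rfl⟩

lemma einc_hit {A K : Set ℍ} (hK : IsCompact K) (hKA : K ⊆ A) : EInc A fun s => (s ∩ K).Nonempty := by
  refine ⟨_, meas_hit hK, ?_, ?_⟩
  · rintro s t hst ⟨x, hx, hxK⟩
    exact ⟨x, hst hx, hxK⟩
  · intro s _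
    simp only [mem_ofPred_eq, inter_assoc, inter_eq_self_of_subset_right hKA]

lemma EM.congr {A : Set ℍ} {Q Q' : Set ℍ → Prop} (h : EM A Q) (hQ : ∀ s, IsClosed s → (Q' s ↔ Q s)) : EM A Q' := by
  obtain ⟨T, h1, h3⟩ := h
  exact ⟨T, h1, fun s hs => (hQ s hs).trans (h3 s hs)⟩

lemma EInc.congr {A : Set ℍ} {Q Q' : Set ℍ → Prop} (h : EInc A Q) (hQ : ∀ s, IsClosed s → (Q' s ↔ Q s)) : EInc A Q' := by
  obtain ⟨T, h1, h2, h3⟩ := h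
  exact ⟨T, h1, h2, fun s hs => (hQ s hs).trans (h3 s hs)⟩

lemma EM.not {A : Set ℍ} {Q : Set ℍ → Prop} (h : EM A Q) : EM A fun s => ¬ Q s := by
  obtain ⟨T, h1, h3⟩ := h
  exact ⟨Tᶜ, h1.compl, fun s hs => by simp [h3 s hs]⟩

lemma EM.forall {ι : Type*} [Countable ι] {A : Set ℍ} {Q : ι → Set ℍ → Prop} (h : ∀ i, EM A (Q i)) :
    EM A fun s => ∀ i, Q i s := by
  choose T h1 h3 using h
  refine ⟨⋂ i, T i, MeasurableSet.iInter h1, fun s hs => ?_⟩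
  simp [h3 _ s hs]

lemma EM.exists {ι : Type*} [Countable ι] {A : Set ℍ} {Q : ι → Set ℍ → Prop} (h : ∀ i, EM A (Q i)) :
    EM A fun s => ∃ i, Q i s := by
  choose T h1 h3 using h
  refine ⟨⋃ i, T i, MeasurableSet.iUnion h1, fun s hs => ?_⟩
  simp [h3 _ s hs]

lemma EInc.forall {ι : Type*} [Countable ι] {A : Set ℍ} {Q : ι → Set ℍ → Prop} (h : ∀ i, EInc A (Q i)) :
    EInc A fun s => ∀ i, Q i s := by
  choose T h1 h2 h3 using h
  refine ⟨⋂ i, T i, MeasurableSet.iInter h1, isUpperSet_iInter h2, fun s hs => ?_⟩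
  simp [h3 _ s hs]

lemma EInc.exists {ι : Type*} [Countable ι] {A : Set ℍ} {Q : ι → Set ℍ → Prop} (h : ∀ i, EInc A (Q i)) :
    EInc A fun s => ∃ i, Q i s := by
  choose T h1 h2 h3 using h
  refine ⟨⋃ i, T i, MeasurableSet.iUnion h1, isUpperSet_iUnion h2, fun s hs => ?_⟩
  simp [h3 _ s hs]

lemma EM.and {A : Set ℍ} {Q Q' : Set ℍ → Prop} (h : EM A Q) (h' : EM A Q') : EM A fun s => Q s ∧ Q' s := by
  obtain ⟨T, h1, h3⟩ := h
  obtain ⟨T', h1', h3'⟩ := h'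
  exact ⟨T ∩ T', h1.inter h1', fun s hs => by simp [h3 s hs, h3' s hs]⟩

lemma EInc.and {A : Set ℍ} {Q Q' : Set ℍ → Prop} (h : EInc A Q) (h' : EInc A Q') : EInc A fun s => Q s ∧ Q' s := by
  obtain ⟨T, h1, h2, h3⟩ := h
  obtain ⟨T', h1', h2', h3'⟩ := h'
  exact ⟨T ∩ T', h1.inter h1', h2.inter h2', fun s hs => by simp [h3 s hs, h3' s hs]⟩

lemma einc_const (A : Set ℍ) (c : Prop) : EInc A fun _ => c := by
  by_cases h : c
  · exact ⟨univ, MeasurableSet.univ, isUpperSet_univ, fun s _ => by simp [h]⟩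
  · exact ⟨∅, @MeasurableSet.empty _ (effrosSigma ℍ), isUpperSet_empty, fun s _ => by simp [h]⟩

lemma meas_inter {A : Set ℍ} (hA : IsClosed A) :
    @Measurable _ _ (effrosSigma ℍ) (effrosSigma ℍ) fun s : Set ℍ => s ∩ A := by
  refine @measurable_generateFrom _ _ (effrosSigma ℍ) _ _ ?_
  rintro _ ⟨K, hK, rfl⟩
  have : (fun s : Set ℍ => s ∩ A) ⁻¹' {s | (s ∩ K).Nonempty} = {s | (s ∩ (A ∩ K)).Nonempty} := by
    ext s; simp [inter_assoc]
  rw [this]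
  exact meas_hit (hK.inter_left hA)

lemma EM.mono {A B : Set ℍ} {Q : Set ℍ → Prop} (h : EM A Q) (hA : IsClosed A) (hAB : A ⊆ B) : EM B Q := by
  obtain ⟨T, h1, h3⟩ := h
  refine ⟨_, meas_inter hA h1, fun s hs => ?_⟩
  rw [h3 s hs, mem_preimage, inter_assoc, inter_eq_self_of_subset_right hAB]

lemma EInc.mono {A B : Set ℍ} {Q : Set ℍ → Prop} (h : EInc A Q) (hA : IsClosed A) (hAB : A ⊆ B) : EInc B Q := by
  obtain ⟨T, h1, h2, h3⟩ := h
  refine ⟨_, meas_inter hA h1, fun s t hst hs => h2 (inter_subset_inter_left A hst) hs, fun s hs => ?_⟩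
  rw [h3 s hs, mem_preimage, inter_assoc, inter_eq_self_of_subset_right hAB]

lemma einc_subset (A : Set ℍ) : EInc A fun s => A ⊆ s := by
  obtain ⟨D, hD1, hD2, hD3⟩ := TopologicalSpace.IsSeparable.exists_countable_dense_subset
    (TopologicalSpace.IsSeparable.of_separableSpace A)
  have : Countable D := hD2
  refine (EInc.forall (ι := D) (Q := fun d s => (s ∩ {d.1}).Nonempty) fun d =>
    einc_hit isCompact_singleton (singleton_subset_iff.2 (hD1 d.2))).congr fun s hs => ?_
  simp only [inter_singleton_nonempty, Subtype.forall]
  exact ⟨fun h a ha => h (hD1 ha), fun h => hD3.trans (closure_minimal h hs)⟩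

namespace Polar
variable {o : ℍ} (X : Polar o)

/-- visibility: some angle in `K` is visible at all times in `T`. -/
def Vis (K T : Set ℝ) (s : Set ℍ) : Prop := ∃ φ ∈ K, ∀ t ∈ T, X.p φ t ∈ s

/-- the region of angles `K` and times `T` -/
def reg (K T : Set ℝ) : Set ℍ := (fun x : ℝ × ℝ => X.p x.1 x.2) '' (K ×ˢ T)

lemma mem_reg {K T : Set ℝ} {φ t : ℝ} (h : φ ∈ K) (h' : t ∈ T) : X.p φ t ∈ X.reg K T := ⟨(φ, t), ⟨h, h'⟩, rfl⟩

lemma isCompact_reg {K T : Set ℝ} (hK : IsCompact K) (hT : IsCompact T) : IsCompact (X.reg K T) :=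
  (hK.prod hT).image X.cont

lemma reg_mono {K K' T T' : Set ℝ} (h : K ⊆ K') (h' : T ⊆ T') : X.reg K T ⊆ X.reg K' T' :=
  image_mono (prod_mono h h')

lemma einc_vis {K : Set ℝ} (hK : IsCompact K) (T : Set ℝ) : EInc (X.reg K T) (X.Vis K T) := by
  rcases T.eq_empty_or_nonempty with rfl | hT
  · exact (einc_const _ K.Nonempty).congr fun s _ => by simp [Vis, Set.Nonempty]
  have := hT.to_subtype
  let d : ℕ → T := TopologicalSpace.denseSeq T
  have hd : DenseRange d := TopologicalSpace.denseRange_denseSeq T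
  refine (EInc.forall (ι := ℕ) fun n => EInc.exists (ι := ℤ) fun k => EInc.forall (ι := Fin n) fun i =>
    einc_hit (K := X.reg (K ∩ Icc (k / 2^n : ℝ) ((k+1) / 2^n)) {(d i).1})
      (X.isCompact_reg (hK.inter_right isClosed_Icc) isCompact_singleton)
      (X.reg_mono inter_subset_left (singleton_subset_iff.2 (d i).2))).congr fun s hs => ?_
  constructor
  · rintro ⟨φ, hφ, h⟩ n
    refine ⟨⌊φ * 2^n⌋, fun i => ⟨X.p φ (d i), h _ (d i).2, X.mem_reg ⟨hφ, ?_, ?_⟩ rfl⟩⟩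
    · rw [div_le_iff₀ (by positivity)]; exact Int.floor_le _
    · rw [le_div_iff₀ (by positivity)]; exact (Int.lt_floor_add_one _).le
  · intro h
    choose k hk using h
    have hk' : ∀ n (i : Fin n), ∃ φ, (φ ∈ K ∧ φ ∈ Icc (k n / 2^n : ℝ) ((k n+1) / 2^n)) ∧ X.p φ (d i) ∈ s := by
      intro n i
      obtain ⟨x, hx, ⟨⟨φ, t⟩, ⟨h1, h2⟩, rfl⟩⟩ := hk n i
      rw [mem_singleton_iff] at h2
      simp only at h2
      subst h2
      exact ⟨φ, h1, hx⟩
    choose a ha has using hk'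
    let b : ℕ → ℝ := fun n => a (n+1) 0
    obtain ⟨φ, hφ, σ, hσ, hlim⟩ := hK.tendsto_subseq (x := b) fun n => (ha (n+1) 0).1
    refine ⟨φ, hφ, ?_⟩
    have hall : ∀ i, X.p φ (d i) ∈ s := by
      intro i
      let c : ℕ → ℝ := fun n => if h : i < n + 1 then a (n+1) ⟨i, h⟩ else b n
      have hc : ∀ n, |c n - b n| ≤ (1/2)^n := by
        intro n
        simp only [c]
        split_ifs with h
        · have e1 := (ha (n+1) ⟨i, h⟩).2
          have e2 := (ha (n+1) 0).2
          have e3 : ((k (n+1) : ℝ) + 1) / 2^(n+1) = k (n+1) / 2^(n+1) + (1/2)^(n+1) := by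
            rw [div_pow, one_pow]; ring
          have e4 : ((1:ℝ)/2)^(n+1) ≤ (1/2)^n := pow_le_pow_of_le_one (by norm_num) (by norm_num) (Nat.le_succ n)
          rw [e3] at e1 e2
          rw [abs_le]
          constructor <;> [linarith [e1.1, e2.2]; linarith [e1.2, e2.1]]
        · simp
      have hcb : Filter.Tendsto (fun n => c n - b n) Filter.atTop (nhds 0) :=
        squeeze_zero_norm hc (tendsto_pow_atTop_nhds_zero_of_lt_one (by norm_num) (by norm_num))
      have hc2 : Filter.Tendsto (fun n => c (σ n)) Filter.atTop (nhds φ) := by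
        have := (hcb.comp hσ.tendsto_atTop).add hlim
        simpa [Function.comp_def] using this
      have hc3 := ((X.cont_left (d i)).tendsto φ).comp hc2
      refine hs.mem_of_tendsto hc3 ?_
      filter_upwards [Filter.eventually_ge_atTop i] with n hn
      have : i < σ n + 1 := by have := hσ.id_le n; simp only [id] at this; omega
      simp only [Function.comp, c, this, dif_pos]
      exact has (σ n + 1) ⟨i, this⟩
    intro t ht
    have hcl : IsClosed {t : T | X.p φ t ∈ s} := hs.preimage ((X.cont_right φ).comp continuous_subtype_val)
    have : (univ : Set T) ⊆ {t : T | X.p φ t ∈ s} := by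
      rw [← hd.closure_range]
      exact closure_minimal (by rintro _ ⟨i, rfl⟩; exact hall i) hcl
    exact this (mem_univ (⟨t, ht⟩ : T))

end Polar

/-- The sigma algebra of the percolation inside `A`. -/
noncomputable def FA {Ω : Type*} (Z : Ω → Set ℍ) (A : Set ℍ) : MeasurableSpace Ω :=
  (effrosSigma ℍ).comap fun ω => Z ω ∩ A

/-- Increasing events. -/
def Inc {Ω : Type*} (Z : Ω → Set ℍ) (E : Set Ω) : Prop :=
  ∃ T : Set (Set ℍ), MeasurableSet[effrosSigma ℍ] T ∧ IsUpperSet T ∧ E = Z ⁻¹' T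

structure Perc {Ω : Type*} [MeasurableSpace Ω] (P : Measure Ω) (Z : Ω → Set ℍ) (R₀ : ℝ) : Prop where
  closed : ∀ ω, IsClosed (Z ω)
  meas : @Measurable Ω (Set ℍ) _ (effrosSigma ℍ) Z
  inv : ∀ (φ : ℍ ≃ᵢ ℍ) (K : Set ℍ),
      IsCompact K → P {ω | (Z ω ∩ K).Nonempty} = P {ω | (Z ω ∩ φ '' K).Nonempty}
  FKG : ∀ g h : Set ℍ → ℝ,
      Monotone g → Monotone h →
      @Measurable (Set ℍ) ℝ (effrosSigma ℍ) _ g →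
      @Measurable (Set ℍ) ℝ (effrosSigma ℍ) _ h →
      (∃ M, ∀ s, |g s| ≤ M) → (∃ M, ∀ s, |h s| ≤ M) →
      (∫ ω, g (Z ω) ∂P) * (∫ ω, h (Z ω) ∂P) ≤ ∫ ω, g (Z ω) * h (Z ω) ∂P
  R_pos : 0 < R₀
  indep : ∀ A B : Set ℍ, (∀ a ∈ A, ∀ b ∈ B, R₀ ≤ dist a b) →
      Indep (FA Z A) (FA Z B) P

section
variable {Ω : Type*} {Z : Ω → Set ℍ}

lemma Inc.inter {E F : Set Ω} (hE : Inc Z E) (hF : Inc Z F) : Inc Z (E ∩ F) := by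
  obtain ⟨T, h1, h2, rfl⟩ := hE
  obtain ⟨T', h1', h2', rfl⟩ := hF
  exact ⟨T ∩ T', h1.inter h1', h2.inter h2', rfl⟩

lemma Inc.union {E F : Set Ω} (hE : Inc Z E) (hF : Inc Z F) : Inc Z (E ∪ F) := by
  obtain ⟨T, h1, h2, rfl⟩ := hE
  obtain ⟨T', h1', h2', rfl⟩ := hF
  exact ⟨T ∪ T', h1.union h1', h2.union h2', rfl⟩

lemma FA_mono {A B : Set ℍ} (hA : IsClosed A) (hAB : A ⊆ B) : FA Z A ≤ FA Z B := by
  rintro _ ⟨T, hT, rfl⟩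
  refine ⟨_, meas_inter hA hT, ?_⟩
  ext ω
  simp only [mem_preimage, inter_assoc, inter_eq_self_of_subset_right hAB]

lemma EM.fa {A : Set ℍ} {Q : Set ℍ → Prop} (h : EM A Q) (hZ : ∀ ω, IsClosed (Z ω)) :
    MeasurableSet[FA Z A] {ω | Q (Z ω)} := by
  obtain ⟨T, h1, h3⟩ := h
  exact ⟨T, h1, by ext ω; simp [h3 _ (hZ ω)]⟩

lemma EInc.inc {A : Set ℍ} {Q : Set ℍ → Prop} (h : EInc A Q) (hA : IsClosed A) (hZ : ∀ ω, IsClosed (Z ω)) :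
    Inc Z {ω | Q (Z ω)} := by
  obtain ⟨T, h1, h2, h3⟩ := h
  exact ⟨_, meas_inter hA h1, fun s t hst hs => h2 (inter_subset_inter_left A hst) hs,
    by ext ω; simp [h3 _ (hZ ω)]⟩

variable [MeasurableSpace Ω] {P : Measure Ω} [IsProbabilityMeasure P] {R₀ : ℝ}

lemma Perc.FA_le (hP : Perc P Z R₀) {A : Set ℍ} (hA : IsClosed A) : FA Z A ≤ ‹MeasurableSpace Ω› := by
  rintro _ ⟨T, hT, rfl⟩
  exact hP.meas (meas_inter hA hT)

lemma Perc.ms (hP : Perc P Z R₀) {A : Set ℍ} {Q : Set ℍ → Prop} (h : EM A Q) (hA : IsClosed A) :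
    MeasurableSet {ω | Q (Z ω)} := hP.FA_le hA _ (h.fa hP.closed)

lemma Perc.fkg (hP : Perc P Z R₀) {E F : Set Ω} (hE : Inc Z E) (hF : Inc Z F) : P.real E * P.real F ≤ P.real (E ∩ F) := by
  classical
  obtain ⟨T, h1, h2, rfl⟩ := hE
  obtain ⟨T', h1', h2', rfl⟩ := hF
  have hm : ∀ T : Set (Set ℍ), IsUpperSet T → Monotone (T.indicator (fun _ => (1:ℝ))) := by
    intro T hT s t hst
    by_cases hs : s ∈ T
    · simp [hs, hT hst hs]
    · simp only [hs, not_false_eq_true, indicator_of_notMem]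
      exact indicator_nonneg (fun _ _ => zero_le_one) _
  have hb : ∀ T : Set (Set ℍ), ∃ M, ∀ s, |T.indicator (fun _ => (1:ℝ)) s| ≤ M := by
    refine fun T => ⟨1, fun s => ?_⟩
    by_cases hs : s ∈ T <;> simp [hs]
  have hme : ∀ T : Set (Set ℍ), MeasurableSet[effrosSigma ℍ] T →
      @Measurable _ _ (effrosSigma ℍ) _ (T.indicator (fun _ => (1:ℝ))) := by
    intro T hT
    let _ : MeasurableSpace (Set ℍ) := effrosSigma ℍ
    exact measurable_const.indicator hT
  have := hP.FKG _ _ (hm T h2) (hm T' h2') (hme T h1) (hme T' h1') (hb T) (hb T')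
  have e : ∀ T : Set (Set ℍ), MeasurableSet[effrosSigma ℍ] T → ∫ ω, T.indicator (fun _ => (1:ℝ)) (Z ω) ∂P = P.real (Z ⁻¹' T) := by
    intro T hT
    rw [← integral_indicator_one (hP.meas hT)]
    rfl
  have e2 : ∀ s, T.indicator (fun _ => (1:ℝ)) s * T'.indicator (fun _ => (1:ℝ)) s = (T ∩ T').indicator (fun _ => (1:ℝ)) s := by
    intro s
    by_cases h : s ∈ T <;> by_cases h' : s ∈ T' <;> simp [h, h']
  simp only [e2] at this
  rwa [e T h1, e T' h1', e _ (h1.inter h1')] at this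

lemma Perc.ind (hP : Perc P Z R₀) {A B : Set ℍ} (hAB : ∀ a ∈ A, ∀ b ∈ B, R₀ ≤ dist a b) {E F : Set Ω}
    (hE : MeasurableSet[FA Z A] E) (hF : MeasurableSet[FA Z B] F) :
    P.real (E ∩ F) = P.real E * P.real F := by
  have := (Indep_iff _ _ _).1 (hP.indep A B hAB) E F hE hF
  simp only [measureReal_def, this, ENNReal.toReal_mul]

lemma Perc.law (hP : Perc P Z R₀) {Q : Set ℍ → Prop} (h : EM univ Q) (Φ : ℍ ≃ᵢ ℍ) :
    P.real {ω | Q (Z ω)} = P.real {ω | Q (Φ '' Z ω)} := by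
  obtain ⟨T, h1, h3⟩ := h
  have hpre : ∀ (K : Set ℍ) ω, (Φ '' Z ω ∩ K).Nonempty ↔ (Z ω ∩ Φ.symm '' K).Nonempty := by
    intro K ω
    constructor
    · rintro ⟨_, ⟨x, hx, rfl⟩, hK⟩
      exact ⟨x, hx, _, hK, by simp⟩
    · rintro ⟨_, hx, y, hy, rfl⟩
      exact ⟨y, ⟨_, hx, by simp⟩, hy⟩
  have hmeas' : @Measurable Ω (Set ℍ) _ (effrosSigma ℍ) fun ω => Φ '' Z ω := by
    refine @measurable_generateFrom _ _ _ _ _ ?_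
    rintro _ ⟨K, hK, rfl⟩
    have : (fun ω => Φ '' Z ω) ⁻¹' {s | (s ∩ K).Nonempty} = Z ⁻¹' {s | (s ∩ Φ.symm '' K).Nonempty} := by
      ext ω; exact hpre K ω
    rw [this]
    exact hP.meas (meas_hit (hK.image Φ.symm.continuous))
  have key : @Measure.map _ _ _ (effrosSigma ℍ) Z P = @Measure.map _ _ _ (effrosSigma ℍ) (fun ω => Φ '' Z ω) P := by
    let _ : MeasurableSpace (Set ℍ) := effrosSigma ℍ
    have : IsProbabilityMeasure (P.map Z) := Measure.isProbabilityMeasure_map hP.meas.aemeasurable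
    have : IsProbabilityMeasure (P.map fun ω => Φ '' Z ω) := Measure.isProbabilityMeasure_map hmeas'.aemeasurable
    refine ext_of_generate_finite {T | ∃ K : Set ℍ, IsCompact K ∧ T = {s | (s ∩ K).Nonempty}ᶜ} ?_ ?_ ?_ ?_
    · apply le_antisymm
      · refine MeasurableSpace.generateFrom_le ?_
        rintro _ ⟨K, hK, rfl⟩
        rw [← compl_compl {s : Set ℍ | (s ∩ K).Nonempty}]
        exact (MeasurableSpace.measurableSet_generateFrom (s := {T | ∃ K : Set ℍ, IsCompact K ∧ T = {s | (s ∩ K).Nonempty}ᶜ}) ⟨K, hK, rfl⟩).compl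
      · refine MeasurableSpace.generateFrom_le ?_
        rintro _ ⟨K, hK, rfl⟩
        exact (meas_hit hK).compl
    · rintro _ ⟨K, hK, rfl⟩ _ ⟨K', hK', rfl⟩ _
      refine ⟨K ∪ K', hK.union hK', ?_⟩
      rw [← compl_union]
      congr 1
      ext s
      simp [inter_union_distrib_left, union_nonempty]
    · rintro _ ⟨K, hK, rfl⟩
      rw [prob_compl_eq_one_sub (meas_hit hK), prob_compl_eq_one_sub (meas_hit hK),
        Measure.map_apply hP.meas (meas_hit hK), Measure.map_apply hmeas' (meas_hit hK)]
      congr 1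
      have e1 := hP.inv Φ.symm K hK
      change P {ω | (Z ω ∩ K).Nonempty} = P {ω | (Φ '' Z ω ∩ K).Nonempty}
      simp only [hpre]
      exact e1
    · simp
  have e1 : {ω | Q (Z ω)} = Z ⁻¹' T := by
    ext ω; simp [h3 _ (hP.closed ω)]
  have e2 : {ω | Q (Φ '' Z ω)} = (fun ω => Φ '' Z ω) ⁻¹' T := by
    ext ω
    have : IsClosed (Φ '' Z ω) := Φ.toHomeomorph.isClosedMap _ (hP.closed ω)
    simp [h3 _ this]
  rw [e1, e2, measureReal_def, measureReal_def, ← @Measure.map_apply _ _ _ (effrosSigma ℍ) _ _ hP.meas _ h1, key,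
    @Measure.map_apply _ _ _ (effrosSigma ℍ) _ _ hmeas' _ h1]

end
end PL

set_option linter.unusedSectionVars false
namespace PL
open UpperHalfPlane

section
variable {Ω : Type*} {Z : Ω → Set ℍ}
variable [mΩ : MeasurableSpace Ω] {P : Measure Ω} [IsProbabilityMeasure P] {R₀ : ℝ}

lemma Inc.ms {E : Set Ω} (h : Inc Z E) (hP : Perc P Z R₀) : MeasurableSet E := by
  obtain ⟨T, h1, h2, rfl⟩ := h
  exact hP.meas h1

lemma inc_hit {A K : Set ℍ} (hA : IsClosed A) (hK : IsCompact K) : Inc Z {ω | (Z ω ∩ A ∩ K).Nonempty} := by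
  refine ⟨_, meas_hit (hK.inter_left hA), ?_, ?_⟩
  · rintro s t hst ⟨x, hx, hxK⟩
    exact ⟨x, hst hx, hxK⟩
  · ext ω; simp [inter_assoc]

theorem Perc.condFKG (hP : Perc P Z R₀) {A B : Set ℍ} (hA : IsClosed A)
    (hAB : ∀ a ∈ A, ∀ b ∈ B, R₀ ≤ dist a b) {f : Set Ω} (hf : Inc Z f) (hfB : MeasurableSet[FA Z B] f)
    {e x : Set Ω} (he : Inc Z e) (hx : MeasurableSet[FA Z A] x) :
    P.real f * P.real (e ∩ x) ≤ P.real (f ∩ (e ∩ x)) := by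
  have hfm := hf.ms hP
  have hle := hP.FA_le hA
  let Pr : Set Ω → Prop := fun x => ∀ e, Inc Z e → P.real f * P.real (e ∩ x) ≤ P.real (f ∩ (e ∩ x))
  have hdisj : ∀ x y, MeasurableSet y → Disjoint x y → Pr x → Pr y → Pr (x ∪ y) := by
    intro x y hy hd h1 h2 e he
    have e1 : P.real (e ∩ (x ∪ y)) = P.real (e ∩ x) + P.real (e ∩ y) := by
      rw [inter_union_distrib_left, measureReal_union _ ((he.ms hP).inter hy)]
      exact hd.mono inter_subset_right inter_subset_right
    have e2 : P.real (f ∩ (e ∩ (x ∪ y))) = P.real (f ∩ (e ∩ x)) + P.real (f ∩ (e ∩ y)) := by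
      rw [inter_union_distrib_left, inter_union_distrib_left, measureReal_union _ (hfm.inter ((he.ms hP).inter hy))]
      exact hd.mono (inter_subset_right.trans inter_subset_right) (inter_subset_right.trans inter_subset_right)
    rw [e1, e2]
    linarith [h1 e he, h2 e he]
  have hmono : ∀ x : ℕ → Set Ω, Monotone x → (∀ n, Pr (x n)) → Pr (⋃ n, x n) := by
    intro x hx h e he
    have t1 : Filter.Tendsto (fun n => P.real (e ∩ x n)) Filter.atTop (nhds (P.real (e ∩ ⋃ n, x n))) := by
      rw [inter_iUnion]
      exact (ENNReal.tendsto_toReal (measure_ne_top _ _)).comp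
        (tendsto_measure_iUnion_atTop fun i j hij => inter_subset_inter_right _ (hx hij))
    have t2 : Filter.Tendsto (fun n => P.real (f ∩ (e ∩ x n))) Filter.atTop (nhds (P.real (f ∩ (e ∩ ⋃ n, x n)))) := by
      rw [inter_iUnion, inter_iUnion]
      exact (ENNReal.tendsto_toReal (measure_ne_top _ _)).comp
        (tendsto_measure_iUnion_atTop fun i j hij => inter_subset_inter_right _ (inter_subset_inter_right _ (hx hij)))
    exact le_of_tendsto_of_tendsto' (t1.const_mul _) t2 fun n => h n e he
  have hanti : ∀ x : ℕ → Set Ω, (∀ n, MeasurableSet (x n)) → Antitone x → (∀ n, Pr (x n)) → Pr (⋂ n, x n) := by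
    intro x hxm hx h e he
    have hem := he.ms hP
    have t1 : Filter.Tendsto (fun n => P.real (e ∩ x n)) Filter.atTop (nhds (P.real (e ∩ ⋂ n, x n))) := by
      rw [inter_iInter]
      exact (ENNReal.tendsto_toReal (measure_ne_top _ _)).comp
        (tendsto_measure_iInter_atTop (fun n => (hem.inter (hxm n)).nullMeasurableSet)
          (fun i j hij => inter_subset_inter_right _ (hx hij)) ⟨0, measure_ne_top _ _⟩)
    have t2 : Filter.Tendsto (fun n => P.real (f ∩ (e ∩ x n))) Filter.atTop (nhds (P.real (f ∩ (e ∩ ⋂ n, x n)))) := by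
      rw [inter_iInter, inter_iInter]
      exact (ENNReal.tendsto_toReal (measure_ne_top _ _)).comp
        (tendsto_measure_iInter_atTop (fun n => (hfm.inter (hem.inter (hxm n))).nullMeasurableSet)
          (fun i j hij => inter_subset_inter_right _ (inter_subset_inter_right _ (hx hij))) ⟨0, measure_ne_top _ _⟩)
    exact le_of_tendsto_of_tendsto' (t1.const_mul _) t2 fun n => h n e he
  let 𝒯 : Set Ω → Prop := fun h => MeasurableSet[FA Z A] h ∧
    ∀ x, MeasurableSet[FA Z A] x → Pr x → Pr (x ∩ h) ∧ Pr (x ∩ hᶜ)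
  have hgen : ∀ h, MeasurableSet[FA Z A] h → 𝒯 h := by
    intro h hh
    have heq : FA Z A = MeasurableSpace.generateFrom (preimage (fun ω => Z ω ∩ A) ''
        {T | ∃ K : Set ℍ, IsCompact K ∧ T = {s | (s ∩ K).Nonempty}}) := MeasurableSpace.comap_generateFrom
    have hh' := hh
    rw [heq] at hh'
    induction h, hh' using MeasurableSpace.generateFrom_induction with
    | hC t ht _ =>
      refine ⟨hh, ?_⟩
      obtain ⟨_, ⟨K, hK, rfl⟩, rfl⟩ := ht
      have hi : Inc Z ((fun ω => Z ω ∩ A) ⁻¹' {s | (s ∩ K).Nonempty}) := inc_hit hA hK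
      set h := (fun ω => Z ω ∩ A) ⁻¹' {s | (s ∩ K).Nonempty}
      intro x hx hPr
      constructor
      · intro e he
        have := hPr (e ∩ h) (he.inter hi)
        rwa [inter_assoc, inter_comm h x] at this
      · intro e he
        have h1 := hPr (e ∪ h) (he.union hi)
        have h2 : P.real ((h ∩ x) ∩ f) = P.real (h ∩ x) * P.real f :=
          hP.ind hAB (hh.inter hx) hfB
        have hxm := hle _ hx
        have hhm := hi.ms hP
        have e0 : (e ∪ h) ∩ x = (e ∩ (x ∩ hᶜ)) ∪ (h ∩ x) := by
          ext ω; simp only [mem_inter_iff, mem_union, mem_compl_iff]; tauto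
        have hd : Disjoint (e ∩ (x ∩ hᶜ)) (h ∩ x) := by
          rw [Set.disjoint_left]; rintro ω ⟨_, _, h3⟩ ⟨h4, _⟩; exact h3 h4
        rw [e0, measureReal_union hd (hhm.inter hxm), inter_union_distrib_left,
          measureReal_union (hd.mono inter_subset_right inter_subset_right) (hfm.inter (hhm.inter hxm)),
          inter_comm f (h ∩ x), h2] at h1
        linarith
    | empty =>
      refine ⟨hh, fun x hx hPr => ⟨?_, by simpa using hPr⟩⟩
      intro e he; simp
    | compl t ht ih =>
      rw [← heq] at ht
      exact ⟨hh, fun x hx hPr => by rw [compl_compl]; exact ((ih ht).2 x hx hPr).symm⟩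
    | iUnion t ht ih =>
      refine ⟨hh, fun x hx hPr => ?_⟩
      have ht' : ∀ n, MeasurableSet[FA Z A] (t n) := by rw [heq]; exact ht
      have hT : ∀ n, 𝒯 (t n) := fun n => ih n (ht' n)
      let U : ℕ → Set Ω := fun n => ⋃ i ∈ Finset.range n, t i
      have hUs : ∀ n, U (n+1) = U n ∪ t n := by
        intro n; ext ω; simp only [U, mem_iUnion, Finset.mem_range, mem_union, exists_prop]
        constructor
        · rintro ⟨i, hi, h⟩
          rcases Nat.lt_succ_iff_lt_or_eq.1 hi with h1 | rfl
          · exact Or.inl ⟨i, h1, h⟩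
          · exact Or.inr h
        · rintro (⟨i, hi, h⟩ | h)
          · exact ⟨i, by omega, h⟩
          · exact ⟨n, by omega, h⟩
      have hUm : ∀ n, MeasurableSet[FA Z A] (U n) := fun n =>
        Finset.measurableSet_biUnion _ fun i _ => ht' i
      have hmonoU : Monotone U := monotone_nat_of_le_succ fun n => by rw [hUs]; exact subset_union_left
      have hU : ⋃ n, U n = ⋃ n, t n := by
        apply subset_antisymm
        · exact iUnion_subset fun n => iUnion₂_subset fun i _ => subset_iUnion t i
        · refine iUnion_subset fun n => ?_
          refine subset_trans ?_ (subset_iUnion U (n+1))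
          rw [hUs]; exact subset_union_right
      have hind : ∀ n, Pr (x ∩ U n) ∧ Pr (x ∩ (U n)ᶜ) := by
        intro n
        induction n with
        | zero =>
          constructor
          · intro e he; simp [U]
          · simpa [U] using hPr
        | succ n ihn =>
          have h3 := (hT n).2 (x ∩ (U n)ᶜ) (hx.inter (hUm n).compl) ihn.2
          rw [hUs]
          constructor
          · have : x ∩ (U n ∪ t n) = (x ∩ U n) ∪ (x ∩ (U n)ᶜ ∩ t n) := by
              ext ω; simp only [mem_inter_iff, mem_union, mem_compl_iff]; tauto
            rw [this]
            refine hdisj _ _ (hle _ ((hx.inter (hUm n).compl).inter (ht' n))) ?_ ihn.1 h3.1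
            rw [Set.disjoint_left]; rintro ω ⟨_, h4⟩ ⟨⟨_, h5⟩, _⟩; exact h5 h4
          · rw [compl_union, ← inter_assoc]; exact h3.2
      rw [← hU]
      constructor
      · rw [inter_iUnion]
        exact hmono _ (fun i j hij => inter_subset_inter_right _ (hmonoU hij)) fun n => (hind n).1
      · rw [compl_iUnion, inter_iInter]
        exact hanti _ (fun n => hle _ (hx.inter (hUm n).compl))
          (fun i j hij => inter_subset_inter_right _ (compl_subset_compl.2 (hmonoU hij))) fun n => (hind n).2
  have huniv : Pr univ := by
    intro e he
    rw [inter_univ]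
    exact hP.fkg hf he
  have := ((hgen x hx).2 univ MeasurableSet.univ huniv).1 e he
  rwa [univ_inter] at this

end
end PL

set_option linter.unusedSectionVars false
namespace PL
open UpperHalfPlane

/-! ### Part 3: the bound for partially blocked boxes -/

lemma count_comp {Y : Type*} [TopologicalSpace Y] [Finite (ConnectedComponents Y)] (I : Finset ℕ) (b : ℕ → Y)
    (h : ∀ i ∈ I, ∀ i' ∈ I, ∀ i'' ∈ I, i < i' → i' < i'' →
      ∃ g : Y → ℝ, Continuous g ∧ g (b i) < 0 ∧ 0 < g (b i'') ∧ ∀ y, g y ≠ 0) :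
    I.card ≤ 2 * Nat.card (ConnectedComponents Y) := by
  classical
  have := Fintype.ofFinite (ConnectedComponents Y)
  have h1 : I.card ≤ 2 * (I.image fun i => ConnectedComponents.mk (b i)).card := by
    apply Finset.card_le_mul_card_image
    intro k _
    set F := I.filter fun i => ConnectedComponents.mk (b i) = k
    rcases F.eq_empty_or_nonempty with hF | hF
    · simp [hF]
    have : F ⊆ {F.min' hF, F.max' hF} := by
      intro i hi
      simp only [Finset.mem_insert, Finset.mem_singleton]
      by_contra hcon
      push Not at hcon
      have l1 : F.min' hF < i := lt_of_le_of_ne (F.min'_le i hi) hcon.1.symm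
      have l2 : i < F.max' hF := lt_of_le_of_ne (F.le_max' i hi) hcon.2
      have m1 := Finset.mem_filter.1 (F.min'_mem hF)
      have m2 := Finset.mem_filter.1 (F.max'_mem hF)
      have mi := Finset.mem_filter.1 hi
      obtain ⟨g, hg, g1, g2, g3⟩ := h _ m1.1 i mi.1 _ m2.1 l1 l2
      have heq := m1.2.trans m2.2.symm
      rw [ConnectedComponents.coe_eq_coe'] at heq
      have hpre := isPreconnected_connectedComponent (x := b (F.max' hF))
      obtain ⟨y, _, hy⟩ := hpre.intermediate_value heq mem_connectedComponent hg.continuousOn ⟨g1.le, g2.le⟩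
      exact g3 y hy
    exact (Finset.card_le_card this).trans Finset.card_le_two
  refine h1.trans (Nat.mul_le_mul_left 2 ?_)
  rw [Nat.card_eq_fintype_card]
  exact Finset.card_le_univ _

/-- All standing assumptions in polar form. -/
structure Setup {Ω : Type*} [MeasurableSpace Ω] (P : Measure Ω) (Z : Ω → Set ℍ) (R₀ : ℝ) {o : ℍ}
    (X : Polar o) (f : ℝ → ℝ) (α c₁ c₂ : ℝ) : Prop extends Perc P Z R₀ where
  α0 : 0 ≤ α
  α1 : α < 1 / 2
  c1 : 0 < c₁
  c2 : 0 < c₂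
  seg : ∀ φ a b, a < b → P.real {ω | ∀ t ∈ Icc a b, X.p φ t ∈ Z ω} = f (b - a)
  lo : ∀ r, 1 ≤ r → c₁ * Real.exp (-α * r) ≤ f r
  hi : ∀ r, 1 ≤ r → f r ≤ c₂ * Real.exp (-α * r)
  comp : ∀ᵐ ω ∂P, Finite (ConnectedComponents ↥(Metric.closedBall o 1 \ Z ω))
  compExp : ∫⁻ ω, (Nat.card (ConnectedComponents ↥(Metric.closedBall o 1 \ Z ω)) : ℝ≥0∞) ∂P < ∞

namespace Polar
variable {o : ℍ} (X : Polar o)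

/-- The box is partially visible but not fully visible at times `[j, j+1]`. -/
def GQ (u w j : ℝ) (s : Set ℍ) : Prop :=
  X.Vis (Icc u (u + w)) (Icc (j - 1) (j + 2)) s ∧ ¬ (X.reg (Icc u (u+w)) (Icc j (j+1)) ⊆ s)

lemma em_GQ (u w j : ℝ) : EM (X.reg (Icc u (u+w)) (Icc (j-1) (j+2))) (X.GQ u w j) := by
  refine (X.einc_vis isCompact_Icc _).em.and (EM.not ?_)
  exact (einc_subset _).em.mono (X.isCompact_reg isCompact_Icc isCompact_Icc).isClosed
    (X.reg_mono subset_rfl (Icc_subset_Icc (by linarith) (by linarith)))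

lemma isClosed_reg {K T : Set ℝ} (hK : IsCompact K) (hT : IsCompact T) : IsClosed (X.reg K T) :=
  (X.isCompact_reg hK hT).isClosed

/-- the separating function -/
noncomputable def sep (θ : ℝ) (z : ℍ) : ℝ := X.S z * Real.cos θ - X.C z * Real.sin θ

lemma sep_p (θ φ t : ℝ) : X.sep θ (X.p φ t) = Real.sinh t * Real.sin (φ - θ) := by
  unfold sep; rw [X.S_p, X.C_p, Real.sin_sub]; ring

lemma sep_cont (θ : ℝ) : Continuous (X.sep θ) := by
  have := X.contC; have := X.contS; unfold sep; fun_prop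

lemma sep_zero {θ : ℝ} {z : ℍ} (h : X.sep θ z = 0) : ∃ t, z = X.p θ t := by
  obtain ⟨φ, t, ht, rfl⟩ := X.surj z
  rw [X.sep_p] at h
  rcases mul_eq_zero.1 h with h | h
  · rw [Real.sinh_eq_zero] at h; subst h; exact ⟨0, by rw [X.zero, X.zero]⟩
  · obtain ⟨n, hn⟩ := Real.sin_eq_zero_iff.1 h
    rcases Int.even_or_odd n with he | ho
    · refine ⟨t, ?_⟩
      obtain ⟨k, hk⟩ := he
      have : φ = θ + k * (2 * Real.pi) := by rw [hk] at hn; push_cast at hn; linarith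
      rw [this]; apply X.eq_of_coords <;> simp
    · refine ⟨-t, ?_⟩
      obtain ⟨k, hk⟩ := ho
      have : φ = θ + Real.pi + k * (2 * Real.pi) := by rw [hk] at hn; push_cast at hn; linarith
      rw [X.neg, this]; apply X.eq_of_coords <;> simp

lemma sinh_mul_exp {j t : ℝ} (h0 : 0 ≤ t) (ht : t ≤ j + 1) : |Real.sinh t| * (1/20 * Real.exp (-j)) ≤ 1/10 := by
  rw [abs_of_nonneg (Real.sinh_nonneg_iff.2 h0), Real.sinh_eq]
  have h1 : Real.exp t ≤ Real.exp 1 * Real.exp j := by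
    rw [← Real.exp_add]; exact Real.exp_le_exp.2 (by linarith)
  have h2 : Real.exp 1 < 2.7182818286 := Real.exp_one_lt_d9
  have h3 : Real.exp j * Real.exp (-j) = 1 := by rw [← Real.exp_add]; simp
  have h4 : 0 < Real.exp (-j) := Real.exp_pos _
  have h5 : 0 < Real.exp (-t) := Real.exp_pos _
  have h6 := mul_le_mul_of_nonneg_right h1 h4.le
  have h7 := mul_pos h5 h4
  nlinarith [Real.exp_pos j]

lemma G_count {u w j : ℝ} (hj : 0 ≤ j) (hw : 0 < w) (m : ℕ) (hm : 2 * m * w ≤ 1/20 * Real.exp (-j))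
    (Φ : ℍ ≃ᵢ ℍ) (hΦ : Φ (X.p u (j + 1/2)) = o) (s : Set ℍ)
    [Finite (ConnectedComponents ↥(Metric.closedBall o 1 \ s))] (I : Finset ℕ)
    (hI : ∀ i ∈ I, i < m ∧ X.GQ (u + 2 * i * w) w j (Φ.symm '' s)) :
    I.card ≤ 2 * Nat.card (ConnectedComponents ↥(Metric.closedBall o 1 \ s)) := by
  classical
  rcases I.eq_empty_or_nonempty with rfl | hne
  · simp
  have hdo : ∀ x, dist (Φ x) o = dist x (X.p u (j+1/2)) := by
    intro x
    have := Φ.dist_eq x (X.p u (j+1/2))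
    rwa [hΦ] at this
  have hrange : ∀ i : ℕ, i < m → ∀ φ ∈ Icc (u + 2 * i * w) (u + 2 * i * w + w),
      |φ - u| ≤ 1/20 * Real.exp (-j) := by
    intro i hi φ hφ
    have h1 : (i : ℝ) + 1 ≤ m := by exact_mod_cast hi
    have h2 : (0:ℝ) ≤ i := Nat.cast_nonneg i
    rw [abs_of_nonneg (by nlinarith [hφ.1])]
    nlinarith [hφ.2]
  have hb : ∀ i ∈ I, ∃ φ ∈ Icc (u + 2 * i * w) (u + 2 * i * w + w), ∃ t ∈ Icc j (j+1),
      Φ (X.p φ t) ∈ Metric.closedBall o 1 \ s := by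
    intro i hi
    obtain ⟨him, _, h2⟩ := hI i hi
    rw [not_subset] at h2
    obtain ⟨_, ⟨⟨φ, t⟩, ⟨h3, h4⟩, rfl⟩, h5⟩ := h2
    refine ⟨φ, h3, t, h4, ?_, fun h6 => h5 ⟨_, h6, by simp⟩⟩
    rw [Metric.mem_closedBall, hdo]
    have d1 := dist_triangle (X.p φ t) (X.p u t) (X.p u (j+1/2))
    have d2 := X.dist_arc φ u t
    have d3 := mul_le_mul_of_nonneg_left (hrange i him φ h3) (abs_nonneg (Real.sinh t))
    have d4 := sinh_mul_exp (hj.trans h4.1) h4.2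
    rw [X.dist_same] at d1
    have d5 : |t - (j + 1/2)| ≤ 1/2 := by rw [abs_le]; constructor <;> linarith [h4.1, h4.2]
    linarith
  choose! φ hφ t ht hbi using hb
  obtain ⟨i0, hi0⟩ := hne
  let b : ℕ → ↥(Metric.closedBall o 1 \ s) := fun i =>
    if h : i ∈ I then ⟨_, hbi i h⟩ else ⟨_, hbi i0 hi0⟩
  have hbval : ∀ i (h : i ∈ I), (b i).1 = Φ (X.p (φ i) (t i)) := by
    intro i h; simp only [b, h, dif_pos]
  refine count_comp I b fun i hi i' hi' i'' hi'' l1 l2 => ?_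
  obtain ⟨hm', ⟨θ, hθ, hvis⟩, _⟩ := hI i' hi'
  have hvis' : ∀ t ∈ Icc (j-1) (j+2), Φ (X.p θ t) ∈ s := by
    intro t ht
    obtain ⟨y, hy, hy2⟩ := hvis t ht
    rw [← hy2]; simpa using hy
  have hlt : φ i < θ := by
    have h1 : (i : ℝ) + 1 ≤ i' := by exact_mod_cast l1
    nlinarith [(hφ i hi).2, hθ.1]
  have hlt' : θ < φ i'' := by
    have h1 : (i' : ℝ) + 1 ≤ i'' := by exact_mod_cast l2
    nlinarith [(hφ i'' hi'').1, hθ.2]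
  have hpos : ∀ i ∈ I, 0 < t i := by
    intro i hi
    refine lt_of_le_of_ne (hj.trans (ht i hi).1) fun h0 => ?_
    have h1 := (hbi i hi).2
    have := ht i hi
    rw [← h0] at h1 this
    rw [X.zero, ← X.zero θ] at h1
    exact h1 (hvis' 0 ⟨by linarith [this.1], by linarith [this.2]⟩)
  have hsmall : ∀ i ∈ I, |φ i - θ| < Real.pi := by
    intro i hi
    have e1 := hrange i (hI i hi).1 _ (hφ i hi)
    have e2 := hrange i' hm' _ hθ
    have e3 := abs_sub_le (φ i) u θ
    rw [abs_sub_comm u θ] at e3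
    have e4 : Real.exp (-j) ≤ 1 := Real.exp_le_one_iff.2 (by linarith)
    linarith [Real.pi_gt_three]
  refine ⟨fun y => X.sep θ (Φ.symm y.1), (X.sep_cont θ).comp (Φ.symm.continuous.comp continuous_subtype_val), ?_, ?_, ?_⟩
  · simp only [hbval i hi, IsometryEquiv.symm_apply_apply, X.sep_p]
    apply mul_neg_of_pos_of_neg (Real.sinh_pos_iff.2 (hpos i hi))
    have := abs_lt.1 (hsmall i hi)
    exact Real.sin_neg_of_neg_of_neg_pi_lt (by linarith) (by linarith)
  · simp only [hbval i'' hi'', IsometryEquiv.symm_apply_apply, X.sep_p]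
    apply mul_pos (Real.sinh_pos_iff.2 (hpos i'' hi''))
    have := abs_lt.1 (hsmall i'' hi'')
    exact Real.sin_pos_of_pos_of_lt_pi (by linarith) (by linarith)
  · rintro ⟨y, hy1, hy2⟩ h0
    obtain ⟨τ, hτ⟩ := X.sep_zero h0
    have hyτ : y = Φ (X.p θ τ) := by rw [← hτ]; simp
    apply hy2
    rw [hyτ]
    apply hvis'
    rw [Metric.mem_closedBall, hyτ, hdo] at hy1
    have d1 := dist_triangle (X.p θ τ) (X.p u (j+1/2)) (X.p θ (j+1/2))
    have d2 := X.dist_arc u θ (j+1/2)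
    have d3 := mul_le_mul_of_nonneg_left (hrange i' hm' θ hθ) (abs_nonneg (Real.sinh (j+1/2)))
    have d4 := sinh_mul_exp (j := j) (t := j + 1/2) (by linarith) (by linarith)
    rw [X.dist_same] at d1
    rw [abs_sub_comm u θ] at d2
    have := abs_le.1 (d1.trans (by linarith : _ ≤ (3:ℝ)/2))
    constructor <;> linarith [this.1, this.2]

end Polar

section
variable {Ω : Type*} {Z : Ω → Set ℍ}
variable [mΩ : MeasurableSpace Ω] {P : Measure Ω} [IsProbabilityMeasure P] {R₀ : ℝ}
variable {o : ℍ} {X : Polar o} {f : ℝ → ℝ} {α c₁ c₂ : ℝ}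

lemma Perc.ms_comp (hP : Perc P Z R₀) {A : Set ℍ} (hA : IsClosed A) {Q : Set ℍ → Prop} (hQ : EM A Q) (Φ : ℍ ≃ᵢ ℍ) :
    MeasurableSet {ω | Q (Φ '' Z ω)} := by
  obtain ⟨T, h1, h3⟩ := hQ
  have hmeas' : @Measurable Ω (Set ℍ) _ (effrosSigma ℍ) fun ω => Φ '' Z ω := by
    refine @measurable_generateFrom _ _ _ _ _ ?_
    rintro _ ⟨K, hK, rfl⟩
    have : (fun ω => Φ '' Z ω) ⁻¹' {s | (s ∩ K).Nonempty} = Z ⁻¹' {s | (s ∩ Φ.symm '' K).Nonempty} := by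
      ext ω
      constructor
      · rintro ⟨_, ⟨x, hx, rfl⟩, hK⟩
        exact ⟨x, hx, _, hK, by simp⟩
      · rintro ⟨_, hx, y, hy, rfl⟩
        exact ⟨y, ⟨_, hx, by simp⟩, hy⟩
    rw [this]
    exact hP.meas (meas_hit (hK.image Φ.symm.continuous))
  have e2 : {ω | Q (Φ '' Z ω)} = (fun ω => Φ '' Z ω) ⁻¹' ((fun s => s ∩ A) ⁻¹' T) := by
    ext ω
    have : IsClosed (Φ '' Z ω) := Φ.toHomeomorph.isClosedMap _ (hP.closed ω)
    simp [h3 _ this]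
  rw [e2]
  exact hmeas' (meas_inter hA h1)

lemma GQ_rot {u w j β : ℝ} {s : Set ℍ} {Φ : ℍ ≃ᵢ ℍ} (hΦ : ∀ φ t, Φ (X.p φ t) = X.p (φ + β) t) :
    X.GQ (u + β) w j (Φ '' s) ↔ X.GQ u w j s := by
  have hmem : ∀ φ t, X.p (φ + β) t ∈ Φ '' s ↔ X.p φ t ∈ s := by
    intro φ t; rw [← hΦ]; exact Φ.injective.mem_set_image
  unfold Polar.GQ
  apply and_congr
  · unfold Polar.Vis
    constructor
    · rintro ⟨φ, hφ, h⟩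
      refine ⟨φ - β, ⟨by linarith [hφ.1], by linarith [hφ.2]⟩, fun t ht => ?_⟩
      have := h t ht
      rwa [← sub_add_cancel φ β, hmem] at this
    · rintro ⟨φ, hφ, h⟩
      exact ⟨φ + β, ⟨by linarith [hφ.1], by linarith [hφ.2]⟩, fun t ht => (hmem _ _).2 (h t ht)⟩
  · rw [not_iff_not]
    unfold Polar.reg
    simp only [image_subset_iff]
    constructor
    · rintro h ⟨φ, t⟩ ⟨h1, h2⟩
      simp only at h1
      have := h (show (φ + β, t) ∈ _ from ⟨⟨by linarith [h1.1], by linarith [h1.2]⟩, h2⟩)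
      exact (hmem _ _).1 this
    · rintro h ⟨φ, t⟩ ⟨h1, h2⟩
      simp only at h1
      have := h (show (φ - β, t) ∈ _ from ⟨⟨by linarith [h1.1], by linarith [h1.2]⟩, h2⟩)
      have := (hmem _ _).2 this
      simpa using this

lemma Setup.G_bound (hS : Setup P Z R₀ X f α c₁ c₂) : ∃ C, 0 < C ∧ ∀ u w j : ℝ, 0 ≤ j → 0 < w →
    P.real {ω | X.GQ u w j (Z ω)} ≤ C * w * Real.exp j := by
  set E := ∫⁻ ω, (Nat.card (ConnectedComponents ↥(Metric.closedBall o 1 \ Z ω)) : ℝ≥0∞) ∂P with hE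
  have hEfin : E ≠ ∞ := hS.compExp.ne
  have hclreg : ∀ u w j, IsClosed (X.reg (Icc u (u+w)) (Icc (j-1) (j+2))) := fun u w j =>
    X.isClosed_reg isCompact_Icc isCompact_Icc
  refine ⟨160 * E.toReal + 80, by positivity, fun u w j hj hw => ?_⟩
  rcases le_or_gt (1/20 * Real.exp (-j)) (4 * w) with hbig | hsmall
  · have h1 : P.real {ω | X.GQ u w j (Z ω)} ≤ 1 := measureReal_le_one
    have h3 : Real.exp j * Real.exp (-j) = 1 := by rw [← Real.exp_add]; simp
    have h4 : 1 ≤ 80 * w * Real.exp j := by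
      have := mul_le_mul_of_nonneg_right hbig (Real.exp_pos j).le
      nlinarith
    have : 0 ≤ 160 * E.toReal * w * Real.exp j := by positivity
    nlinarith
  set M := 1/20 * Real.exp (-j) / (2 * w) with hM
  set m := ⌊M⌋₊ with hm
  have hM2 : 2 ≤ M := by rw [hM, le_div_iff₀ (by positivity)]; linarith
  have hmle : (m : ℝ) ≤ M := Nat.floor_le (by linarith)
  have hmge : M / 2 ≤ m := by have := Nat.lt_floor_add_one M; rw [← hm] at this; linarith
  have hm2 : 2 * m * w ≤ 1/20 * Real.exp (-j) := by
    rw [hM, le_div_iff₀ (by positivity)] at hmle; linarith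
  obtain ⟨Φ, hΦ⟩ := X.move (X.p u (j+1/2))
  have hsame : ∀ i : ℕ, P.real {ω | X.GQ (u + 2 * i * w) w j (Φ.symm '' Z ω)} = P.real {ω | X.GQ u w j (Z ω)} := by
    intro i
    rw [← hS.law ((X.em_GQ _ w j).mono (hclreg _ _ _) (subset_univ _)) Φ.symm]
    obtain ⟨Ψ, hΨ⟩ := X.rot (2 * i * w)
    rw [hS.law ((X.em_GQ _ w j).mono (hclreg _ _ _) (subset_univ _)) Ψ]
    simp only [GQ_rot hΨ]
  have hms : ∀ i : ℕ, MeasurableSet {ω | X.GQ (u + 2 * i * w) w j (Φ.symm '' Z ω)} := fun i =>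
    hS.ms_comp (hclreg _ _ _) (X.em_GQ _ w j) Φ.symm
  have hsum : ∑ i ∈ Finset.range m, P {ω | X.GQ (u + 2 * i * w) w j (Φ.symm '' Z ω)} ≤ 2 * E := by
    classical
    have : ∀ i ∈ Finset.range m, P {ω | X.GQ (u + 2 * i * w) w j (Φ.symm '' Z ω)} =
        ∫⁻ ω, {ω | X.GQ (u + 2 * i * w) w j (Φ.symm '' Z ω)}.indicator 1 ω ∂P := fun i _ =>
      (lintegral_indicator_one (hms i)).symm
    rw [Finset.sum_congr rfl this, ← lintegral_finsetSum' _ (fun i _ => (measurable_one.indicator (hms i)).aemeasurable), hE,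
      ← lintegral_const_mul' _ _ (by norm_num)]
    apply lintegral_mono_ae
    filter_upwards [hS.comp] with ω hω
    have h := X.G_count hj hw m hm2 Φ hΦ (Z ω)
      ((Finset.range m).filter fun i : ℕ => X.GQ (u + 2 * i * w) w j (Φ.symm '' Z ω)) (fun i hi => by
        simpa using hi)
    have e : ∑ i ∈ Finset.range m, {ω | X.GQ (u + 2 * i * w) w j (Φ.symm '' Z ω)}.indicator (1 : Ω → ℝ≥0∞) ω =
        (((Finset.range m).filter fun i : ℕ => X.GQ (u + 2 * i * w) w j (Φ.symm '' Z ω)).card : ℝ≥0∞) := by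
      rw [Finset.card_filter, Nat.cast_sum]
      refine Finset.sum_congr rfl fun i _ => ?_
      by_cases h : X.GQ (u + 2 * i * w) w j (Φ.symm '' Z ω) <;> simp [h]
    rw [e]
    have h' := (Nat.cast_le (α := ℝ≥0∞)).2 h
    rwa [Nat.cast_mul, Nat.cast_ofNat] at h'
  have hsum' : (m : ℝ) * P.real {ω | X.GQ u w j (Z ω)} ≤ 2 * E.toReal := by
    have h1 := ENNReal.toReal_mono (by finiteness) hsum
    rw [ENNReal.toReal_sum (fun i _ => measure_ne_top _ _), ENNReal.toReal_mul] at h1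
    have h2 : ∑ i ∈ Finset.range m, (P {ω | X.GQ (u + 2 * i * w) w j (Φ.symm '' Z ω)}).toReal =
        ∑ i ∈ Finset.range m, P.real {ω | X.GQ u w j (Z ω)} :=
      Finset.sum_congr rfl fun i _ => hsame i
    rw [h2] at h1
    simpa using h1
  set q := P.real {ω | X.GQ u w j (Z ω)} with hq
  have hq0 : 0 ≤ q := measureReal_nonneg
  have h1 : M / 2 * q ≤ 2 * E.toReal := (mul_le_mul_of_nonneg_right hmge hq0).trans hsum'
  have h2 : M = Real.exp (-j) / (40 * w) := by rw [hM]; field_simp; norm_num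
  rw [h2] at h1
  have h3 : Real.exp j * Real.exp (-j) = 1 := by rw [← Real.exp_add]; simp
  have h4 : q = (Real.exp (-j) / (40 * w) / 2 * q) * (80 * w * Real.exp j) := by
    field_simp
    linear_combination (-80 * q) * h3
  rw [h4]
  have h5 := mul_le_mul_of_nonneg_right h1 (show 0 ≤ 80 * w * Real.exp j by positivity)
  refine h5.trans ?_
  have : 0 ≤ w * Real.exp j := by positivity
  nlinarith

end
end PL

set_option linter.unusedSectionVars false
namespace PL
open UpperHalfPlane

/-! ### Part 4: upper bound for the visibility probability of thin boxes -/

lemma sum_exp_le (n : ℕ) : ∑ k ∈ Finset.range n, Real.exp (-((n:ℝ) - k)) ≤ 1 := by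
  induction n with
  | zero => simp
  | succ n ih =>
    rw [Finset.sum_range_succ]
    have h1 : ∀ k ∈ Finset.range n, Real.exp (-(((n+1 : ℕ):ℝ) - k)) = Real.exp (-1) * Real.exp (-((n:ℝ) - k)) := by
      intro k _; rw [← Real.exp_add]; congr 1; push_cast; ring
    rw [Finset.sum_congr rfl h1, ← Finset.mul_sum]
    have h2 : Real.exp (-(((n+1 : ℕ):ℝ) - n)) = Real.exp (-1) := by congr 1; push_cast; ring
    rw [h2]
    have h3 : Real.exp (-1) ≤ 1/2 := by
      rw [Real.exp_neg, inv_le_comm₀ (Real.exp_pos 1) (by norm_num)]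
      have := Real.exp_one_gt_d9; norm_num; linarith
    nlinarith [Real.exp_pos (-1)]

namespace Polar
variable {o : ℍ} (X : Polar o)

lemma Vis.mono {X : Polar o} {K K' T T' : Set ℝ} {s : Set ℍ} (h : X.Vis K T s) (hK : K ⊆ K') (hT : T' ⊆ T) : X.Vis K' T' s := by
  obtain ⟨φ, hφ, h⟩ := h
  exact ⟨φ, hK hφ, fun t ht => h t (hT ht)⟩

lemma reg_sep {K K' T T' : Set ℝ} {R : ℝ} (h : ∀ t ∈ T, ∀ t' ∈ T', R ≤ |(|t| - |t'|)|) :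
    ∀ a ∈ X.reg K T, ∀ b ∈ X.reg K' T', R ≤ dist a b := by
  rintro _ ⟨⟨φ, t⟩, ⟨_, h2⟩, rfl⟩ _ ⟨⟨φ', t'⟩, ⟨_, h2'⟩, rfl⟩
  exact (h t h2 t' h2').trans (X.dist_ge φ φ' t t')

end Polar

section
variable {Ω : Type*} {Z : Ω → Set ℍ}
variable [mΩ : MeasurableSpace Ω] {P : Measure Ω} [IsProbabilityMeasure P] {R₀ : ℝ}
variable {o : ℍ} {X : Polar o} {f : ℝ → ℝ} {α c₁ c₂ : ℝ}

lemma Perc.ind3 (hP : Perc P Z R₀) {A B C : Set ℍ} (hB : IsClosed B) (hC : IsClosed C)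
    (hAB : ∀ a ∈ A, ∀ b ∈ B, R₀ ≤ dist a b)
    (hAC : ∀ a ∈ A, ∀ b ∈ C, R₀ ≤ dist a b) (hBC : ∀ a ∈ B, ∀ b ∈ C, R₀ ≤ dist a b)
    {Q₁ Q₂ Q₃ : Set ℍ → Prop} (h₁ : EM A Q₁) (h₂ : EM B Q₂) (h₃ : EM C Q₃) :
    P.real {ω | Q₁ (Z ω) ∧ Q₂ (Z ω) ∧ Q₃ (Z ω)} =
      P.real {ω | Q₁ (Z ω)} * (P.real {ω | Q₂ (Z ω)} * P.real {ω | Q₃ (Z ω)}) := by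
  rw [← hP.ind hBC (h₂.fa hP.closed) (h₃.fa hP.closed)]
  rw [← hP.ind (A := A) (B := B ∪ C) ?_ (h₁.fa hP.closed) ?_]
  · rfl
  · rintro a ha b (hb | hb)
    · exact hAB a ha b hb
    · exact hAC a ha b hb
  · exact (FA_mono hB subset_union_left _ (h₂.fa hP.closed)).inter (FA_mono hC subset_union_right _ (h₃.fa hP.closed))

lemma Perc.ind2 (hP : Perc P Z R₀) {A B : Set ℍ}
    (hAB : ∀ a ∈ A, ∀ b ∈ B, R₀ ≤ dist a b)
    {Q₁ Q₂ : Set ℍ → Prop} (h₁ : EM A Q₁) (h₂ : EM B Q₂) :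
    P.real {ω | Q₁ (Z ω) ∧ Q₂ (Z ω)} = P.real {ω | Q₁ (Z ω)} * P.real {ω | Q₂ (Z ω)} := by
  rw [← hP.ind hAB (h₁.fa hP.closed) (h₂.fa hP.closed)]; rfl

lemma Setup.Q_nat (hS : Setup P Z R₀ X f α c₁ c₂) : ∃ ε M : ℝ, 0 < ε ∧ ε ≤ 1 ∧ 1 ≤ M ∧
    ∀ n : ℕ, ∀ u w a : ℝ, 0 ≤ a → 0 < w → w ≤ ε * Real.exp (-(a + n)) →
      P.real {ω | X.Vis (Icc u (u+w)) (Icc a (a + n)) (Z ω)} ≤ M * Real.exp (-α * n) := by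
  obtain ⟨C, hC, hG⟩ := hS.G_bound
  obtain ⟨R, hR⟩ := exists_nat_ge R₀
  have hα0 := hS.α0
  have hα1 := hS.α1
  have hc2 := hS.c2
  set M := 2 * (c₂ + 1) * Real.exp 4 with hM
  have he4 : 1 ≤ Real.exp 4 := Real.one_le_exp (by norm_num)
  have hM1 : 1 ≤ M := by nlinarith
  set D := Real.exp (2 * R + 3) with hD
  have hD1 : 1 ≤ D := Real.one_le_exp (by positivity)
  refine ⟨min 1 (1 / (2 * M * D * C)), M, by positivity, min_le_left _ _, hM1, ?_⟩
  intro n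
  induction n using Nat.strong_induction_on with
  | _ n ih =>
  intro u w a ha hw hwε
  have hwε' : w ≤ 1 / (2 * M * D * C) * Real.exp (-(a+n)) :=
    hwε.trans (mul_le_mul_of_nonneg_right (min_le_right _ _) (Real.exp_pos _).le)
  rcases lt_or_ge n 4 with hn | hn
  · refine measureReal_le_one.trans ?_
    have h1 : Real.exp (-4) ≤ Real.exp (-α * n) := by
      apply Real.exp_le_exp.2
      have : (n:ℝ) ≤ 4 := by exact_mod_cast hn.le
      nlinarith [Nat.cast_nonneg (α := ℝ) n]
    have h2 : Real.exp 4 * Real.exp (-4) = 1 := by rw [← Real.exp_add]; simp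
    calc (1:ℝ) = Real.exp 4 * Real.exp (-4) := h2.symm
      _ ≤ M * Real.exp (-4) := by
        apply mul_le_mul_of_nonneg_right _ (Real.exp_pos _).le
        rw [hM]; nlinarith
      _ ≤ _ := by gcongr
  have hn4 : (4:ℝ) ≤ n := by exact_mod_cast hn
  set I := Icc u (u+w) with hI
  -- decomposition
  let Ek : ℕ → Set Ω := fun k => {ω | X.Vis I (Icc a (a + k - 1 - R)) (Z ω) ∧ X.GQ u w (a+k) (Z ω) ∧
    X.Vis I (Icc (a + k + 2 + R) (a + n)) (Z ω)}
  have hdec : {ω | X.Vis I (Icc a (a + n)) (Z ω)} ⊆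
      {ω | ∀ t ∈ Icc (a+1) (a+n-2), X.p u t ∈ Z ω} ∪ ⋃ k ∈ (Finset.range n).filter (fun k => 1 ≤ k ∧ k + 2 ≤ n), Ek k := by
    intro ω hω
    by_cases hv : ∀ t ∈ Icc (a+1) (a+n-2), X.p u t ∈ Z ω
    · exact Or.inl hv
    right
    push Not at hv
    obtain ⟨t, ht, htZ⟩ := hv
    simp only [mem_iUnion]
    have hta : 0 ≤ t - a := by linarith [ht.1]
    have hk1 : 1 ≤ ⌊t - a⌋₊ := Nat.le_floor (by push_cast; linarith [ht.1])
    have hk2 : ⌊t - a⌋₊ + 2 ≤ n := by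
      have := Nat.floor_le hta
      have h3 : ((⌊t - a⌋₊ + 2 : ℕ) : ℝ) ≤ n := by push_cast; linarith [ht.2]
      exact_mod_cast h3
    have hk1' : (1:ℝ) ≤ ⌊t - a⌋₊ := by exact_mod_cast hk1
    have hk2' : (⌊t - a⌋₊:ℝ) + 2 ≤ n := by exact_mod_cast hk2
    refine ⟨⌊t - a⌋₊, Finset.mem_filter.2 ⟨Finset.mem_range.2 (by omega), hk1, hk2⟩, ?_, ⟨?_, ?_⟩, ?_⟩
    · exact hω.mono subset_rfl (Icc_subset_Icc le_rfl (by linarith [Nat.cast_nonneg (α := ℝ) R]))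
    · exact hω.mono subset_rfl (Icc_subset_Icc (by linarith) (by linarith))
    · intro hsub
      refine htZ (hsub (X.mem_reg ⟨le_rfl, by linarith⟩ ⟨?_, ?_⟩))
      · linarith [Nat.floor_le hta]
      · linarith [Nat.lt_floor_add_one (t - a)]
    · exact hω.mono subset_rfl (Icc_subset_Icc (by linarith [Nat.cast_nonneg (α := ℝ) R]) le_rfl)
  have hseg : P.real {ω | ∀ t ∈ Icc (a+1) (a+n-2), X.p u t ∈ Z ω} ≤ M / 2 * Real.exp (-α * n) := by
    rw [hS.seg u _ _ (by linarith)]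
    refine (hS.hi _ (by linarith)).trans ?_
    have : Real.exp (-α * (a + n - 2 - (a + 1))) ≤ Real.exp 4 * Real.exp (-α * n) := by
      rw [← Real.exp_add]; apply Real.exp_le_exp.2; nlinarith
    calc _ ≤ c₂ * (Real.exp 4 * Real.exp (-α * n)) := by gcongr
      _ ≤ _ := by
        rw [hM]
        have : 0 < Real.exp 4 * Real.exp (-α * n) := by positivity
        nlinarith
  have hEk : ∀ k ∈ (Finset.range n).filter (fun k => 1 ≤ k ∧ k + 2 ≤ n),
      P.real (Ek k) ≤ M / 2 * Real.exp (-α * n) * Real.exp (-((n:ℝ) - k)) := by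
    intro k hk
    obtain ⟨hkn, hk1, hk2⟩ := Finset.mem_filter.1 hk
    have hkn' := Finset.mem_range.1 hkn
    have hk1' : (1:ℝ) ≤ k := by exact_mod_cast hk1
    have hk2' : (k:ℝ) + 2 ≤ n := by exact_mod_cast hk2
    have hR0 : (0:ℝ) ≤ R := Nat.cast_nonneg R
    have hprod : P.real (Ek k) = P.real {ω | X.Vis I (Icc a (a + k - 1 - R)) (Z ω)} *
        (P.real {ω | X.GQ u w (a+k) (Z ω)} * P.real {ω | X.Vis I (Icc (a + k + 2 + R) (a + n)) (Z ω)}) := by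
      refine hS.ind3 (X.isClosed_reg isCompact_Icc isCompact_Icc) (X.isClosed_reg isCompact_Icc isCompact_Icc)
        ?_ ?_ ?_ (X.einc_vis isCompact_Icc _).em (X.em_GQ u w (a+k)) (X.einc_vis isCompact_Icc _).em
      all_goals
        apply X.reg_sep
        intro t ht t' ht'
        rw [abs_of_nonneg (show 0 ≤ t by linarith [ht.1]), abs_of_nonneg (show 0 ≤ t' by linarith [ht'.1]),
          abs_sub_comm]
        refine le_trans ?_ (le_abs_self _)
        linarith [ht.2, ht'.1]
    have b1 : P.real {ω | X.Vis I (Icc a (a + k - 1 - R)) (Z ω)} ≤ M * Real.exp (R + 1) * Real.exp (-α * k) := by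
      rcases le_or_gt (R + 1) k with h | h
      · have e : a + k - 1 - R = a + ((k - (R+1) : ℕ) : ℝ) := by push_cast [Nat.cast_sub h]; ring
        rw [e]
        refine (ih (k - (R+1)) (by omega) u w a ha hw (hwε.trans ?_)).trans ?_
        · apply mul_le_mul_of_nonneg_left _ (by positivity)
          apply Real.exp_le_exp.2
          have : ((k - (R+1) : ℕ) : ℝ) ≤ n := by exact_mod_cast (by omega : k - (R+1) ≤ n)
          linarith
        · rw [mul_assoc M, ← Real.exp_add]
          apply mul_le_mul_of_nonneg_left _ (by positivity)
          apply Real.exp_le_exp.2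
          push_cast [Nat.cast_sub h]; nlinarith
      · refine measureReal_le_one.trans ?_
        rw [mul_assoc M, ← Real.exp_add]
        have h' : (k:ℝ) ≤ R + 1 := by exact_mod_cast h.le
        exact one_le_mul_of_one_le_of_one_le hM1 (Real.one_le_exp (by nlinarith))
    have b3 : P.real {ω | X.Vis I (Icc (a + k + 2 + R) (a + n)) (Z ω)} ≤ M * Real.exp (R + 2) * Real.exp (-α * (n - k)) := by
      rcases le_or_gt (k + R + 2) n with h | h
      · have e : a + (n:ℝ) = a + k + 2 + R + ((n - (k + R + 2) : ℕ) : ℝ) := by push_cast [Nat.cast_sub h]; ring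
        rw [e]
        refine (ih (n - (k+R+2)) (by omega) u w (a + k + 2 + R) (by positivity) hw ?_).trans ?_
        · rw [← e]; exact hwε
        · rw [mul_assoc M, ← Real.exp_add]
          apply mul_le_mul_of_nonneg_left _ (by positivity)
          apply Real.exp_le_exp.2
          push_cast [Nat.cast_sub h]; nlinarith
      · refine measureReal_le_one.trans ?_
        rw [mul_assoc M, ← Real.exp_add]
        have h' : (n:ℝ) ≤ k + R + 2 := by exact_mod_cast h.le
        exact one_le_mul_of_one_le_of_one_le hM1 (Real.one_le_exp (by nlinarith))
    have b2 : P.real {ω | X.GQ u w (a+k) (Z ω)} ≤ 1 / (2 * M * D) * Real.exp (-((n:ℝ) - k)) := by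
      refine (hG u w (a+k) (by positivity) hw).trans ?_
      have e1 : Real.exp (-((n:ℝ) - k)) = Real.exp (-(a+n)) * Real.exp (a+k) := by
        rw [← Real.exp_add]; congr 1; ring
      rw [e1, ← mul_assoc]
      apply mul_le_mul_of_nonneg_right _ (Real.exp_pos _).le
      calc C * w ≤ C * (1 / (2 * M * D * C) * Real.exp (-(a+n))) := by gcongr
        _ = _ := by field_simp
    rw [hprod]
    calc _ ≤ (M * Real.exp (R + 1) * Real.exp (-α * k)) * ((1 / (2 * M * D) * Real.exp (-((n:ℝ) - k))) *
          (M * Real.exp (R + 2) * Real.exp (-α * (n - k)))) := by gcongr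
      _ = (M / 2) * ((Real.exp (R+1) * Real.exp (R+2)) / D) * (Real.exp (-α * k) * Real.exp (-α * (n - k))) * Real.exp (-((n:ℝ) - k)) := by
        field_simp
      _ = _ := by
        have e1 : Real.exp ((R:ℝ)+1) * Real.exp (R+2) = D := by rw [← Real.exp_add, hD]; congr 1; ring
        have e2 : Real.exp (-α * k) * Real.exp (-α * (n - k)) = Real.exp (-α * n) := by
          rw [← Real.exp_add]; congr 1; ring
        rw [e1, e2, div_self (by positivity), mul_one]
  calc P.real {ω | X.Vis I (Icc a (a + n)) (Z ω)} ≤ _ := measureReal_mono hdec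
    _ ≤ _ := measureReal_union_le _ _
    _ ≤ M / 2 * Real.exp (-α * n) + ∑ k ∈ (Finset.range n).filter (fun k => 1 ≤ k ∧ k + 2 ≤ n),
          M / 2 * Real.exp (-α * n) * Real.exp (-((n:ℝ) - k)) := by
      gcongr
      exact (measureReal_biUnion_finset_le _ _).trans (Finset.sum_le_sum hEk)
    _ ≤ M / 2 * Real.exp (-α * n) + ∑ k ∈ Finset.range n,
          M / 2 * Real.exp (-α * n) * Real.exp (-((n:ℝ) - k)) := by
      gcongr
      exact Finset.filter_subset _ _
    _ ≤ _ := by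
      rw [← Finset.mul_sum]
      have h1 := sum_exp_le n
      have h2 : 0 < M / 2 * Real.exp (-α * n) := by positivity
      nlinarith

lemma Setup.Q_bound (hS : Setup P Z R₀ X f α c₁ c₂) : ∃ ε M : ℝ, 0 < ε ∧ ε ≤ 1 ∧ 1 ≤ M ∧
    ∀ u w a b : ℝ, 0 ≤ a → 0 < w → w ≤ ε * Real.exp (-b) →
      P.real {ω | X.Vis (Icc u (u+w)) (Icc a b) (Z ω)} ≤ M * Real.exp (-α * (b - a)) := by
  obtain ⟨ε, M, h0, h1, hM, h⟩ := hS.Q_nat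
  have hα0 := hS.α0
  have hα1 := hS.α1
  refine ⟨ε, M * Real.exp 1, h0, h1, one_le_mul_of_one_le_of_one_le hM (Real.one_le_exp zero_le_one), ?_⟩
  intro u w a b ha hw hwε
  rw [mul_assoc, ← Real.exp_add]
  rcases le_or_gt a b with hab | hab
  · have f1 := Nat.floor_le (sub_nonneg.2 hab)
    have f2 := Nat.lt_floor_add_one (b - a)
    have e1 : P.real {ω | X.Vis (Icc u (u+w)) (Icc a b) (Z ω)} ≤
        P.real {ω | X.Vis (Icc u (u+w)) (Icc a (a + ⌊b - a⌋₊)) (Z ω)} :=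
      measureReal_mono fun ω hω => Polar.Vis.mono hω subset_rfl (Icc_subset_Icc le_rfl (by linarith))
    refine e1.trans ((h ⌊b - a⌋₊ u w a ha hw (hwε.trans ?_)).trans ?_)
    · apply mul_le_mul_of_nonneg_left _ h0.le
      apply Real.exp_le_exp.2; linarith
    · apply mul_le_mul_of_nonneg_left _ (by linarith)
      apply Real.exp_le_exp.2; nlinarith
  · refine measureReal_le_one.trans (one_le_mul_of_one_le_of_one_le hM (Real.one_le_exp (by nlinarith)))

end

/-- two sided time intervals -/
def tt (a b : ℝ) : Set ℝ := Icc (-b) (-a) ∪ Icc a b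

lemma isCompact_tt (a b : ℝ) : IsCompact (tt a b) := isCompact_Icc.union isCompact_Icc

lemma tt_subset {a b a' b' : ℝ} (h : a' ≤ a) (h' : b ≤ b') : tt a b ⊆ tt a' b' :=
  union_subset_union (Icc_subset_Icc (by linarith) (by linarith)) (Icc_subset_Icc h h')

lemma mem_tt {a b t : ℝ} (ha : 0 ≤ a) : t ∈ tt a b ↔ a ≤ |t| ∧ |t| ≤ b := by
  unfold tt
  simp only [mem_union, mem_Icc]
  rcases le_total 0 t with h | h
  · rw [abs_of_nonneg h]
    constructor
    · rintro (⟨h1, h2⟩ | h1)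
      · constructor <;> linarith
      · exact h1
    · exact Or.inr
  · rw [abs_of_nonpos h]
    constructor
    · rintro (h1 | ⟨h1, h2⟩)
      · constructor <;> linarith [h1.1, h1.2]
      · constructor <;> linarith
    · rintro ⟨h1, h2⟩; left; constructor <;> linarith

section
variable {Ω : Type*} {Z : Ω → Set ℍ}
variable [mΩ : MeasurableSpace Ω] {P : Measure Ω} [IsProbabilityMeasure P] {R₀ : ℝ}
variable {o : ℍ} {X : Polar o} {f : ℝ → ℝ} {α c₁ c₂ : ℝ}

lemma vis_neg (u w a b : ℝ) (s : Set ℍ) : X.Vis (Icc u (u+w)) (Icc (-b) (-a)) s ↔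
    X.Vis (Icc (u + Real.pi) (u + Real.pi + w)) (Icc a b) s := by
  constructor
  · rintro ⟨φ, hφ, h⟩
    refine ⟨φ + Real.pi, ⟨by linarith [hφ.1], by linarith [hφ.2]⟩, fun t ht => ?_⟩
    rw [← X.neg]
    exact h _ ⟨by linarith [ht.2], by linarith [ht.1]⟩
  · rintro ⟨φ, hφ, h⟩
    refine ⟨φ - Real.pi, ⟨by linarith [hφ.1], by linarith [hφ.2]⟩, fun t ht => ?_⟩
    rw [X.sub_pi]
    exact h _ ⟨by linarith [ht.2], by linarith [ht.1]⟩

lemma cos_nonneg_of {x : ℝ} (h : |x| ≤ 3/2) : 0 ≤ Real.cos x := by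
  have := abs_le.1 h
  have := Real.pi_gt_three
  exact Real.cos_nonneg_of_mem_Icc ⟨by linarith, by linarith⟩

/-- opposite regions are far apart -/
lemma reg_opp {K K' : Set ℝ} {a b a' b' R : ℝ} (hK : ∀ φ ∈ K, ∀ ψ ∈ K', |φ - ψ| ≤ 3/2) (ha : 0 ≤ a) (ha' : 0 ≤ a') (haR : R ≤ a ∨ R ≤ a') :
    ∀ x ∈ X.reg K (Icc (-b) (-a)), ∀ y ∈ X.reg K' (Icc a' b'), R ≤ dist x y := by
  rintro _ ⟨⟨φ, t⟩, ⟨h1, h2⟩, rfl⟩ _ ⟨⟨φ', t'⟩, ⟨h1', h2'⟩, rfl⟩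
  simp only [mem_Icc] at h1 h2 h1' h2'
  have := X.dist_opp (cos_nonneg_of (hK φ h1 φ' h1')) (show t ≤ 0 by linarith) (show 0 ≤ t' by linarith)
  refine le_trans ?_ this
  rcases haR with h | h
  · exact le_trans (by linarith) (le_max_left _ _)
  · exact le_trans (by linarith) (le_max_right _ _)

lemma Setup.Q2_bound (hS : Setup P Z R₀ X f α c₁ c₂) : ∃ ε M : ℝ, 0 < ε ∧ ε ≤ 1 ∧ 1 ≤ M ∧
    (∀ u w a b : ℝ, 0 ≤ a → 0 < w → w ≤ ε * Real.exp (-b) →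
      P.real {ω | X.Vis (Icc u (u+w)) (Icc a b) (Z ω)} ≤ M * Real.exp (-α * (b - a))) ∧
    ∀ u w a b : ℝ, 0 ≤ a → 0 < w → w ≤ 1 → w ≤ ε * Real.exp (-b) →
      P.real {ω | X.Vis (Icc u (u+w)) (tt a b) (Z ω)} ≤ M * Real.exp (-2 * α * (b - a)) := by
  obtain ⟨ε, M, h0, h1, hM, h⟩ := hS.Q_bound
  have hR := hS.R_pos
  have hα0 := hS.α0
  have hα1 := hS.α1
  have hMM : M ≤ M * M * Real.exp R₀ := by
    have : 1 ≤ M * Real.exp R₀ := one_le_mul_of_one_le_of_one_le hM (Real.one_le_exp hR.le)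
    nlinarith
  refine ⟨ε, M * M * Real.exp R₀, h0, h1, hM.trans hMM, ?_, ?_⟩
  · intro u w a b ha hw hwε
    exact (h u w a b ha hw hwε).trans (mul_le_mul_of_nonneg_right hMM (Real.exp_pos _).le)
  intro u w a b ha hw hw1 hwε
  have e1 : P.real {ω | X.Vis (Icc u (u+w)) (tt a b) (Z ω)} ≤
      P.real {ω | X.Vis (Icc u (u+w)) (Icc (-b) (-a)) (Z ω) ∧ X.Vis (Icc u (u+w)) (Icc (a + R₀) b) (Z ω)} := by
    refine measureReal_mono (fun ω hω => ?_)
    refine ⟨Polar.Vis.mono hω subset_rfl subset_union_left, Polar.Vis.mono hω subset_rfl ?_⟩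
    exact (Icc_subset_Icc (by linarith) le_rfl).trans subset_union_right
  refine e1.trans ?_
  rw [hS.ind2 ?_ (X.einc_vis isCompact_Icc _).em (X.einc_vis isCompact_Icc _).em]
  · simp only [vis_neg]
    calc _ ≤ (M * Real.exp (-α * (b - a))) * (M * Real.exp (-α * (b - (a + R₀)))) := by
          exact mul_le_mul (h _ w a b ha hw hwε) (h _ w _ b (by linarith) hw hwε) measureReal_nonneg (by positivity)
      _ = M * M * Real.exp (-α * (b - a) + -α * (b - (a + R₀))) := by rw [Real.exp_add]; ring
      _ ≤ _ := by
        rw [mul_assoc (M * M), ← Real.exp_add]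
        apply mul_le_mul_of_nonneg_left _ (by positivity)
        apply Real.exp_le_exp.2
        nlinarith
  · apply reg_opp _ ha (by linarith) (Or.inr (by linarith))
    intro φ hφ ψ hψ
    rw [abs_le]; constructor <;> linarith [hφ.1, hφ.2, hψ.1, hψ.2]

end
end PL

set_option linter.unusedSectionVars false
namespace PL
open UpperHalfPlane

/-! ### Part 5: upper bound for the dimension -/

/-- the union of all lines through `o` contained in `s` -/
def Polar.Lset {o : ℍ} (X : Polar o) (s : Set ℍ) : Set ℍ := {x | ∃ φ t, x = X.p φ t ∧ ∀ t', X.p φ t' ∈ s}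

lemma box_mem {N : ℕ} (hN : 0 < N) {u x : ℝ} (hx : x ∈ Icc u (u+1)) :
    ∃ i : Fin N, x ∈ Icc (u + i * (1/N : ℝ)) (u + i * (1/N : ℝ) + 1/N) := by
  have hN' : (0:ℝ) < N := by exact_mod_cast hN
  have h0 : 0 ≤ (x - u) * N := mul_nonneg (by linarith [hx.1]) hN'.le
  rcases lt_or_ge ⌊(x-u)*N⌋₊ N with h | h
  · refine ⟨⟨_, h⟩, ?_, ?_⟩
    · have := Nat.floor_le h0
      simp only
      have h2 : (⌊(x-u)*N⌋₊:ℝ) * (1/N) ≤ (x-u)*N * (1/N) := by gcongr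
      have h3 : (x-u)*N * (1/N) = x - u := by field_simp
      linarith
    · have := (Nat.lt_floor_add_one ((x-u)*N)).le
      simp only
      have h2 : (x-u)*N * (1/N) ≤ ((⌊(x-u)*N⌋₊:ℝ)+1) * (1/N) := by gcongr
      have h3 : (x-u)*N * (1/N) = x - u := by field_simp
      linarith
  · refine ⟨⟨N-1, by omega⟩, ?_, ?_⟩
    · have h1 := Nat.floor_le h0
      have h4 : (N:ℝ) ≤ ⌊(x-u)*N⌋₊ := by exact_mod_cast h
      have h5 : x - u ≥ 1 := by nlinarith
      have h6 : ((N-1:ℕ):ℝ) * (1/N) ≤ 1 := by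
        rw [mul_one_div, div_le_one hN']; exact_mod_cast Nat.sub_le N 1
      simp only; linarith
    · simp only
      have h6 : ((N-1:ℕ):ℝ) * (1/N) + 1/N = 1 := by
        push_cast [Nat.cast_sub (show 1 ≤ N by omega)]; field_simp; ring
      linarith [hx.2]

lemma Polar.ediam_box {o : ℍ} (X : Polar o) {u v w τ : ℝ} (hw : 0 ≤ w) (hv : v ∈ Icc τ (τ+1)) (hv' : v + w ≤ τ + 1) :
    Metric.ediam (X.reg (Icc u (u+w)) (Icc v (v+w))) ≤ ENNReal.ofReal ((Real.sinh (|τ| + 1) + 1) * w) := by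
  apply Metric.ediam_le
  rintro _ ⟨⟨φ, t⟩, ⟨h1, h2⟩, rfl⟩ _ ⟨⟨φ', t'⟩, ⟨h1', h2'⟩, rfl⟩
  simp only [mem_Icc] at h1 h2 h1' h2'
  rw [edist_dist]
  apply ENNReal.ofReal_le_ofReal
  have ht : |t| ≤ |τ| + 1 := by
    rw [abs_le]; constructor <;> cases abs_cases τ <;> linarith [hv.1, hv.2]
  have hs : |Real.sinh t| ≤ Real.sinh (|τ|+1) := by
    rw [Real.abs_sinh]; exact Real.sinh_le_sinh.2 ht
  have e1 : |φ - φ'| ≤ w := by rw [abs_le]; constructor <;> linarith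
  have e2 : |t - t'| ≤ w := by rw [abs_le]; constructor <;> linarith
  calc dist (X.p φ t) (X.p φ' t') ≤ dist (X.p φ t) (X.p φ' t) + dist (X.p φ' t) (X.p φ' t') := dist_triangle _ _ _
    _ ≤ |Real.sinh t| * |φ - φ'| + |t - t'| := add_le_add (X.dist_arc _ _ _) (X.dist_same _ _ _).le
    _ ≤ Real.sinh (|τ| + 1) * w + w := by gcongr
    _ = _ := by ring

section
variable {Ω : Type*} {Z : Ω → Set ℍ}
variable [mΩ : MeasurableSpace Ω] {P : Measure Ω} [IsProbabilityMeasure P] {R₀ : ℝ}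
variable {o : ℍ} {X : Polar o} {f : ℝ → ℝ} {α c₁ c₂ : ℝ}

lemma Setup.upper_piece (hS : Setup P Z R₀ X f α c₁ c₂) (u τ d : ℝ) (hd0 : 0 < d) (hd : 2 - 2 * α < d) :
    ∀ᵐ ω ∂P, μH[d] {x | ∃ φ ∈ Icc u (u+1), ∃ t ∈ Icc τ (τ+1), x = X.p φ t ∧ ∀ t', X.p φ t' ∈ Z ω} = 0 := by
  obtain ⟨ε, M, h0, h1, hM, -, hQ⟩ := hS.Q2_bound
  set K := Real.sinh (|τ| + 1) + 1 with hK
  have hK0 : 0 < K := by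
    have : 0 ≤ Real.sinh (|τ|+1) := Real.sinh_nonneg_iff.2 (by positivity)
    linarith
  let N : ℕ → ℕ := fun n => ⌈Real.exp n / ε⌉₊
  have hNlo : ∀ n : ℕ, Real.exp n / ε ≤ N n := fun n => Nat.le_ceil _
  have hNhi : ∀ n : ℕ, (N n : ℝ) ≤ 2 / ε * Real.exp n := by
    intro n
    have := (Nat.ceil_lt_add_one (show 0 ≤ Real.exp n / ε by positivity)).le
    have h2 : 1 ≤ Real.exp n / ε := by
      rw [le_div_iff₀ h0]; linarith [Real.one_le_exp (Nat.cast_nonneg (α := ℝ) n)]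
    calc (N n : ℝ) ≤ Real.exp n / ε + 1 := this
      _ ≤ Real.exp n / ε + Real.exp n / ε := by gcongr
      _ = _ := by ring
  have hNpos : ∀ n, 0 < N n := fun n => Nat.ceil_pos.2 (by positivity)
  have hNpos' : ∀ n, (0:ℝ) < N n := fun n => by exact_mod_cast hNpos n
  have hw : ∀ n, 1 / (N n : ℝ) ≤ ε * Real.exp (-(n:ℝ)) := by
    intro n
    rw [div_le_iff₀ (hNpos' n)]
    calc (1:ℝ) = ε * Real.exp (-(n:ℝ)) * (Real.exp n / ε) := by
          rw [Real.exp_neg]; field_simp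
      _ ≤ _ := by gcongr; exact hNlo n
  have hw1 : ∀ n, 1 / (N n : ℝ) ≤ 1 := by
    intro n; rw [div_le_one (hNpos' n)]; exact_mod_cast hNpos n
  let B : (n : ℕ) → ℕ → Set ℝ := fun n i => Icc (u + i * (1/N n : ℝ)) (u + i * (1/N n : ℝ) + 1/N n)
  let Al : (n : ℕ) → ℕ → Set Ω := fun n i => {ω | X.Vis (B n i) (tt 0 n) (Z ω)}
  have hAlm : ∀ n i, MeasurableSet (Al n i) := fun n i =>
    hS.ms (X.einc_vis isCompact_Icc _).em (X.isClosed_reg isCompact_Icc (isCompact_tt _ _))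
  have hAlP : ∀ n i, P (Al n i) ≤ ENNReal.ofReal (M * Real.exp (-2 * α * n)) := by
    intro n i
    rw [← ofReal_measureReal]
    apply ENNReal.ofReal_le_ofReal
    have := hQ (u + i * (1/N n : ℝ)) (1/N n) 0 n le_rfl (one_div_pos.2 (hNpos' n)) (hw1 n) (hw n)
    rwa [sub_zero] at this
  let Y : ℕ → Ω → ℝ≥0∞ := fun n ω => ∑ x : Fin (N n) × Fin (N n),
    (Al n x.1).indicator (fun _ => ENNReal.ofReal (K * (1/N n)) ^ d) ω
  have hYm : ∀ n, Measurable (Y n) := fun n =>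
    Finset.measurable_sum _ fun x _ => measurable_const.indicator (hAlm n x.1)
  let E : ℕ → ℝ := fun n => (2 / ε) ^ 2 * K ^ d * M * Real.exp (-(d - (2 - 2 * α)) * n)
  have hYE : ∀ n, ∫⁻ ω, Y n ω ∂P ≤ ENNReal.ofReal (E n) := by
    intro n
    rw [lintegral_finsetSum _ fun x _ => measurable_const.indicator (hAlm n x.1)]
    have hb : ∀ x : Fin (N n) × Fin (N n), ∫⁻ ω, (Al n x.1).indicator (fun _ => ENNReal.ofReal (K * (1/N n)) ^ d) ω ∂P
        ≤ ENNReal.ofReal (K ^ d * Real.exp (-(n:ℝ)*d) * (M * Real.exp (-2 * α * n))) := by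
      intro x
      rw [lintegral_indicator_const (hAlm n x.1), ENNReal.ofReal_mul (p := K ^ d * Real.exp (-(n:ℝ)*d)) (by positivity)]
      refine mul_le_mul' ?_ (hAlP n _)
      rw [ENNReal.ofReal_rpow_of_nonneg (by positivity) hd0.le]
      apply ENNReal.ofReal_le_ofReal
      rw [Real.mul_rpow hK0.le (by positivity)]
      gcongr
      rw [Real.exp_mul]
      gcongr
      refine (hw n).trans ?_
      have := Real.exp_pos (-(n:ℝ))
      nlinarith
    refine (Finset.sum_le_sum fun x _ => hb x).trans ?_
    rw [Finset.sum_const, nsmul_eq_mul, ← ENNReal.ofReal_natCast, ← ENNReal.ofReal_mul (by positivity)]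
    apply ENNReal.ofReal_le_ofReal
    simp only [Finset.card_univ, Fintype.card_prod, Fintype.card_fin, Nat.cast_mul]
    calc (N n * N n : ℝ) * (K ^ d * Real.exp (-(n:ℝ)*d) * (M * Real.exp (-2 * α * n)))
        ≤ ((2 / ε * Real.exp n) * (2 / ε * Real.exp n)) * (K ^ d * Real.exp (-(n:ℝ)*d) * (M * Real.exp (-2 * α * n))) := by
          have := hNhi n
          gcongr
      _ = (2 / ε) ^ 2 * K ^ d * M * (Real.exp n * Real.exp n * Real.exp (-(n:ℝ)*d) * Real.exp (-2 * α * n)) := by ring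
      _ = E n := by
        simp only [E, ← Real.exp_add]
        congr 2; ring
  have hE0 : Filter.Tendsto (fun n => ENNReal.ofReal (E n)) Filter.atTop (nhds 0) := by
    rw [← ENNReal.ofReal_zero]
    apply ENNReal.tendsto_ofReal
    have : Filter.Tendsto (fun n : ℕ => Real.exp (-(d - (2 - 2 * α)) * n)) Filter.atTop (nhds 0) := by
      apply Real.tendsto_exp_atBot.comp
      apply Filter.Tendsto.const_mul_atTop_of_neg (by linarith)
      exact tendsto_natCast_atTop_atTop
    simpa [E] using this.const_mul ((2 / ε) ^ 2 * K ^ d * M)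
  have hlim : ∀ᵐ ω ∂P, Filter.liminf (fun n => Y n ω) Filter.atTop = 0 := by
    have hm : Measurable fun ω => Filter.liminf (fun n => Y n ω) Filter.atTop := Measurable.liminf hYm
    have := (lintegral_eq_zero_iff (μ := P) hm).1 (le_antisymm ?_ zero_le)
    · exact this
    · refine (lintegral_liminf_le hYm).trans ?_
      rw [← hE0.liminf_eq]
      exact Filter.liminf_le_liminf (Filter.Eventually.of_forall hYE)
  filter_upwards [hlim] with ω hω
  let r : ℕ → ℝ≥0∞ := fun n => ENNReal.ofReal (K * Real.exp (-(n:ℝ)))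
  have hr : Filter.Tendsto r Filter.atTop (nhds 0) := by
    rw [← ENNReal.ofReal_zero]
    apply ENNReal.tendsto_ofReal
    have : Filter.Tendsto (fun n : ℕ => Real.exp (-(n:ℝ))) Filter.atTop (nhds 0) :=
      Real.tendsto_exp_atBot.comp (Filter.tendsto_neg_atTop_atBot.comp tendsto_natCast_atTop_atTop)
    simpa using this.const_mul K
  let T : (n : ℕ) → ℕ → Set ℝ := fun n i => Icc (τ + i * (1/N n : ℝ)) (τ + i * (1/N n : ℝ) + 1/N n)
  let t : (n : ℕ) → Fin (N n) × Fin (N n) → Set ℍ := fun n x => {z | ω ∈ Al n x.1 ∧ z ∈ X.reg (B n x.1) (T n x.2)}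
  have htd : ∀ n x, Metric.ediam (t n x) ≤ ENNReal.ofReal (K * (1/N n)) := by
    intro n x
    refine (Metric.ediam_mono (fun z hz => hz.2)).trans ?_
    have hx : (x.2:ℝ) + 1 ≤ N n := by exact_mod_cast x.2.2
    have hx2 : (x.2:ℝ) * (1/N n) + 1 / N n ≤ 1 := by
      have : (x.2:ℝ) * (1/N n) + 1 / N n = (x.2+1) / N n := by ring
      rw [this, div_le_one (hNpos' n)]; exact hx
    have hx3 : 0 ≤ (x.2:ℝ) * (1/N n) := by positivity
    have hx4 : 0 ≤ 1 / (N n : ℝ) := by positivity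
    exact X.ediam_box (by positivity) ⟨by linarith, by linarith⟩ (by linarith)
  refine le_antisymm ?_ zero_le
  refine (Measure.hausdorffMeasure_le_liminf_sum d _ r hr t ?_ ?_).trans ?_
  · refine Filter.Eventually.of_forall fun n x => (htd n x).trans ?_
    apply ENNReal.ofReal_le_ofReal
    have := Real.exp_pos (-(n:ℝ))
    apply mul_le_mul_of_nonneg_left _ hK0.le
    exact (hw n).trans (by nlinarith)
  · refine Filter.Eventually.of_forall fun n => ?_
    rintro x ⟨φ, hφ, s, hs, rfl, hv⟩
    obtain ⟨i, hi⟩ := box_mem (hNpos n) hφ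
    obtain ⟨j, hj⟩ := box_mem (hNpos n) hs
    exact mem_iUnion.2 ⟨(i, j), ⟨φ, hi, fun t _ => hv t⟩, X.mem_reg hi hj⟩
  · rw [← hω]
    refine Filter.liminf_le_liminf (Filter.Eventually.of_forall fun n => ?_)
    refine Finset.sum_le_sum fun x _ => ?_
    by_cases hx : ω ∈ Al n x.1
    · rw [indicator_of_mem hx]
      exact ENNReal.rpow_le_rpow (htd n x) hd0.le
    · have : t n x = ∅ := by ext z; simp [t, hx]
      rw [this]; simp [hd0]

lemma Setup.upper (hS : Setup P Z R₀ X f α c₁ c₂) :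
    ∀ᵐ ω ∂P, dimH (X.Lset (Z ω)) ≤ ENNReal.ofReal (2 - 2 * α) := by
  have hα1 := hS.α1
  have h : ∀ᵐ ω ∂P, ∀ (u τ : ℤ) (m : ℕ), μH[2 - 2 * α + 1 / ((m:ℝ) + 1)] {x | ∃ φ ∈ Icc (u:ℝ) (u+1), ∃ t ∈ Icc (τ:ℝ) (τ+1), x = X.p φ t ∧ ∀ t', X.p φ t' ∈ Z ω} = 0 := by
    simp only [ae_all_iff]
    intro u τ m
    have : 0 < 1 / ((m:ℝ) + 1) := by positivity
    exact hS.upper_piece u τ _ (by linarith) (by linarith)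
  filter_upwards [h] with ω hω
  have hsub : X.Lset (Z ω) ⊆ ⋃ u : ℤ, ⋃ τ : ℤ, {x | ∃ φ ∈ Icc (u:ℝ) (u+1), ∃ t ∈ Icc (τ:ℝ) (τ+1), x = X.p φ t ∧ ∀ t', X.p φ t' ∈ Z ω} := by
    rintro x ⟨φ, t, rfl, hv⟩
    simp only [mem_iUnion]
    exact ⟨⌊φ⌋, ⌊t⌋, φ, ⟨Int.floor_le φ, (Int.lt_floor_add_one φ).le⟩, t, ⟨Int.floor_le t, (Int.lt_floor_add_one t).le⟩, rfl, hv⟩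
  have hm : ∀ m : ℕ, dimH (X.Lset (Z ω)) ≤ ENNReal.ofReal (2 - 2 * α + 1 / ((m:ℝ) + 1)) := by
    intro m
    have : 0 < 1 / ((m:ℝ) + 1) := by positivity
    refine (dimH_mono hsub).trans ?_
    rw [dimH_iUnion]
    refine iSup_le fun u => ?_
    rw [dimH_iUnion]
    refine iSup_le fun τ => ?_
    apply dimH_le_of_hausdorffMeasure_ne_top (d := Real.toNNReal (2 - 2 * α + 1 / ((m:ℝ) + 1)))
    rw [Real.coe_toNNReal _ (by linarith), hω u τ m]
    exact zero_ne_top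
  have ht : Filter.Tendsto (fun m : ℕ => ENNReal.ofReal (2 - 2 * α + 1 / ((m:ℝ) + 1))) Filter.atTop (nhds (ENNReal.ofReal (2 - 2 * α))) := by
    apply ENNReal.tendsto_ofReal
    simpa using tendsto_one_div_add_atTop_nhds_zero_nat.const_add (2 - 2 * α)
  exact ge_of_tendsto' ht hm

end
end PL

set_option linter.unusedSectionVars false
namespace PL
open UpperHalfPlane

/-! ### Part 6: second moment tools -/

lemma int4 {Ω : Type*} [MeasurableSpace Ω] {P : Measure Ω} [IsProbabilityMeasure P] {x u v w : Ω → ℝ} {a b c d : ℝ}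
    (hx : Integrable x P) (hu : Integrable u P) (hv : Integrable v P) (hw : Integrable w P)
    (h : ∀ ω, x ω ≤ a + b * u ω + c * v ω + d * w ω) :
    ∫ ω, x ω ∂P ≤ a + b * ∫ ω, u ω ∂P + c * ∫ ω, v ω ∂P + d * ∫ ω, w ω ∂P := by
  have i1 : Integrable (fun ω => a + b * u ω) P := (integrable_const a).add (hu.const_mul b)
  have i2 : Integrable (fun ω => a + b * u ω + c * v ω) P := i1.add (hv.const_mul c)
  have i3 : Integrable (fun ω => a + b * u ω + c * v ω + d * w ω) P := i2.add (hw.const_mul d)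
  refine (integral_mono hx i3 h).trans (le_of_eq ?_)
  rw [integral_add i2 (hw.const_mul d), integral_add i1 (hv.const_mul c), integral_add (integrable_const a) (hu.const_mul b)]
  simp only [integral_const_mul, integral_const, probReal_univ, one_smul]

lemma second_moment {Ω : Type*} [MeasurableSpace Ω] {P : Measure Ω} [IsProbabilityMeasure P] (N : ℕ)
    (A : ℕ → Set Ω) (hA : ∀ i, MeasurableSet (A i)) (F : Set Ω) (hF : MeasurableSet F) (w : ℕ → ℕ → ℝ)
    (m Γ Λ η : ℝ) (hm : 0 < m) (hmA : m = ∑ i ∈ Finset.range N, P.real (A i)) (hΓ : 0 < Γ)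
    (h2 : ∑ i ∈ Finset.range N, ∑ j ∈ Finset.range N, P.real (A i ∩ A j) ≤ Γ * m ^ 2)
    (hE : ∑ i ∈ Finset.range N, ∑ j ∈ Finset.range N, w i j * P.real (A i ∩ A j) ≤ Λ * m ^ 2)
    (hη : 0 ≤ η) (hηΛ : η * Λ ≤ 1 / 4)
    (hw : ∀ i j, 0 ≤ w i j)
    (hcov : ∀ ω, ω ∉ F → (∑ i ∈ Finset.range N, (A i).indicator (fun _ => (1:ℝ)) ω) ^ 2 ≤
      η * ∑ i ∈ Finset.range N, ∑ j ∈ Finset.range N, w i j * (A i ∩ A j).indicator (fun _ => (1:ℝ)) ω) :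
    1 / (4 * Γ) ≤ P.real F := by
  classical
  have hIntg : ∀ B : Set Ω, MeasurableSet B → Integrable (B.indicator (fun _ => (1:ℝ))) P := fun B hB =>
    (integrable_const (1:ℝ)).indicator hB
  have hval : ∀ B : Set Ω, MeasurableSet B → ∫ ω, B.indicator (fun _ => (1:ℝ)) ω ∂P = P.real B := fun B hB => by
    rw [integral_indicator_const _ hB]; simp
  have hpt : ∀ ω, (∑ i ∈ Finset.range N, (A i).indicator (fun _ => (1:ℝ)) ω) ≤
      m / 4 + η / m * (∑ i ∈ Finset.range N, ∑ j ∈ Finset.range N, w i j * (A i ∩ A j).indicator (fun _ => (1:ℝ)) ω)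
      + 1 / (4 * Γ * m) * (∑ i ∈ Finset.range N, ∑ j ∈ Finset.range N, (A i ∩ A j).indicator (fun _ => (1:ℝ)) ω)
      + m * Γ * F.indicator (fun _ => (1:ℝ)) ω := by
    intro ω
    set S := ∑ i ∈ Finset.range N, (A i).indicator (fun _ => (1:ℝ)) ω with hSdef
    set En := ∑ i ∈ Finset.range N, ∑ j ∈ Finset.range N, w i j * (A i ∩ A j).indicator (fun _ => (1:ℝ)) ω with hEn
    have hEn0 : 0 ≤ En := Finset.sum_nonneg fun i _ => Finset.sum_nonneg fun j _ =>
      mul_nonneg (hw i j) (indicator_nonneg (fun _ _ => zero_le_one) _)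
    have hS2 : ∑ i ∈ Finset.range N, ∑ j ∈ Finset.range N, (A i ∩ A j).indicator (fun _ => (1:ℝ)) ω = S ^ 2 := by
      rw [sq, hSdef, Finset.sum_mul_sum]
      refine Finset.sum_congr rfl fun i _ => Finset.sum_congr rfl fun j _ => ?_
      by_cases h1 : ω ∈ A i <;> by_cases h2 : ω ∈ A j <;> simp [indicator, h1, h2]
    rw [hS2]
    by_cases hω : ω ∈ F
    · rw [indicator_of_mem hω]
      have h1 : S ≤ 1 / (4 * Γ * m) * S ^ 2 + m * Γ * 1 := by
        have : 1 / (4 * Γ * m) * S ^ 2 + m * Γ * 1 - S = (S - 2 * Γ * m) ^ 2 / (4 * Γ * m) := by field_simp; ring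
        have h3 : 0 ≤ (S - 2 * Γ * m) ^ 2 / (4 * Γ * m) := by positivity
        linarith
      have h4 : 0 ≤ η / m * En := by positivity
      linarith
    · rw [indicator_of_notMem hω]
      have h1 : S ≤ m / 4 + S ^ 2 / m := by
        have : m / 4 + S ^ 2 / m - S = (S - m / 2) ^ 2 / m := by field_simp; ring
        have h3 : 0 ≤ (S - m / 2) ^ 2 / m := by positivity
        linarith
      have h2 : S ^ 2 / m ≤ η / m * En := by
        rw [div_mul_eq_mul_div]
        exact div_le_div_of_nonneg_right (hcov ω hω) hm.le
      have h4 : 0 ≤ 1 / (4 * Γ * m) * S ^ 2 := by positivity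
      linarith
  have hI1 : Integrable (fun ω => ∑ i ∈ Finset.range N, (A i).indicator (fun _ => (1:ℝ)) ω) P :=
    integrable_finsetSum _ fun i _ => hIntg _ (hA i)
  have hI2 : Integrable (fun ω => ∑ i ∈ Finset.range N, ∑ j ∈ Finset.range N, w i j * (A i ∩ A j).indicator (fun _ => (1:ℝ)) ω) P :=
    integrable_finsetSum _ fun i _ => integrable_finsetSum _ fun j _ => (hIntg _ ((hA i).inter (hA j))).const_mul _
  have hI3 : Integrable (fun ω => ∑ i ∈ Finset.range N, ∑ j ∈ Finset.range N, (A i ∩ A j).indicator (fun _ => (1:ℝ)) ω) P :=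
    integrable_finsetSum _ fun i _ => integrable_finsetSum _ fun j _ => (hIntg _ ((hA i).inter (hA j)))
  have hle := int4 hI1 hI2 hI3 (hIntg F hF) hpt
  rw [hval F hF, integral_finsetSum _ (fun i _ => hIntg _ (hA i)),
    integral_finsetSum _ (fun i _ => integrable_finsetSum _ fun j _ => (hIntg _ ((hA i).inter (hA j))).const_mul _),
    integral_finsetSum _ (fun i _ => integrable_finsetSum _ fun j _ => (hIntg _ ((hA i).inter (hA j))))] at hle
  have e1 : ∀ i, ∫ ω, ∑ j ∈ Finset.range N, w i j * (A i ∩ A j).indicator (fun _ => (1:ℝ)) ω ∂P = ∑ j ∈ Finset.range N, w i j * P.real (A i ∩ A j) := by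
    intro i
    rw [integral_finsetSum _ (fun j _ => (hIntg _ ((hA i).inter (hA j))).const_mul _)]
    refine Finset.sum_congr rfl fun j _ => ?_
    rw [integral_const_mul, hval _ ((hA i).inter (hA j))]
  have e2 : ∀ i, ∫ ω, ∑ j ∈ Finset.range N, (A i ∩ A j).indicator (fun _ => (1:ℝ)) ω ∂P = ∑ j ∈ Finset.range N, P.real (A i ∩ A j) := by
    intro i
    rw [integral_finsetSum _ (fun j _ => (hIntg _ ((hA i).inter (hA j))))]
    exact Finset.sum_congr rfl fun j _ => hval _ ((hA i).inter (hA j))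
  simp only [e1, e2, hval _ (hA _), ← hmA] at hle
  have k1 : η / m * ∑ i ∈ Finset.range N, ∑ j ∈ Finset.range N, w i j * P.real (A i ∩ A j) ≤ m / 4 := by
    calc _ ≤ η / m * (Λ * m ^ 2) := by gcongr
      _ = (η * Λ) * m := by field_simp
      _ ≤ _ := by nlinarith
  have k2 : 1 / (4 * Γ * m) * ∑ i ∈ Finset.range N, ∑ j ∈ Finset.range N, P.real (A i ∩ A j) ≤ m / 4 := by
    calc _ ≤ 1 / (4 * Γ * m) * (Γ * m ^ 2) := by gcongr
      _ = _ := by field_simp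
  have k3 : m / 4 ≤ m * Γ * P.real F := by linarith
  rw [div_le_iff₀ (by positivity)]
  have : m * (1 / 4) ≤ m * (Γ * P.real F) := by linarith
  have := le_of_mul_le_mul_left this hm
  linarith

lemma sum_rpow_le {β : ℝ} (hβ : 0 ≤ β) (hβ1 : β < 1) (N : ℕ) :
    ∑ k ∈ Finset.range N, ((k:ℝ) + 1) ^ (-β) ≤ 1 / (1 - β) * (N:ℝ) ^ (1 - β) := by
  have hpos : 0 < 1 - β := by linarith
  induction N with
  | zero => simp [Real.zero_rpow hpos.ne']
  | succ N ih =>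
    rw [Finset.sum_range_succ]
    have hN : (0:ℝ) < (N:ℝ) + 1 := by positivity
    have h1 : (N:ℝ) ^ (1 - β) ≤ ((N:ℝ)+1) ^ (1 - β) * (1 - (1 - β) / (N + 1)) := by
      have := _root_.rpow_one_add_le_one_add_mul_self (s := -(1/((N:ℝ)+1))) (p := 1 - β)
        (by rw [neg_le_neg_iff, div_le_one hN]; linarith [Nat.cast_nonneg (α := ℝ) N]) hpos.le (by linarith)
      have e : (N:ℝ) = ((N:ℝ)+1) * (1 + -(1/((N:ℝ)+1))) := by field_simp; ring
      have e0 : 0 ≤ 1 + -(1/((N:ℝ)+1)) := by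
        have : 1 / ((N:ℝ)+1) ≤ 1 := by rw [div_le_one hN]; linarith [Nat.cast_nonneg (α := ℝ) N]
        linarith
      calc (N:ℝ) ^ (1 - β) = (((N:ℝ)+1) * (1 + -(1/((N:ℝ)+1)))) ^ (1 - β) := by rw [← e]
        _ = ((N:ℝ)+1) ^ (1 - β) * (1 + -(1/((N:ℝ)+1))) ^ (1 - β) := Real.mul_rpow hN.le e0
        _ ≤ ((N:ℝ)+1) ^ (1 - β) * (1 + (1 - β) * -(1/((N:ℝ)+1))) := by gcongr
        _ = _ := by ring
    have h2 : ((N:ℝ) + 1) ^ (-β) = ((N:ℝ)+1) ^ (1 - β) / (N + 1) := by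
      rw [Real.rpow_sub hN, Real.rpow_one, Real.rpow_neg hN.le]; field_simp
    push_cast
    rw [h2]
    calc _ ≤ 1 / (1 - β) * (((N:ℝ)+1) ^ (1 - β) * (1 - (1 - β) / (N + 1))) + ((N:ℝ)+1) ^ (1 - β) / (N + 1) := by
          gcongr
          exact ih.trans (by gcongr)
      _ = _ := by field_simp; ring

lemma sum_dist_le (g : ℝ → ℝ) (hg : ∀ x, 0 ≤ g x) (N i : ℕ) (hi : i < N) :
    ∑ j ∈ Finset.range N, g |(i:ℝ) - j| ≤ 2 * ∑ k ∈ Finset.range N, g k := by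
  have h1 : ∑ j ∈ Finset.range (i+1), g |(i:ℝ) - j| = ∑ k ∈ Finset.range (i+1), g k := by
    rw [← Finset.sum_range_reflect (fun k : ℕ => g k)]
    refine Finset.sum_congr rfl fun j hj => ?_
    have hj' : j ≤ i := by have := Finset.mem_range.1 hj; omega
    have e : i + 1 - 1 - j = i - j := by omega
    rw [e, Nat.cast_sub hj', abs_of_nonneg]
    exact sub_nonneg.2 (by exact_mod_cast hj')
  have h2 : ∑ j ∈ Finset.Ico (i+1) N, g |(i:ℝ) - j| ≤ ∑ k ∈ Finset.range N, g k := by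
    have e : ∑ j ∈ Finset.Ico (i+1) N, g |(i:ℝ) - j| = ∑ k ∈ Finset.Ico 1 (N - i), g k := by
      rw [Finset.sum_Ico_eq_sum_range, Finset.sum_Ico_eq_sum_range]
      rw [show N - (i+1) = N - i - 1 by omega]
      refine Finset.sum_congr rfl fun j _ => ?_
      congr 1
      push_cast
      rw [abs_sub_comm, abs_of_nonneg (by linarith [Nat.cast_nonneg (α := ℝ) j])]; ring
    rw [e]
    apply Finset.sum_le_sum_of_subset_of_nonneg
    · intro k hk; rw [Finset.mem_Ico] at hk; rw [Finset.mem_range]; omega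
    · intros; exact hg _
  have h3 : ∑ k ∈ Finset.range (i+1), g k ≤ ∑ k ∈ Finset.range N, g k := by
    apply Finset.sum_le_sum_of_subset_of_nonneg
    · intro k hk; rw [Finset.mem_range] at *; omega
    · intros; exact hg _
  rw [← Finset.sum_range_add_sum_Ico _ (show i + 1 ≤ N by omega), h1]
  linarith

lemma sum_sum_rpow_le {β : ℝ} (hβ : 0 ≤ β) (hβ1 : β < 1) (N : ℕ) :
    ∑ i ∈ Finset.range N, ∑ j ∈ Finset.range N, (|(i:ℝ) - j| + 1) ^ (-β) ≤ 2 / (1 - β) * ((N:ℝ) * (N:ℝ) ^ (1 - β)) := by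
  have : ∀ i ∈ Finset.range N, ∑ j ∈ Finset.range N, (|(i:ℝ) - j| + 1) ^ (-β) ≤ 2 / (1 - β) * (N:ℝ) ^ (1 - β) := by
    intro i hi
    refine (sum_dist_le (fun x => (|x| + 1) ^ (-β)) (fun x => by positivity) N i (Finset.mem_range.1 hi) |>.trans' ?_).trans ?_
    · simp
    · have := sum_rpow_le hβ hβ1 N
      simp only [Nat.abs_cast]
      calc _ ≤ 2 * (1 / (1 - β) * (N:ℝ) ^ (1 - β)) := by gcongr
        _ = _ := by ring
  refine (Finset.sum_le_sum this).trans (le_of_eq ?_)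
  rw [Finset.sum_const, Finset.card_range, nsmul_eq_mul]; ring

end PL

set_option linter.unusedSectionVars false
namespace PL
open UpperHalfPlane

/-! ### Part 7: the covering event and slicing -/

/-- the union of a finite family of rational open intervals -/
def cov (C : Finset (ℚ × ℚ)) : Set ℝ := ⋃ x ∈ C, Ioo (x.1:ℝ) (x.2:ℝ)

lemma isOpen_cov (C : Finset (ℚ × ℚ)) : IsOpen (cov C) := isOpen_biUnion fun _ _ => isOpen_Ioo

/-- finite families with small total content and long intervals -/
def Small (n : ℕ) (s η : ℝ) (C : Finset (ℚ × ℚ)) : Prop :=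
  (∀ x ∈ C, Real.exp (-(n:ℝ)) ≤ (x.2:ℝ) - x.1) ∧ ∑ x ∈ C, ((x.2:ℝ) - x.1) ^ s < η

/-- large content, i.e. not coverable with small content -/
def Big (s η : ℝ) (V : Set ℝ) : Prop :=
  ∀ C : Finset (ℚ × ℚ), (∀ x ∈ C, (x.1:ℝ) < x.2) → ∑ x ∈ C, ((x.2:ℝ) - x.1) ^ s < η → ¬ V ⊆ cov C

lemma Big.tsum {s η : ℝ} {V : Set ℝ} (hV : IsCompact V) (h : Big s η V) (x : ℕ → ℚ × ℚ)
    (hx : ∀ n, ((x n).1:ℝ) < (x n).2) (T : Set ℕ) (hT : V ⊆ ⋃ n ∈ T, Ioo ((x n).1:ℝ) (x n).2) :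
    ENNReal.ofReal η ≤ ∑' n, T.indicator (fun n => ENNReal.ofReal (((x n).2 - (x n).1 : ℝ) ^ s)) n := by
  classical
  obtain ⟨F, hF1, hF2, hF3⟩ := hV.elim_finite_subcover_image (fun n _ => isOpen_Ioo) hT
  set G := hF2.toFinset with hG
  have hGF : ∀ n, n ∈ G ↔ n ∈ F := fun n => hF2.mem_toFinset
  have h1 : η ≤ ∑ y ∈ G.image x, ((y.2:ℝ) - y.1) ^ s := by
    by_contra hlt
    push Not at hlt
    refine h (G.image x) ?_ hlt ?_
    · intro y hy
      obtain ⟨n, -, rfl⟩ := Finset.mem_image.1 hy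
      exact hx n
    · intro v hv
      obtain ⟨n, hn, hvn⟩ := mem_iUnion₂.1 (hF3 hv)
      exact mem_iUnion₂.2 ⟨x n, Finset.mem_image_of_mem x ((hGF n).2 hn), hvn⟩
  have h2 : ∑ y ∈ G.image x, ((y.2:ℝ) - y.1) ^ s ≤ ∑ n ∈ G, (((x n).2:ℝ) - (x n).1) ^ s := by
    apply Finset.sum_image_le_of_nonneg
    intro y hy
    obtain ⟨n, -, rfl⟩ := Finset.mem_image.1 hy
    exact Real.rpow_nonneg (by linarith [hx n]) s
  calc ENNReal.ofReal η ≤ ENNReal.ofReal (∑ n ∈ G, (((x n).2:ℝ) - (x n).1) ^ s) := ENNReal.ofReal_le_ofReal (h1.trans h2)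
    _ = ∑ n ∈ G, ENNReal.ofReal ((((x n).2:ℝ) - (x n).1) ^ s) :=
      ENNReal.ofReal_sum_of_nonneg fun n _ => Real.rpow_nonneg (by linarith [hx n]) s
    _ = ∑ n ∈ G, T.indicator (fun n => ENNReal.ofReal (((x n).2 - (x n).1 : ℝ) ^ s)) n := by
      refine Finset.sum_congr rfl fun n hn => ?_
      rw [indicator_of_mem (hF1 ((hGF n).1 hn))]
    _ ≤ _ := ENNReal.sum_le_tsum G

lemma rat_int (c r e : ℝ) (he : 0 < e) : ∃ x : ℚ × ℚ, (x.1:ℝ) < c - r ∧ c + r < x.2 ∧ (x.2:ℝ) - x.1 ≤ 2 * r + e := by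
  obtain ⟨a, ha1, ha2⟩ := exists_rat_btwn (show c - r - e / 2 < c - r by linarith)
  obtain ⟨b, hb1, hb2⟩ := exists_rat_btwn (show c + r < c + r + e / 2 by linarith)
  exact ⟨(a, b), ha2, hb1, by simp only; linarith⟩

lemma Big.slice {o : ℍ} (X : Polar o) {s η u : ℝ} (hs : 0 < s) (hη : 0 < η) {V : Set ℝ} (hVc : IsCompact V)
    (hV : Big s η V) (hVu : V ⊆ Icc u (u+1)) : μH[1 + s] (X.reg V (Icc 1 2)) ≠ 0 := by
  classical
  set K := 2 * Real.cosh 4 with hK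
  have hK0 : 0 < K := by positivity
  set c := 2 * (2 * K + 1) ^ s with hc
  have hc0 : 0 < c := by positivity
  have main : ∀ t : ℕ → Set ℍ, X.reg V (Icc 1 2) ⊆ ⋃ n, t n → (∀ n, Metric.ediam (t n) ≤ 1) →
      ENNReal.ofReal η ≤ ENNReal.ofReal c * ∑' n, Metric.ediam (t n) ^ (1 + s) := by
    intro t ht htd
    set d : ℕ → ℝ := fun n => (Metric.ediam (t n)).toReal with hd
    have hd0 : ∀ n, 0 ≤ d n := fun n => ENNReal.toReal_nonneg
    have hdn : ∀ n, ENNReal.ofReal (d n) = Metric.ediam (t n) := fun n =>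
      ENNReal.ofReal_toReal ((htd n).trans_lt one_lt_top).ne
    have hch : ∀ n, ∃ (φ : ℝ) (T : Set ℝ), MeasurableSet T ∧ volume T ≤ ENNReal.ofReal (2 * d n) ∧
        ∀ ψ ∈ V, ∀ τ ∈ Icc (1:ℝ) 2, X.p ψ τ ∈ t n → τ ∈ T ∧ |ψ - φ| ≤ K * d n := by
      intro n
      by_cases hne : ∃ φ ∈ V, ∃ σ ∈ Icc (1:ℝ) 2, X.p φ σ ∈ t n
      · obtain ⟨φ, hφ, σ, hσ, hp⟩ := hne
        refine ⟨φ, Icc (σ - d n) (σ + d n), measurableSet_Icc, ?_, ?_⟩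
        · rw [Real.volume_Icc]; apply ENNReal.ofReal_le_ofReal; linarith
        · intro ψ hψ τ hτ hp'
          have hdist : dist (X.p ψ τ) (X.p φ σ) ≤ d n := by
            have := Metric.edist_le_ediam_of_mem hp' hp
            rw [← hdn n, edist_dist] at this
            exact (ENNReal.ofReal_le_ofReal_iff (hd0 n)).1 this
          have hab : |ψ - φ| ≤ 3/2 := by
            have h1 := hVu hφ; have h2 := hVu hψ
            rw [abs_le]; constructor <;> linarith [h1.1, h1.2, h2.1, h2.2]
          obtain ⟨k1, k2⟩ := X.lower_lip hab hτ hσ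
          have k3 := abs_le.1 (k2.trans hdist)
          refine ⟨⟨by linarith, by linarith⟩, k1.trans ?_⟩
          exact mul_le_mul_of_nonneg_left hdist hK0.le
      · refine ⟨0, ∅, MeasurableSet.empty, by simp, ?_⟩
        intro ψ hψ τ hτ hp
        exact absurd ⟨ψ, hψ, τ, hτ, hp⟩ hne
    choose φ T hTm hTv hT using hch
    let e : ℕ → ℝ := fun n => if d n = 0 then 1 else d n
    have he : ∀ n, 0 < e n := by
      intro n; simp only [e]; split_ifs with h
      · exact one_pos
      · exact lt_of_le_of_ne (hd0 n) (Ne.symm h)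
    choose x hx1 hx2 hx3 using fun n => rat_int (φ n) (K * d n) (e n) (he n)
    have hx : ∀ n, ((x n).1:ℝ) < (x n).2 := fun n => by
      have : 0 ≤ K * d n := mul_nonneg hK0.le (hd0 n)
      linarith [hx1 n, hx2 n]
    have hτ : ∀ τ ∈ Icc (1:ℝ) 2, ENNReal.ofReal η ≤
        ∑' n, (T n).indicator (fun _ => ENNReal.ofReal (((x n).2 - (x n).1 : ℝ) ^ s)) τ := by
      intro τ hτ
      refine (hV.tsum hVc x hx {n | τ ∈ T n} ?_).trans (le_of_eq ?_)
      · intro ψ hψ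
        obtain ⟨n, hn⟩ := mem_iUnion.1 (ht (X.mem_reg hψ hτ))
        obtain ⟨h1, h2⟩ := hT n ψ hψ τ hτ hn
        have h3 := abs_le.1 h2
        exact mem_iUnion₂.2 ⟨n, h1, by linarith [hx1 n], by linarith [hx2 n]⟩
      · rfl
    have hIntg : ENNReal.ofReal η ≤ ∑' n, ENNReal.ofReal (((x n).2 - (x n).1 : ℝ) ^ s) * volume (T n) := by
      calc ENNReal.ofReal η = ∫⁻ _ in Icc (1:ℝ) 2, ENNReal.ofReal η := by
            rw [setLIntegral_const, Real.volume_Icc]; norm_num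
        _ ≤ ∫⁻ τ in Icc (1:ℝ) 2, ∑' n, (T n).indicator (fun _ => ENNReal.ofReal (((x n).2 - (x n).1 : ℝ) ^ s)) τ :=
            setLIntegral_mono' measurableSet_Icc hτ
        _ ≤ ∫⁻ τ, ∑' n, (T n).indicator (fun _ => ENNReal.ofReal (((x n).2 - (x n).1 : ℝ) ^ s)) τ :=
            setLIntegral_le_lintegral _ _
        _ = ∑' n, ∫⁻ τ, (T n).indicator (fun _ => ENNReal.ofReal (((x n).2 - (x n).1 : ℝ) ^ s)) τ :=
            lintegral_tsum fun n => (measurable_const.indicator (hTm n)).aemeasurable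
        _ = _ := by
            refine tsum_congr fun n => ?_
            rw [lintegral_indicator_const (hTm n)]
    refine hIntg.trans ?_
    rw [← ENNReal.tsum_mul_left]
    refine ENNReal.tsum_le_tsum fun n => ?_
    rw [← hdn n, ENNReal.ofReal_rpow_of_nonneg (hd0 n) (by linarith), ← ENNReal.ofReal_mul hc0.le]
    refine (mul_le_mul' le_rfl (hTv n)).trans ?_
    rw [← ENNReal.ofReal_mul (Real.rpow_nonneg (by linarith [hx n]) s)]
    apply ENNReal.ofReal_le_ofReal
    by_cases h0 : d n = 0
    · rw [h0]; simp only [mul_zero]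
      positivity
    · have hdp : 0 < d n := lt_of_le_of_ne (hd0 n) (Ne.symm h0)
      have hen : e n = d n := by simp only [e, if_neg h0]
      have h3 := hx3 n
      rw [hen] at h3
      calc (((x n).2:ℝ) - (x n).1) ^ s * (2 * d n) ≤ ((2 * K + 1) * d n) ^ s * (2 * d n) := by
            gcongr
            · linarith [hx n]
            · linarith
        _ = c * (d n) ^ (1 + s) := by
            rw [Real.mul_rpow (by positivity) hdp.le, Real.rpow_add hdp, Real.rpow_one, hc]; ring
  have hle : ENNReal.ofReal (η / c) ≤ μH[1 + s] (X.reg V (Icc 1 2)) := by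
    rw [Measure.hausdorffMeasure_apply]
    refine le_iSup₂_of_le 1 one_pos ?_
    refine le_iInf fun t => le_iInf fun ht => le_iInf fun htd => ?_
    have h1 := main t ht htd
    have h2 : ∀ n, Metric.ediam (t n) ^ (1 + s) ≤ ⨆ (_ : (t n).Nonempty), Metric.ediam (t n) ^ (1 + s) := by
      intro n
      rcases (t n).eq_empty_or_nonempty with h | h
      · rw [h, Metric.ediam_empty, ENNReal.zero_rpow_of_pos (by linarith)]; exact zero_le
      · exact le_iSup (fun _ : (t n).Nonempty => Metric.ediam (t n) ^ (1 + s)) h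
    refine le_trans ?_ (ENNReal.tsum_le_tsum h2)
    rw [ENNReal.ofReal_div_of_pos hc0]
    exact ENNReal.div_le_of_le_mul' h1
  intro h0
  rw [h0] at hle
  have : 0 < ENNReal.ofReal (η / c) := ENNReal.ofReal_pos.2 (by positivity)
  exact absurd hle (not_le.2 this)

namespace Polar
variable {o : ℍ} (X : Polar o)

/-- the level `n` covering event -/
def FQ (J : Set ℝ) (a s η : ℝ) (n : ℕ) (z : Set ℍ) : Prop :=
  ∀ C : Finset (ℚ × ℚ), Small n s η C → X.Vis (J \ cov C) (tt a n) z

lemma einc_FQ {J : Set ℝ} (hJ : IsCompact J) (a s η : ℝ) (n : ℕ) :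
    EInc (X.reg J (tt a n)) (X.FQ J a s η n) := by
  classical
  refine EInc.forall fun C => ?_
  by_cases hC : Small n s η C
  · refine ((X.einc_vis (hJ.diff (isOpen_cov C)) (tt a n)).mono (X.isClosed_reg (hJ.diff (isOpen_cov C)) (isCompact_tt _ _))
      (X.reg_mono sdiff_subset subset_rfl)).congr fun s _ => ?_
    simp [hC]
  · exact (einc_const _ True).congr fun s _ => by simp [hC]

lemma FQ_anti {J : Set ℝ} {a s η : ℝ} {n m : ℕ} (hnm : n ≤ m) {z : Set ℍ} (h : X.FQ J a s η m z) : X.FQ J a s η n z := by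
  intro C hC
  have hc : (n:ℝ) ≤ m := by exact_mod_cast hnm
  refine (h C ⟨fun x hx => le_trans ?_ (hC.1 x hx), hC.2⟩).mono subset_rfl (tt_subset le_rfl hc)
  exact Real.exp_le_exp.2 (by linarith)

/-- directions in `J` visible beyond distance `a` on both sides -/
def VJ (J : Set ℝ) (a : ℝ) (z : Set ℍ) : Set ℝ := {φ | φ ∈ J ∧ ∀ t, a ≤ |t| → X.p φ t ∈ z}

lemma isClosed_visT (T : Set ℝ) {z : Set ℍ} (hz : IsClosed z) : IsClosed {φ | ∀ t ∈ T, X.p φ t ∈ z} := by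
  simp only [ofPred_forall]
  exact isClosed_iInter fun t => isClosed_iInter fun _ => hz.preimage (X.cont_left t)

lemma isCompact_VJ {J : Set ℝ} (hJ : IsCompact J) (a : ℝ) {z : Set ℍ} (hz : IsClosed z) : IsCompact (X.VJ J a z) :=
  hJ.inter_right (X.isClosed_visT {t | a ≤ |t|} hz)

lemma big_of_FQ {J : Set ℝ} (hJ : IsCompact J) {a s η : ℝ} (ha : 0 ≤ a) {z : Set ℍ} (hz : IsClosed z)
    (h : ∀ n, X.FQ J a s η n z) : Big s η (X.VJ J a z) := by
  classical
  intro C hC hsum hsub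
  obtain ⟨n0, hn0⟩ : ∃ n0 : ℕ, ∀ x ∈ C, Real.exp (-(n0:ℝ)) ≤ (x.2:ℝ) - x.1 := by
    have : ∀ᶠ n : ℕ in Filter.atTop, ∀ x ∈ C, Real.exp (-(n:ℝ)) ≤ (x.2:ℝ) - x.1 := by
      rw [Filter.eventually_all_finset]
      intro x hx
      have ht : Filter.Tendsto (fun n : ℕ => Real.exp (-(n:ℝ))) Filter.atTop (nhds 0) :=
        Real.tendsto_exp_atBot.comp (Filter.tendsto_neg_atTop_atBot.comp tendsto_natCast_atTop_atTop)
      exact (ht.eventually_lt_const (show (0:ℝ) < (x.2:ℝ) - x.1 by linarith [hC x hx])).mono fun n hn => hn.le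
    exact this.exists
  let W : ℕ → Set ℝ := fun n => (J \ cov C) ∩ {φ | ∀ t ∈ tt a ((n + n0 : ℕ) : ℝ), X.p φ t ∈ z}
  have hWc : ∀ n, IsCompact (W n) := fun n => (hJ.diff (isOpen_cov C)).inter_right (X.isClosed_visT _ hz)
  have hW1 : ∀ n, W (n+1) ⊆ W n := by
    intro n
    refine inter_subset_inter_right _ fun φ hφ t ht => hφ t (tt_subset le_rfl ?_ ht)
    exact_mod_cast (by omega : n + n0 ≤ n + 1 + n0)
  have hW2 : ∀ n, (W n).Nonempty := by
    intro n
    obtain ⟨φ, hφ, hv⟩ := h (n + n0) C ⟨fun x hx => le_trans (Real.exp_le_exp.2 (by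
      have : (n0:ℝ) ≤ ((n + n0 : ℕ):ℝ) := by exact_mod_cast Nat.le_add_left n0 n
      linarith)) (hn0 x hx), hsum⟩
    exact ⟨φ, hφ, hv⟩
  obtain ⟨φ, hφ⟩ := IsCompact.nonempty_iInter_of_sequence_nonempty_isCompact_isClosed W hW1 hW2 (hWc 0) (fun n => (hWc n).isClosed)
  rw [mem_iInter] at hφ
  refine (hφ 0).1.2 (hsub ⟨(hφ 0).1.1, fun t ht => ?_⟩)
  obtain ⟨n, hn⟩ := exists_nat_ge |t|
  refine (hφ n).2 t ((mem_tt ha).2 ⟨ht, hn.trans ?_⟩)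
  exact_mod_cast Nat.le_add_right n n0

lemma dim_of_FQ {u w a s η : ℝ} (hw1 : w ≤ 1) (ha : 0 ≤ a) (hs : 0 < s) (hη : 0 < η) {z : Set ℍ} (hz : IsClosed z)
    (h : ∀ n, X.FQ (Icc u (u+w)) a s η n z) (hfull : X.reg (Icc u (u+w)) (Icc (-a) a) ⊆ z) :
    ENNReal.ofReal (1 + s) ≤ dimH (X.Lset z) := by
  have hb := X.big_of_FQ isCompact_Icc ha hz h
  have hm := hb.slice X (u := u) hs hη (X.isCompact_VJ isCompact_Icc a hz)
    (fun φ hφ => ⟨hφ.1.1, hφ.1.2.trans (by linarith)⟩)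
  have hsub : X.reg (X.VJ (Icc u (u+w)) a z) (Icc 1 2) ⊆ X.Lset z := by
    rintro _ ⟨⟨φ, t⟩, ⟨h1, _⟩, rfl⟩
    refine ⟨φ, t, rfl, fun t' => ?_⟩
    rcases le_or_gt a |t'| with h' | h'
    · exact h1.2 t' h'
    · exact hfull (X.mem_reg h1.1 ⟨by linarith [neg_abs_le t'], by linarith [le_abs_self t']⟩)
  refine le_trans ?_ (dimH_mono hsub)
  have : ENNReal.ofReal (1 + s) = ((1 + s).toNNReal : ℝ≥0∞) := rfl
  rw [this]
  apply le_dimH_of_hausdorffMeasure_ne_zero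
  rwa [Real.coe_toNNReal _ (by linarith)]

end Polar
end PL

set_option linter.unusedSectionVars false
namespace PL
open UpperHalfPlane

/-! ### Part 8: probability of the covering event -/

lemma cover_det {n : ℕ} {s η u : ℝ} (hs : 0 < s) {C : Finset (ℚ × ℚ)} (hC : Small n s η C) (S : Finset ℕ)
    (hS : ∀ i ∈ S, u + i * Real.exp (-(n:ℝ)) ∈ cov C) :
    (S.card : ℝ) ^ 2 ≤ (η * 2 ^ s * Real.exp (n * s)) * ∑ i ∈ S, ∑ j ∈ S, (|(i:ℝ) - j| + 1) ^ (-s) := by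
  classical
  set h := Real.exp (-(n:ℝ)) with hh
  have hh0 : 0 < h := Real.exp_pos _
  have hg : ∀ i, ∃ x : ℚ × ℚ, i ∈ S → x ∈ C ∧ u + i * h ∈ Ioo (x.1:ℝ) x.2 := by
    intro i
    by_cases hi : i ∈ S
    · obtain ⟨x, hx, hx'⟩ := mem_iUnion₂.1 (hS i hi)
      exact ⟨x, fun _ => ⟨hx, hx'⟩⟩
    · exact ⟨0, fun h => absurd h hi⟩
  choose g hg using hg
  let ℓ : ℚ × ℚ → ℝ := fun x => (x.2:ℝ) - x.1
  have hℓ : ∀ x ∈ C, h ≤ ℓ x := hC.1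
  let Sx : ℚ × ℚ → Finset ℕ := fun x => S.filter fun i => g i = x
  have hcard : (S.card : ℝ) = ∑ x ∈ C, ((Sx x).card : ℝ) := by
    rw [Finset.card_eq_sum_card_fiberwise (f := g) (t := C) (fun i hi => (hg i hi).1)]
    push_cast; rfl
  have hCS : (∑ x ∈ C, ((Sx x).card : ℝ)) ^ 2 ≤ (∑ x ∈ C, ℓ x ^ s) * ∑ x ∈ C, ((Sx x).card : ℝ) ^ 2 * ℓ x ^ (-s) := by
    apply Finset.sum_sq_le_sum_mul_sum_of_sq_le_mul
    · intro x hx; exact Real.rpow_nonneg (hh0.le.trans (hℓ x hx)) _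
    · intro x hx; exact mul_nonneg (sq_nonneg _) (Real.rpow_nonneg (hh0.le.trans (hℓ x hx)) _)
    · intro x hx
      have hx0 : 0 < ℓ x := hh0.trans_le (hℓ x hx)
      rw [Real.rpow_neg hx0.le]
      have : 0 < ℓ x ^ s := Real.rpow_pos_of_pos hx0 s
      apply le_of_eq
      field_simp
  set D := 2 ^ s * Real.exp (n * s) with hD
  have hD0 : 0 < D := by positivity
  have hDh : D = (h / 2) ^ (-s) := by
    rw [Real.div_rpow hh0.le (by norm_num), hh, ← Real.exp_mul, Real.rpow_neg (by norm_num : (0:ℝ) ≤ 2), hD]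
    rw [div_inv_eq_mul, mul_comm]; congr 2; ring
  have hx : ∀ x ∈ C, ((Sx x).card : ℝ) ^ 2 * ℓ x ^ (-s) ≤ D * ∑ i ∈ Sx x, ∑ j ∈ S, (|(i:ℝ) - j| + 1) ^ (-s) := by
    intro x hx
    have hx0 : 0 < ℓ x := hh0.trans_le (hℓ x hx)
    have e : ((Sx x).card : ℝ) ^ 2 * ℓ x ^ (-s) = ∑ i ∈ Sx x, ∑ j ∈ Sx x, ℓ x ^ (-s) := by
      simp only [Finset.sum_const, nsmul_eq_mul]; ring
    rw [e, Finset.mul_sum]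
    refine Finset.sum_le_sum fun i hi => ?_
    rw [Finset.mul_sum]
    refine le_trans (Finset.sum_le_sum fun j hj => ?_) (Finset.sum_le_sum_of_subset_of_nonneg (Finset.filter_subset (fun i => g i = x) S) fun j _ _ => by positivity)
    obtain ⟨hi1, hi2⟩ := Finset.mem_filter.1 hi
    obtain ⟨hj1, hj2⟩ := Finset.mem_filter.1 hj
    have gi := (hg i hi1).2
    have gj := (hg j hj1).2
    rw [hi2] at gi
    rw [hj2] at gj
    have hd : |(i:ℝ) - j| * h ≤ ℓ x := by
      have : |(i:ℝ)-j| * h = |((i:ℝ)-j)*h| := by rw [abs_mul, abs_of_pos hh0]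
      rw [this, abs_le]
      simp only [ℓ]
      constructor <;> nlinarith [gi.1, gi.2, gj.1, gj.2]
    have hd2 : (|(i:ℝ) - j| + 1) * (h / 2) ≤ ℓ x := by nlinarith [hℓ x hx]
    rw [hDh, mul_comm, ← Real.mul_rpow (by positivity) (by positivity)]
    exact Real.rpow_le_rpow_of_nonpos (by positivity) hd2 (by linarith)
  have hsum : ∑ x ∈ C, ∑ i ∈ Sx x, ∑ j ∈ S, (|(i:ℝ) - j| + 1) ^ (-s) = ∑ i ∈ S, ∑ j ∈ S, (|(i:ℝ) - j| + 1) ^ (-s) :=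
    Finset.sum_fiberwise_of_maps_to (fun i hi => (hg i hi).1) _
  have hE0 : 0 ≤ ∑ i ∈ S, ∑ j ∈ S, (|(i:ℝ) - j| + 1) ^ (-s) := Finset.sum_nonneg fun i _ => Finset.sum_nonneg fun j _ => by positivity
  have hη : ∑ x ∈ C, ℓ x ^ s ≤ η := hC.2.le
  calc (S.card : ℝ) ^ 2 ≤ (∑ x ∈ C, ℓ x ^ s) * ∑ x ∈ C, ((Sx x).card : ℝ) ^ 2 * ℓ x ^ (-s) := by rw [hcard]; exact hCS
    _ ≤ (∑ x ∈ C, ℓ x ^ s) * ∑ x ∈ C, D * ∑ i ∈ Sx x, ∑ j ∈ S, (|(i:ℝ) - j| + 1) ^ (-s) := by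
        apply mul_le_mul_of_nonneg_left (Finset.sum_le_sum hx)
        exact Finset.sum_nonneg fun x hx => Real.rpow_nonneg (hh0.le.trans (hℓ x hx)) _
    _ = (∑ x ∈ C, ℓ x ^ s) * (D * ∑ i ∈ S, ∑ j ∈ S, (|(i:ℝ) - j| + 1) ^ (-s)) := by rw [← Finset.mul_sum, hsum]
    _ ≤ η * (D * ∑ i ∈ S, ∑ j ∈ S, (|(i:ℝ) - j| + 1) ^ (-s)) := by gcongr
    _ = _ := by rw [hD]; ring

section
variable {Ω : Type*} {Z : Ω → Set ℍ}
variable [mΩ : MeasurableSpace Ω] {P : Measure Ω} [IsProbabilityMeasure P] {R₀ : ℝ}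
variable {o : ℍ} {X : Polar o} {f : ℝ → ℝ} {α c₁ c₂ : ℝ}

lemma vis_singleton (φ : ℝ) (T : Set ℝ) (s : Set ℍ) : X.Vis {φ} T s ↔ ∀ t ∈ T, X.p φ t ∈ s := by
  simp [Polar.Vis]

lemma Setup.seg2 (hS : Setup P Z R₀ X f α c₁ c₂) (φ : ℝ) {a b : ℝ} (ha : R₀ ≤ a) (hab : a < b) :
    P.real {ω | X.Vis {φ} (tt a b) (Z ω)} = f (b - a) ^ 2 := by
  have hR := hS.R_pos
  have e : {ω | X.Vis {φ} (tt a b) (Z ω)} = {ω | X.Vis {φ} (Icc (-b) (-a)) (Z ω) ∧ X.Vis {φ} (Icc a b) (Z ω)} := by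
    ext ω
    simp only [vis_singleton, mem_ofPred_eq, tt, mem_union, or_imp, forall_and]
  rw [e, hS.ind2 ?_ (X.einc_vis isCompact_singleton _).em (X.einc_vis isCompact_singleton _).em]
  · simp only [vis_singleton]
    rw [hS.seg φ _ _ hab, hS.seg φ _ _ (by linarith), sq]; congr 2; ring
  · apply reg_opp _ (by linarith) (by linarith) (Or.inr ha)
    rintro x rfl y rfl; norm_num

lemma Setup.pair_bound (hS : Setup P Z R₀ X f α c₁ c₂) : ∃ C : ℝ, 1 ≤ C ∧ ∀ (φ ψ a n θ : ℝ), R₀ ≤ a → |φ - ψ| = θ → 0 < θ →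
    θ ≤ Real.exp (-a) →
    P.real ({ω | X.Vis {φ} (tt a n) (Z ω)} ∩ {ω | X.Vis {ψ} (tt a n) (Z ω)}) ≤
      P.real {ω | X.Vis {φ} (tt a n) (Z ω)} * (C * (θ * Real.exp n) ^ (-2 * α)) := by
  obtain ⟨ε, M, h0, h1, hM, -, hQ⟩ := hS.Q2_bound
  have hR := hS.R_pos
  have hα0 := hS.α0
  have hα1 := hS.α1
  set C₃ := 8 * Real.sinh R₀ + 2 with hC3
  have hsR : 0 < Real.sinh R₀ := Real.sinh_pos_iff.2 hR
  refine ⟨M * C₃, one_le_mul_of_one_le_of_one_le hM (by linarith), ?_⟩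
  intro φ ψ a n θ ha hθ hθ0 hθa
  set b := Real.log (C₃ / θ) with hb
  have hC30 : 0 < C₃ := by linarith
  have heb : Real.exp b = C₃ / θ := Real.exp_log (by positivity)
  have ha0 : 0 ≤ a := by linarith
  have hθ1 : θ ≤ 1 := hθa.trans (Real.exp_le_one_iff.2 (by linarith))
  have hab : a ≤ b := by
    rw [hb, Real.le_log_iff_exp_le (by positivity), le_div_iff₀ hθ0]
    calc Real.exp a * θ ≤ Real.exp a * Real.exp (-a) := by gcongr
      _ = 1 := by rw [← Real.exp_add]; simp
      _ ≤ C₃ := by linarith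
  have hsb : Real.sinh R₀ ≤ Real.sinh b * (θ / 2) := by
    have h2 : 2 ≤ Real.exp b := by
      rw [heb, le_div_iff₀ hθ0]; nlinarith
    have h3 : Real.exp b / 4 ≤ Real.sinh b := by
      rw [Real.sinh_eq]
      have : Real.exp (-b) ≤ 1 := Real.exp_le_one_iff.2 (by linarith)
      linarith
    calc Real.sinh R₀ ≤ C₃ / θ / 4 * (θ / 2) := by field_simp; linarith
      _ = Real.exp b / 4 * (θ / 2) := by rw [heb]
      _ ≤ _ := by gcongr
  have hsub : {ω | X.Vis {φ} (tt a n) (Z ω)} ∩ {ω | X.Vis {ψ} (tt a n) (Z ω)} ⊆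
      {ω | X.Vis {φ} (tt a n) (Z ω) ∧ X.Vis {ψ} (tt b n) (Z ω)} := by
    rintro ω ⟨h1, h2⟩
    exact ⟨h1, Polar.Vis.mono h2 subset_rfl (tt_subset hab le_rfl)⟩
  refine (measureReal_mono hsub).trans ?_
  rw [hS.ind2 ?_ (X.einc_vis isCompact_singleton _).em (X.einc_vis isCompact_singleton _).em]
  · gcongr
    set w := min 1 (ε * Real.exp (-n)) with hw
    have hw0 : 0 < w := by positivity
    calc P.real {ω | X.Vis {ψ} (tt b n) (Z ω)} ≤ P.real {ω | X.Vis (Icc ψ (ψ+w)) (tt b n) (Z ω)} := by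
          refine measureReal_mono (fun ω hω => Polar.Vis.mono hω ?_ subset_rfl)
          rintro x rfl; exact ⟨le_rfl, by linarith⟩
      _ ≤ M * Real.exp (-2 * α * (n - b)) := hQ ψ w b n (by linarith) hw0 (min_le_left _ _) (min_le_right _ _)
      _ ≤ _ := by
        rw [mul_assoc M C₃]
        apply mul_le_mul_of_nonneg_left _ (by linarith)
        have e : Real.exp (-2 * α * (n - b)) = C₃ ^ (2 * α) * (θ * Real.exp n) ^ (-2 * α) := by
          have : Real.exp (-2 * α * (n - b)) = (Real.exp b / Real.exp n) ^ (2 * α) := by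
            rw [← Real.exp_sub, ← Real.exp_mul]; congr 1; ring
          rw [this, heb, show -2 * α = -(2 * α) by ring, Real.rpow_neg (by positivity), ← div_eq_mul_inv, ← Real.div_rpow (by positivity) (by positivity), div_div]
        rw [e]
        gcongr
        calc C₃ ^ (2 * α) ≤ C₃ ^ (1:ℝ) := Real.rpow_le_rpow_of_exponent_le (by linarith) (by linarith)
          _ = C₃ := Real.rpow_one _
  · have hθ' : |φ - ψ| ≤ 3/2 := by rw [hθ]; linarith
    have hθ'' : |ψ - φ| ≤ 3/2 := by rw [abs_sub_comm]; exact hθ'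
    rintro _ ⟨⟨φ', t⟩, ⟨hφ, ht⟩, rfl⟩ _ ⟨⟨ψ', t'⟩, ⟨hψ, ht'⟩, rfl⟩
    simp only [mem_singleton_iff] at hφ hψ
    subst hφ hψ
    simp only at ht ht' ⊢
    obtain ⟨hta, htn⟩ := (mem_tt ha0).1 ht
    obtain ⟨hta', htn'⟩ := (mem_tt (by linarith)).1 ht'
    have k1 := X.sinh_dist_ge (ψ := φ') (φ := ψ') (s := t') (t := t)
    rw [dist_comm] at k1
    have k2 : Real.sinh R₀ ≤ |Real.sinh t' * Real.sin (ψ' - φ')| := by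
      rw [abs_mul, Real.abs_sinh]
      refine hsb.trans (mul_le_mul (Real.sinh_le_sinh.2 hta') ?_ (by positivity) (Real.sinh_nonneg_iff.2 (abs_nonneg _)))
      have := Polar.sin_lower' hθ''
      rwa [abs_sub_comm, hθ] at this
    exact Real.sinh_le_sinh.1 (k2.trans k1)

end
end PL

set_option linter.unusedSectionVars false
namespace PL
open UpperHalfPlane
section
variable {Ω : Type*} {Z : Ω → Set ℍ}
variable [mΩ : MeasurableSpace Ω] {P : Measure Ω} [IsProbabilityMeasure P] {R₀ : ℝ}
variable {o : ℍ} {X : Polar o} {f : ℝ → ℝ} {α c₁ c₂ : ℝ}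

lemma sum_aux {β p q Γ D : ℝ} {N : ℕ} (hβ : 0 ≤ β) (hβ1 : β < 1) (hp : 0 ≤ p) (hD : 0 ≤ D) (hq : 0 < q)
    (hN : 0 < (N:ℝ)) {b s : ℝ} (hb : β = b + s) (hpq : q * (N:ℝ) ^ (-b) ≤ p) (hΓ : Γ = D * (2 / (1 - β)) / q) :
    D * p * ∑ i ∈ Finset.range N, ∑ j ∈ Finset.range N, (|(i:ℝ) - j| + 1) ^ (-β) ≤ (Γ * (N:ℝ) ^ (-s)) * ((N:ℝ) * p) ^ 2 := by
  have h1 := sum_sum_rpow_le hβ hβ1 N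
  have h0 : 0 < 1 - β := by linarith
  have e : (N:ℝ) ^ (1 - β) = N * ((N:ℝ) ^ (-b) * (N:ℝ) ^ (-s)) := by
    rw [← Real.rpow_add hN, ← Real.rpow_one_add' hN.le (by rw [hb] at h0; linarith)]; congr 1; rw [hb]; ring
  calc _ ≤ D * p * (2 / (1 - β) * ((N:ℝ) * (N:ℝ) ^ (1 - β))) := by gcongr
    _ = Γ * (N:ℝ) ^ (-s) * N ^ 2 * p * (q * (N:ℝ) ^ (-b)) := by rw [e, hΓ]; field_simp
    _ ≤ Γ * (N:ℝ) ^ (-s) * N ^ 2 * p * p := by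
      have : 0 ≤ Γ := by rw [hΓ]; positivity
      gcongr
    _ = _ := by ring

lemma Setup.FQ_one (hS : Setup P Z R₀ X f α c₁ c₂) {s κ : ℝ} (hs : 0 < s) (hsα : s < 1 - 2 * α) (hκ : 0 < κ) (hκ1 : κ ≤ 1) :
    ∃ c η₀ : ℝ, 0 < c ∧ 0 < η₀ ∧ ∀ (a u : ℝ) (n : ℕ), R₀ ≤ a → 1 ≤ κ * Real.exp (n - a) → 1 ≤ n - a →
      c ≤ P.real {ω | X.FQ (Icc u (u + κ * Real.exp (-a))) a s (η₀ * Real.exp (-a * s)) n (Z ω)} := by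
  classical
  obtain ⟨C, hC, hpair⟩ := hS.pair_bound
  have hα0 := hS.α0
  have hα1 := hS.α1
  have hc1 := hS.c1
  have hR := hS.R_pos
  have hpos1 : 0 < 1 - 2 * α := by linarith
  have hpos2 : 0 < 1 - (2 * α + s) := by linarith
  set q := c₁ ^ 2 * κ with hq
  have hq0 : 0 < q := by positivity
  set D := 2 * C with hD
  have hD1 : 1 ≤ D := by linarith
  set Γ := D * (2 / (1 - 2 * α)) / q with hΓ
  set Γ₂ := D * (2 / (1 - (2 * α + s))) / q with hΓ₂
  have hΓ0 : 0 < Γ := by positivity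
  have hΓ20 : 0 < Γ₂ := by positivity
  refine ⟨1 / (4 * Γ), κ ^ s / (4 * 2 ^ s * Γ₂), by positivity, by positivity, ?_⟩
  intro a u n ha hx hna
  set x := κ * Real.exp (n - a) with hxd
  set N := ⌊x⌋₊ + 1 with hN
  have hx0 : 0 < x := by linarith
  have hNx : x ≤ N := by rw [hN]; push_cast; exact (Nat.lt_floor_add_one x).le
  have hNx' : (N:ℝ) - 1 ≤ x := by rw [hN]; push_cast; linarith [Nat.floor_le hx0.le]
  have hN0 : (0:ℝ) < N := by linarith
  set h := Real.exp (-(n:ℝ)) with hh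
  have hh0 : 0 < h := Real.exp_pos _
  have hxh : x * h = κ * Real.exp (-a) := by
    rw [hxd, hh, mul_assoc, ← Real.exp_add]; congr 2; ring
  have hhn : h * Real.exp n = 1 := by rw [hh, ← Real.exp_add]; simp
  let A : ℕ → Set Ω := fun i => {ω | X.Vis {u + i * h} (tt a n) (Z ω)}
  have hAm : ∀ i, MeasurableSet (A i) := fun i =>
    hS.ms (X.einc_vis isCompact_singleton _).em (X.isCompact_reg isCompact_singleton (isCompact_tt _ _)).isClosed
  set p := f (n - a) ^ 2 with hp
  have hPA : ∀ i, P.real (A i) = p := fun i => hS.seg2 _ ha (by linarith)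
  have hpq : q * (N:ℝ) ^ (-(2 * α)) ≤ p := by
    have h1 := hS.lo (n - a) hna
    have h2 : (c₁ * Real.exp (-α * (n - a))) ^ 2 ≤ p := by
      rw [hp]; gcongr
    refine le_trans ?_ h2
    have e : (c₁ * Real.exp (-α * (n - a))) ^ 2 = c₁ ^ 2 * (x / κ) ^ (-(2 * α)) := by
      have : x / κ = Real.exp (n - a) := by rw [hxd]; field_simp
      rw [this, ← Real.exp_mul, mul_pow, ← Real.exp_nat_mul]; congr 2; push_cast; ring
    rw [e, hq, mul_assoc]
    gcongr
    rw [Real.div_rpow hx0.le hκ.le, Real.rpow_neg hκ.le, div_inv_eq_mul, mul_comm]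
    gcongr ?_ * ?_
    · exact Real.rpow_le_rpow_of_nonpos hx0 hNx (by linarith)
    · calc κ = κ ^ (1:ℝ) := (Real.rpow_one _).symm
        _ ≤ κ ^ (2 * α) := Real.rpow_le_rpow_of_exponent_ge hκ hκ1 (by linarith)
  have hp0 : 0 < p := lt_of_lt_of_le (by positivity) hpq
  have hpp : ∀ i ∈ Finset.range N, ∀ j ∈ Finset.range N, P.real (A i ∩ A j) ≤ D * p * (|(i:ℝ) - j| + 1) ^ (-(2 * α)) := by
    intro i hi j hj
    by_cases hij : i = j
    · subst hij
      rw [inter_self, hPA]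
      simp; nlinarith
    have hi' : (i:ℝ) + 1 ≤ N := by exact_mod_cast Finset.mem_range.1 hi
    have hj' : (j:ℝ) + 1 ≤ N := by exact_mod_cast Finset.mem_range.1 hj
    have hi0 : (0:ℝ) ≤ i := by positivity
    have hj0 : (0:ℝ) ≤ j := by positivity
    have h1 : 1 ≤ |(i:ℝ) - j| := by
      have : (1:ℤ) ≤ |(i:ℤ) - j| := Int.one_le_abs (by omega)
      exact_mod_cast this
    have h2 : |(i:ℝ) - j| ≤ x := by rw [abs_le]; constructor <;> linarith
    have e1 : |(u + i * h) - (u + j * h)| = |(i:ℝ) - j| * h := by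
      rw [show (u + i * h) - (u + j * h) = ((i:ℝ) - j) * h by ring, abs_mul, abs_of_pos hh0]
    have h3 : |(i:ℝ) - j| * h ≤ Real.exp (-a) := by
      calc _ ≤ x * h := by gcongr
        _ = κ * Real.exp (-a) := hxh
        _ ≤ 1 * Real.exp (-a) := by gcongr
        _ = _ := one_mul _
    refine (hpair (u + i * h) (u + j * h) a n _ ha e1 (by positivity) h3).trans ?_
    have hPA' := hPA i
    simp only [A] at hPA'
    rw [hPA', mul_assoc _ h, hhn, mul_one]
    have h4 : |(i:ℝ) - j| ^ (-2 * α) ≤ 2 * (|(i:ℝ) - j| + 1) ^ (-(2 * α)) := by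
      calc |(i:ℝ) - j| ^ (-2 * α) = |(i:ℝ) - j| ^ (-(2 * α)) := by congr 1; ring
        _ ≤ ((|(i:ℝ) - j| + 1) / 2) ^ (-(2 * α)) := Real.rpow_le_rpow_of_nonpos (by positivity) (by linarith) (by linarith)
        _ = (2:ℝ) ^ (2 * α) * (|(i:ℝ) - j| + 1) ^ (-(2 * α)) := by
          rw [Real.div_rpow (by positivity) (by norm_num), Real.rpow_neg (by norm_num : (0:ℝ) ≤ 2), div_inv_eq_mul, mul_comm]
        _ ≤ _ := by
          gcongr
          calc (2:ℝ) ^ (2 * α) ≤ 2 ^ (1:ℝ) := Real.rpow_le_rpow_of_exponent_le (by norm_num) (by linarith)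
            _ = 2 := Real.rpow_one _
    calc _ ≤ p * (C * (2 * (|(i:ℝ) - j| + 1) ^ (-(2 * α)))) := by gcongr
      _ = _ := by rw [hD]; ring
  have hJ : IsCompact (Icc u (u + κ * Real.exp (-a))) := isCompact_Icc
  set η := κ ^ s / (4 * 2 ^ s * Γ₂) * Real.exp (-a * s) with hη
  refine second_moment N A hAm _ (hS.ms (X.einc_FQ hJ a s η n).em (X.isCompact_reg hJ (isCompact_tt _ _)).isClosed)
    (fun i j => (|(i:ℝ) - j| + 1) ^ (-s)) (N * p) Γ (Γ₂ * (N:ℝ) ^ (-s)) (η * 2 ^ s * Real.exp (n * s)) (by positivity) ?_ hΓ0 ?_ ?_ (by positivity) ?_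
    (fun i j => by positivity) ?_
  · simp [hPA]
  · have := sum_aux (β := 2 * α) (s := 0) (by linarith) (by linarith) hp0.le (by linarith : 0 ≤ D) hq0 hN0 (by ring) hpq hΓ
    simp only [neg_zero, Real.rpow_zero, mul_one] at this
    refine le_trans ?_ this
    rw [Finset.mul_sum]
    refine Finset.sum_le_sum fun i hi => ?_
    rw [Finset.mul_sum]
    exact Finset.sum_le_sum fun j hj => hpp i hi j hj
  · refine le_trans ?_ (sum_aux (β := 2 * α + s) (by linarith) (by linarith) hp0.le (by linarith : 0 ≤ D) hq0 hN0 rfl hpq hΓ₂)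
    rw [Finset.mul_sum]
    refine Finset.sum_le_sum fun i hi => ?_
    rw [Finset.mul_sum]
    refine Finset.sum_le_sum fun j hj => ?_
    rw [neg_add, Real.rpow_add (by positivity)]
    calc _ ≤ (|(i:ℝ) - j| + 1) ^ (-s) * (D * p * (|(i:ℝ) - j| + 1) ^ (-(2 * α))) := by gcongr; exact hpp i hi j hj
      _ = _ := by ring
  · have e : η * 2 ^ s * Real.exp (n * s) * (Γ₂ * (N:ℝ) ^ (-s)) = (κ * Real.exp (n - a)) ^ s * (N:ℝ) ^ (-s) / 4 := by
      rw [Real.mul_rpow hκ.le (Real.exp_pos _).le, ← Real.exp_mul, hη, sub_mul, sub_eq_add_neg, Real.exp_add, ← neg_mul]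
      field_simp
    rw [e, ← hxd, Real.rpow_neg hN0.le, ← div_eq_mul_inv, ← Real.div_rpow hx0.le hN0.le]
    have : (x / N) ^ s ≤ 1 := Real.rpow_le_one (by positivity) (by rwa [div_le_one hN0]) hs.le
    linarith
  · intro ω hω
    simp only [Polar.FQ, mem_ofPred_eq] at hω
    push Not at hω
    obtain ⟨Cc, hCc, hv⟩ := hω
    let S := (Finset.range N).filter fun i => ω ∈ A i
    have hcd := cover_det (u := u) hs hCc S (by
      intro i hi
      obtain ⟨hi1, hi2⟩ := Finset.mem_filter.1 hi
      by_contra hcon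
      apply hv
      obtain ⟨φ, hφ, hφ'⟩ := hi2
      rw [mem_singleton_iff.1 hφ] at hφ'
      refine ⟨_, ⟨⟨by have : (0:ℝ) ≤ i * h := by positivity
                      linarith, ?_⟩, hcon⟩, hφ'⟩
      have hi' : (i:ℝ) + 1 ≤ N := by exact_mod_cast Finset.mem_range.1 hi1
      rw [← hxh]
      have : (i:ℝ) * h ≤ x * h := by gcongr; linarith
      linarith)
    have e1 : ∑ i ∈ Finset.range N, (A i).indicator (fun _ => (1:ℝ)) ω = S.card := by
      simp [S, indicator_apply, Finset.sum_boole]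
    have e2 : ∑ i ∈ Finset.range N, ∑ j ∈ Finset.range N, (|(i:ℝ) - j| + 1) ^ (-s) * (A i ∩ A j).indicator (fun _ => (1:ℝ)) ω =
        ∑ i ∈ S, ∑ j ∈ S, (|(i:ℝ) - j| + 1) ^ (-s) := by
      simp only [S, Finset.sum_filter]
      refine Finset.sum_congr rfl fun i _ => ?_
      by_cases hi : ω ∈ A i
      · simp only [hi, if_true]
        refine Finset.sum_congr rfl fun j _ => ?_
        by_cases hj : ω ∈ A j <;> simp [indicator_apply, hi, hj]
      · simp [indicator_apply, hi]
    rw [e1, e2]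
    exact hcd

lemma Setup.FQ_prob (hS : Setup P Z R₀ X f α c₁ c₂) {s κ : ℝ} (hs : 0 < s) (hsα : s < 1 - 2 * α) (hκ : 0 < κ) (hκ1 : κ ≤ 1) :
    ∃ c η₀ : ℝ, 0 < c ∧ 0 < η₀ ∧ ∀ (a u : ℝ), R₀ ≤ a →
      c ≤ P.real {ω | ∀ n : ℕ, X.FQ (Icc u (u + κ * Real.exp (-a))) a s (η₀ * Real.exp (-a * s)) n (Z ω)} := by
  obtain ⟨c, η₀, hc, hη, h⟩ := hS.FQ_one hs hsα hκ hκ1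
  refine ⟨c, η₀, hc, hη, fun a u ha => ?_⟩
  set J := Icc u (u + κ * Real.exp (-a))
  have hJ : IsCompact J := isCompact_Icc
  set η := η₀ * Real.exp (-a * s)
  let F : ℕ → Set Ω := fun n => {ω | X.FQ J a s η n (Z ω)}
  have hF : Antitone F := fun n m hnm ω hω => X.FQ_anti hnm hω
  have hm : ∀ n, MeasurableSet (F n) := fun n =>
    hS.ms (X.einc_FQ hJ a s η n).em (X.isCompact_reg hJ (isCompact_tt _ _)).isClosed
  have hlim := tendsto_measure_iInter_atTop (μ := P) (fun n => (hm n).nullMeasurableSet) hF ⟨0, measure_ne_top _ _⟩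
  have hlim2 := (ENNReal.tendsto_toReal (measure_ne_top P _)).comp hlim
  have e : {ω | ∀ n : ℕ, X.FQ J a s η n (Z ω)} = ⋂ n, F n := by ext; simp [F]
  rw [e]
  refine ge_of_tendsto hlim2 ?_
  obtain ⟨n₀, hn₀⟩ := exists_nat_ge (a + 1 + |Real.log κ|)
  filter_upwards [Filter.eventually_ge_atTop n₀] with n hn
  have hn' : (n₀:ℝ) ≤ n := by exact_mod_cast hn
  refine h a u n ha ?_ (by linarith [abs_nonneg (Real.log κ)])
  have e : κ * Real.exp (n - a) = Real.exp (Real.log κ + (n - a)) := by rw [Real.exp_add, Real.exp_log hκ]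
  rw [e]
  exact Real.one_le_exp (by linarith [neg_abs_le (Real.log κ)])

end
end PL

set_option linter.unusedSectionVars false
namespace PL
open UpperHalfPlane
section
variable {Ω : Type*} [mΩ : MeasurableSpace Ω] {P : Measure Ω} [IsProbabilityMeasure P]

lemma union_step (e : ℕ → Set Ω) (he : ∀ i, MeasurableSet (e i)) {x D : Set Ω} (hx : MeasurableSet x) (hD : MeasurableSet D)
    {c : ℝ} (N : ℕ)
    (h : ∀ i < N, c * P.real (e i ∩ (x ∩ {ω | ∃ i' < i, ω ∈ e i'}ᶜ)) ≤ P.real (D ∩ (e i ∩ (x ∩ {ω | ∃ i' < i, ω ∈ e i'}ᶜ)))) :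
    c * P.real (x ∩ {ω | ∃ i < N, ω ∈ e i}) ≤ P.real (D ∩ (x ∩ {ω | ∃ i < N, ω ∈ e i})) := by
  have hU : ∀ n : ℕ, MeasurableSet {ω | ∃ i < n, ω ∈ e i} := by
    intro n
    have : {ω | ∃ i < n, ω ∈ e i} = ⋃ i, ⋃ (_ : i < n), e i := by ext; simp
    rw [this]
    exact MeasurableSet.iUnion fun i => MeasurableSet.iUnion fun _ => he i
  induction N with
  | zero => simp
  | succ N ih =>
    have ih' := ih fun i hi => h i (by omega)
    have hN := h N (by omega)
    have e1 : x ∩ {ω | ∃ i < N + 1, ω ∈ e i} = (x ∩ {ω | ∃ i < N, ω ∈ e i}) ∪ (e N ∩ (x ∩ {ω | ∃ i < N, ω ∈ e i}ᶜ)) := by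
      ext ω
      simp only [mem_inter_iff, mem_union, mem_ofPred_eq, mem_compl_iff, Nat.lt_succ_iff_lt_or_eq]
      constructor
      · rintro ⟨hx, i, hi | rfl, hi'⟩
        · exact Or.inl ⟨hx, i, hi, hi'⟩
        · by_cases hq : ∃ i' < i, ω ∈ e i'
          · exact Or.inl ⟨hx, hq⟩
          · exact Or.inr ⟨hi', hx, hq⟩
      · rintro (⟨hx, i, hi, hi'⟩ | ⟨h1, h2, h3⟩)
        · exact ⟨hx, i, Or.inl hi, hi'⟩
        · exact ⟨h2, N, Or.inr rfl, h1⟩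
    have hdis : Disjoint (x ∩ {ω | ∃ i < N, ω ∈ e i}) (e N ∩ (x ∩ {ω | ∃ i < N, ω ∈ e i}ᶜ)) := by
      rw [Set.disjoint_left]
      rintro ω ⟨_, h1⟩ ⟨_, _, h2⟩
      exact h2 h1
    have m2 : MeasurableSet (e N ∩ (x ∩ {ω | ∃ i < N, ω ∈ e i}ᶜ)) := (he N).inter (hx.inter (hU N).compl)
    rw [e1, inter_union_distrib_left, measureReal_union hdis m2,
      measureReal_union (hdis.mono inter_subset_right inter_subset_right) (hD.inter m2)]
    linarith

lemma zero_one (F : ℕ → MeasurableSpace Ω) (hF : Monotone F) (hFm : ∀ k, F k ≤ mΩ) (T : ℕ → Set Ω)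
    (hT : ∀ k, MeasurableSet[F (k+1)] (T k)) (D : Set Ω) (hD : MeasurableSet[⨆ k, F k] D) {c : ℝ} (hc : 0 < c)
    (h : ∀ k x, MeasurableSet[F k] x → c * P.real (x ∩ T k) ≤ P.real (D ∩ (x ∩ T k))) :
    ∀ᵐ ω ∂P, (∀ N, ∃ k ≥ N, ω ∈ T k) → ω ∈ D := by
  classical
  have hsup : (⨆ k, F k) ≤ mΩ := iSup_le hFm
  have hDm : MeasurableSet D := hsup _ hD
  have hTm : ∀ k, MeasurableSet (T k) := fun k => hFm _ _ (hT k)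
  set I : Set Ω := {ω | ∀ N, ∃ k ≥ N, ω ∈ T k} with hI
  have hIm : MeasurableSet I := by
    have : I = ⋂ N, ⋃ k, ⋃ (_ : k ≥ N), T k := by ext; simp [hI]
    rw [this]
    exact MeasurableSet.iInter fun N => MeasurableSet.iUnion fun k => MeasurableSet.iUnion fun _ => hTm k
  have key : ∀ k x, MeasurableSet[F k] x → c * P.real (x ∩ I) ≤ P.real (D ∩ x) := by
    intro k x hx
    have hx' := hFm _ _ hx
    have h1 : ∀ N, c * P.real (x ∩ {ω | ∃ i < N, ω ∈ T (k + i)}) ≤ P.real (D ∩ x) := by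
      intro N
      refine (union_step (fun i => T (k + i)) (fun i => hTm _) hx' hDm N ?_).trans ?_
      · intro i _
        rw [inter_comm (T (k+i))]
        refine h (k+i) _ ?_
        refine @MeasurableSet.inter _ (F (k+i)) _ _ (hF (by omega) _ hx) (@MeasurableSet.compl _ _ (F (k+i)) ?_)
        have : {ω | ∃ i' < i, ω ∈ T (k + i')} = ⋃ i', ⋃ (_ : i' < i), T (k + i') := by ext; simp
        rw [this]
        exact @MeasurableSet.iUnion _ _ (F (k+i)) _ _ fun i' => @MeasurableSet.iUnion _ _ (F (k+i)) _ _ fun hi' =>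
          hF (by omega) _ (hT (k+i'))
      · exact measureReal_mono (inter_subset_inter_right _ inter_subset_left)
    have hmono : Monotone fun N : ℕ => x ∩ {ω | ∃ i < N, ω ∈ T (k + i)} := by
      rintro N N' hN ω ⟨h1, i, hi, h2⟩
      exact ⟨h1, i, by omega, h2⟩
    have hlim := tendsto_measure_iUnion_atTop (μ := P) hmono
    have hlim2 := (ENNReal.tendsto_toReal (measure_ne_top P _)).comp hlim
    have h3 := le_of_tendsto (hlim2.const_mul c) (Filter.Eventually.of_forall h1)
    refine le_trans ?_ h3
    apply mul_le_mul_of_nonneg_left _ hc.le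
    refine measureReal_mono ?_
    rintro ω ⟨h1, h2⟩
    obtain ⟨m, hm, hm'⟩ := h2 k
    refine mem_iUnion.2 ⟨m - k + 1, h1, m - k, by omega, ?_⟩
    rwa [show k + (m - k) = m by omega]
  let ℱ : Filtration ℕ mΩ := ⟨F, hF, hFm⟩
  let g : Ω → ℝ := D.indicator fun _ => (1:ℝ)
  have hgi : Integrable g P := (integrable_const (1:ℝ)).indicator hDm
  have hlev := tendsto_ae_condExp (μ := P) (ℱ := ℱ) g
  have hg : P[g | ⨆ n, ℱ n] = g := by
    refine condExp_of_stronglyMeasurable hsup ?_ hgi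
    exact (stronglyMeasurable_const).indicator hD
  rw [hg] at hlev
  have hε : ∀ ε : ℝ, 0 < ε → c * P.real (I ∩ Dᶜ) ≤ ε := by
    intro ε hε
    let x : ℕ → Set Ω := fun k => {ω | (P[g | ℱ k]) ω < ε}
    have hxm : ∀ k, MeasurableSet[F k] (x k) := fun k =>
      (stronglyMeasurable_condExp (m := ℱ k) (μ := P) (f := g)).measurable measurableSet_Iio
    have h1 : ∀ k, c * P.real (x k ∩ I) ≤ ε := by
      intro k
      refine (key k _ (hxm k)).trans ?_
      have e1 : ∫ ω in x k, (P[g | ℱ k]) ω ∂P = ∫ ω in x k, g ω ∂P := setIntegral_condExp (hFm k) hgi (hxm k)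
      have e2 : ∫ ω in x k, g ω ∂P = P.real (D ∩ x k) := by
        rw [integral_indicator_const _ hDm]; simp [Measure.real, Measure.restrict_apply hDm]
      rw [← e2, ← e1]
      have : ∫ ω in x k, (P[g | ℱ k]) ω ∂P ≤ ∫ ω in x k, ε ∂P := by
        refine setIntegral_mono_on integrable_condExp.integrableOn (integrable_const _) (hFm k _ (hxm k)) ?_
        intro ω hω; exact le_of_lt hω
      refine this.trans ?_
      simp only [setIntegral_const, smul_eq_mul]
      have := measureReal_le_one (μ := P) (s := x k)
      nlinarith
    let y : ℕ → Set Ω := fun N => {ω | ∀ k ≥ N, ω ∈ x k} ∩ I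
    have hmono : Monotone y := by
      rintro N N' hN ω ⟨h1, h2⟩
      exact ⟨fun k hk => h1 k (le_trans hN hk), h2⟩
    have hlim := tendsto_measure_iUnion_atTop (μ := P) hmono
    have hlim2 := (ENNReal.tendsto_toReal (measure_ne_top P _)).comp hlim
    have h3 : c * P.real (⋃ n, y n) ≤ ε := by
      refine le_of_tendsto (hlim2.const_mul c) (Filter.Eventually.of_forall fun N => ?_)
      refine le_trans ?_ (h1 N)
      apply mul_le_mul_of_nonneg_left _ hc.le
      exact measureReal_mono fun ω hω => ⟨hω.1 N le_rfl, hω.2⟩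
    refine le_trans (mul_le_mul_of_nonneg_left ?_ hc.le) h3
    apply ENNReal.toReal_mono (measure_ne_top _ _)
    refine measure_mono_ae ?_
    filter_upwards [hlev] with ω hω hω'
    have hg0 : g ω = 0 := by simp only [g]; exact indicator_of_notMem hω'.2 _
    rw [hg0] at hω
    obtain ⟨N, hN⟩ := Filter.eventually_atTop.1 (hω.eventually (gt_mem_nhds hε))
    exact mem_iUnion.2 ⟨N, fun k hk => hN k hk, hω'.1⟩
  have h0 : P.real (I ∩ Dᶜ) = 0 := by
    apply le_antisymm _ measureReal_nonneg
    have := le_of_forall_pos_le_add (a := c * P.real (I ∩ Dᶜ)) (b := 0) fun ε hε' => by simpa using hε ε hε'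
    nlinarith
  have h0' : P (I ∩ Dᶜ) = 0 := (measureReal_eq_zero_iff).1 h0
  filter_upwards [measure_eq_zero_iff_ae_notMem.1 h0'] with ω hω hI'
  by_contra hcon
  exact hω ⟨hI', hcon⟩

end
end PL

set_option linter.unusedSectionVars false
namespace PL
open UpperHalfPlane

/-- grid width -/
noncomputable def gw (M q k : ℕ) : ℝ := 1 / (M * (q:ℝ) ^ k)

/-- grid box -/
def gb (u0 : ℝ) (M q k i : ℕ) : Set ℝ := Icc (u0 + i * gw M q k) (u0 + i * gw M q k + gw M q k)

/-- radii -/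
noncomputable def rr (q : ℕ) (k : ℕ) : ℝ := k * Real.log q

lemma exp_rr {q : ℕ} (hq : 0 < q) (k : ℕ) : Real.exp (rr q k) = (q:ℝ) ^ k := by
  rw [rr, mul_comm, Real.exp_mul, Real.exp_log (by exact_mod_cast hq), Real.rpow_natCast]

lemma rr_succ (q k : ℕ) : rr q (k+1) = rr q k + Real.log q := by simp [rr]; ring

lemma gw_pos {M q : ℕ} (hM : 0 < M) (hq : 0 < q) (k : ℕ) : 0 < gw M q k := by
  have : (0:ℝ) < M := by exact_mod_cast hM
  have : (0:ℝ) < q := by exact_mod_cast hq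
  unfold gw; positivity

lemma gw_total {M q : ℕ} (hM : 0 < M) (hq : 0 < q) (k : ℕ) : ((M * q ^ k : ℕ) : ℝ) * gw M q k = 1 := by
  have : (0:ℝ) < M := by exact_mod_cast hM
  have : (0:ℝ) < q := by exact_mod_cast hq
  unfold gw; push_cast; field_simp

lemma gb_bound {u0 : ℝ} {M q k i : ℕ} (hM : 0 < M) (hq : 0 < q) (hi : i < M * q ^ k) {φ : ℝ} (h : φ ∈ gb u0 M q k i) : φ ∈ Icc u0 (u0 + 1) := by
  have h1 := gw_pos hM hq k
  have h2 : ((i:ℝ) + 1) * gw M q k ≤ 1 := by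
    calc ((i:ℝ) + 1) * gw M q k ≤ ((M * q ^ k : ℕ) : ℝ) * gw M q k := by
          gcongr
          exact_mod_cast hi
      _ = 1 := gw_total hM hq k
  have h3 : 0 ≤ (i:ℝ) * gw M q k := by positivity
  constructor
  · linarith [h.1]
  · linarith [h.2]

lemma isCompact_gb {u0 : ℝ} {M q k i : ℕ} : IsCompact (gb u0 M q k i) := isCompact_Icc

namespace Polar
variable {o : ℍ} (X : Polar o)

/-- a box fully visible up to radius `r (k+1)` -/
def EQ (u0 : ℝ) (M q k i : ℕ) (z : Set ℍ) : Prop :=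
  X.reg (gb u0 M q k i) (Icc (-rr q (k+1)) (rr q (k+1))) ⊆ z

/-- some box fully visible -/
def TQ (u0 : ℝ) (M q k : ℕ) (z : Set ℍ) : Prop := ∃ i < M * q ^ k, X.EQ u0 M q k i z

lemma einc_EQ (u0 : ℝ) (M q k i : ℕ) :
    EInc (X.reg (gb u0 M q k i) (Icc (-rr q (k+1)) (rr q (k+1)))) (X.EQ u0 M q k i) := einc_subset _

lemma isClosed_EQ (u0 : ℝ) (M q k i : ℕ) : IsClosed (X.reg (gb u0 M q k i) (Icc (-rr q (k+1)) (rr q (k+1)))) :=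
  (X.isCompact_reg isCompact_gb isCompact_Icc).isClosed

lemma reg_ball {K : Set ℝ} {T : Set ℝ} {r : ℝ} (h : ∀ t ∈ T, |t| ≤ r) : X.reg K T ⊆ Metric.closedBall o r := by
  rintro _ ⟨⟨φ, t⟩, ⟨_, h2⟩, rfl⟩
  rw [Metric.mem_closedBall, dist_comm]
  simp only
  rw [X.dist_o]
  exact h t h2

lemma EQ_ball (u0 : ℝ) (M q k i : ℕ) : X.reg (gb u0 M q k i) (Icc (-rr q (k+1)) (rr q (k+1))) ⊆ Metric.closedBall o (rr q (k+1)) :=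
  X.reg_ball fun _ ht => abs_le.2 ht

end Polar

section
variable {Ω : Type*} {Z : Ω → Set ℍ}
variable [mΩ : MeasurableSpace Ω] {P : Measure Ω} [IsProbabilityMeasure P] {R₀ : ℝ}
variable {o : ℍ} {X : Polar o} {f : ℝ → ℝ} {α c₁ c₂ : ℝ}

/-- the good event for one box -/
def Polar.GE (X : Polar o) (u0 : ℝ) (M q : ℕ) (s η₀ : ℝ) (k i : ℕ) (z : Set ℍ) : Prop :=
  ∀ n : ℕ, X.FQ (gb u0 M q k i) (rr q (k+1)) s (η₀ * Real.exp (-rr q (k+1) * s)) n z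

lemma inc_GE (hP : Perc P Z R₀) (u0 : ℝ) (M q : ℕ) (s η₀ : ℝ) (k i : ℕ) : Inc Z {ω | X.GE u0 M q s η₀ k i (Z ω)} := by
  have : EInc univ (X.GE u0 M q s η₀ k i) := EInc.forall fun n =>
    (X.einc_FQ isCompact_gb _ _ _ n).mono (X.isCompact_reg isCompact_gb (isCompact_tt _ _)).isClosed (subset_univ _)
  exact this.inc isClosed_univ hP.closed

lemma fa_GE (hP : Perc P Z R₀) {u0 : ℝ} {M q : ℕ} (hq : 1 ≤ q) {s η₀ : ℝ} {k i : ℕ} :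
    MeasurableSet[FA Z (X.reg (gb u0 M q k i) {t | rr q (k+1) ≤ |t|})] {ω | X.GE u0 M q s η₀ k i (Z ω)} := by
  have e : {ω | X.GE u0 M q s η₀ k i (Z ω)} = ⋂ n : ℕ, {ω | X.FQ (gb u0 M q k i) (rr q (k+1)) s (η₀ * Real.exp (-rr q (k+1) * s)) n (Z ω)} := by
    ext; simp [Polar.GE]
  rw [e]
  refine @MeasurableSet.iInter _ _ (FA Z _) _ _ fun n => ?_
  have hc := (X.isCompact_reg (isCompact_gb (u0 := u0) (M := M) (q := q) (k := k) (i := i)) (isCompact_tt (rr q (k+1)) n)).isClosed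
  refine FA_mono hc ?_ _ ((X.einc_FQ isCompact_gb _ _ _ n).em.fa hP.closed)
  apply X.reg_mono subset_rfl
  intro t ht
  have h0 : 0 ≤ rr q (k+1) := mul_nonneg (by positivity) (Real.log_nonneg (by exact_mod_cast hq))
  exact ((mem_tt h0).1 ht).1

/-- the main good event -/
def Polar.DQ (X : Polar o) (u0 : ℝ) (M q : ℕ) (s η₀ : ℝ) (z : Set ℍ) : Prop :=
  ∃ k i, i < M * q ^ k ∧ X.EQ u0 M q k i z ∧ X.GE u0 M q s η₀ k i z

lemma Setup.one_class (hS : Setup P Z R₀ X f α c₁ c₂) {u0 : ℝ} {M q : ℕ} (hM : 0 < M) (hq : 2 ≤ q) (hqR : R₀ ≤ Real.log q)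
    {s η₀ c : ℝ}
    (hGE : ∀ k i, c ≤ P.real {ω | X.GE u0 M q s η₀ k i (Z ω)})
    {D : Set Ω} (hDm : MeasurableSet D) (hD : ∀ ω, X.DQ u0 M q s η₀ (Z ω) → ω ∈ D)
    {Kc : ℕ} (hKc : 8 * Real.sinh R₀ * M ≤ (Kc:ℝ) - 1) (cl k : ℕ) {x : Set Ω}
    (hx : MeasurableSet[FA Z (Metric.closedBall o (rr q k))] x) :
    c * P.real (x ∩ {ω | ∃ i < M * q ^ k, ω ∈ {ω | i % Kc = cl ∧ X.EQ u0 M q k i (Z ω)}}) ≤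
      P.real (D ∩ (x ∩ {ω | ∃ i < M * q ^ k, ω ∈ {ω | i % Kc = cl ∧ X.EQ u0 M q k i (Z ω)}})) := by
  classical
  have hq0 : 0 < q := by omega
  have hR := hS.R_pos
  have hlogq : 0 ≤ Real.log q := by linarith
  have hrk : ∀ k, 0 ≤ rr q k := fun k => mul_nonneg (by positivity) hlogq
  have hEinc : ∀ i, EInc (X.reg (gb u0 M q k i) (Icc (-rr q (k+1)) (rr q (k+1)))) fun z => i % Kc = cl ∧ X.EQ u0 M q k i z :=
    fun i => (einc_const _ _).and (X.einc_EQ u0 M q k i)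
  refine union_step _ (fun i => hS.ms (hEinc i).em (X.isClosed_EQ ..)) (hS.FA_le Metric.isClosed_closedBall _ hx) hDm _ ?_
  intro i hi
  by_cases hcl : i % Kc = cl
  swap
  · have : {ω | i % Kc = cl ∧ X.EQ u0 M q k i (Z ω)} = ∅ := by ext; simp [hcl]
    rw [this]; simp
  set A : Set ℍ := Metric.closedBall o (rr q k) ∪ ⋃ i' ∈ (Finset.range i).filter (fun i' => i' % Kc = cl),
    X.reg (gb u0 M q k i') (Icc (-rr q (k+1)) (rr q (k+1))) with hA
  have hAc : IsClosed A := by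
    refine Metric.isClosed_closedBall.union (Set.Finite.isClosed_biUnion (Finset.finite_toSet _) fun i' _ => X.isClosed_EQ ..)
  set B := X.reg (gb u0 M q k i) {t | rr q (k+1) ≤ |t|} with hB
  have hAB : ∀ a ∈ A, ∀ b ∈ B, R₀ ≤ dist a b := by
    rintro a ha _ ⟨⟨φ, t⟩, ⟨hφ, ht⟩, rfl⟩
    simp only at hφ ht ⊢
    have ht' : rr q (k+1) ≤ |t| := ht
    rcases ha with ha | ha
    · have h1 := Metric.mem_closedBall.1 ha
      have h2 := X.dist_o (φ := φ) (t := t)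
      have h3 := dist_triangle_left o (X.p φ t) a
      rw [rr_succ] at ht'
      linarith
    · obtain ⟨i', hi', ψ, hψ⟩ := mem_iUnion₂.1 ha
      obtain ⟨⟨hψ1, hψ2⟩, rfl⟩ := hψ
      obtain ⟨ψ, t'⟩ := ψ
      simp only at hψ1 hψ2 ⊢
      obtain ⟨hi1, hi2⟩ := Finset.mem_filter.1 hi'
      have hlt := Finset.mem_range.1 hi1
      have hmod : i' + Kc ≤ i := by
        have h1 : Kc ∣ i - i' := (Nat.modEq_iff_dvd' hlt.le).1 (by rw [Nat.ModEq, hi2, hcl])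
        have := Nat.le_of_dvd (by omega) h1
        omega
      have hw := gw_pos hM hq0 k
      have hmod' : (i':ℝ) + Kc ≤ i := by exact_mod_cast hmod
      have hsep : ((Kc:ℝ) - 1) * gw M q k ≤ φ - ψ := by
        have h1 := hφ.1
        have h2 := hψ1.2
        have : ((i':ℝ) + Kc) * gw M q k ≤ i * gw M q k := by gcongr
        nlinarith
      have b1 := gb_bound hM hq0 hi hφ
      have b2 := gb_bound hM hq0 (hlt.trans hi) hψ1
      have hle1 : |φ - ψ| ≤ 3/2 := by rw [abs_le]; constructor <;> linarith [b1.1, b1.2, b2.1, b2.2]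
      have h1 := Polar.sin_lower' hle1
      have h2 := X.sinh_dist_ge φ ψ t t'
      rw [dist_comm]
      apply Real.sinh_le_sinh.1
      refine le_trans ?_ h2
      rw [abs_mul, Real.abs_sinh]
      have hsr : (q:ℝ) ^ (k+1) / 4 ≤ Real.sinh |t| := by
        refine le_trans ?_ (Real.sinh_le_sinh.2 ht')
        rw [Real.sinh_eq, exp_rr hq0, Real.exp_neg, exp_rr hq0]
        have hge : (2:ℝ) ≤ (q:ℝ) ^ (k+1) := by
          calc (2:ℝ) ≤ q := by exact_mod_cast hq
            _ = (q:ℝ) ^ 1 := (pow_one _).symm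
            _ ≤ (q:ℝ) ^ (k+1) := pow_le_pow_right₀ (by exact_mod_cast hq0) (by omega)
        have : ((q:ℝ) ^ (k+1))⁻¹ ≤ 1 := inv_le_one_of_one_le₀ (by linarith)
        linarith
      have hM' : (0:ℝ) < M := by exact_mod_cast hM
      have hq' : (1:ℝ) ≤ q := by exact_mod_cast hq0
      have hang : 8 * Real.sinh R₀ * M * gw M q k ≤ |φ - ψ| :=
        (mul_le_mul_of_nonneg_right hKc hw.le).trans (hsep.trans (le_abs_self _))
      have hs0 : 0 < Real.sinh R₀ := Real.sinh_pos_iff.2 hR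
      calc Real.sinh R₀ ≤ (q:ℝ) * Real.sinh R₀ := by nlinarith
        _ = (q:ℝ) ^ (k+1) / 4 * (8 * Real.sinh R₀ * M * gw M q k / 2) := by unfold gw; field_simp; ring
        _ ≤ _ := by
          refine mul_le_mul hsr (le_trans (by linarith) h1) ?_ (le_trans (by positivity) hsr)
          positivity
  have hx' : MeasurableSet[FA Z A] (x ∩ {ω | ∃ i' < i, ω ∈ {ω | i' % Kc = cl ∧ X.EQ u0 M q k i' (Z ω)}}ᶜ) := by
    refine @MeasurableSet.inter _ (FA Z A) _ _ (FA_mono Metric.isClosed_closedBall subset_union_left _ hx) ?_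
    refine @MeasurableSet.compl _ _ (FA Z A) ?_
    have : {ω | ∃ i' < i, ω ∈ {ω | i' % Kc = cl ∧ X.EQ u0 M q k i' (Z ω)}} =
        ⋃ i' ∈ (Finset.range i).filter (fun i' => i' % Kc = cl), {ω | X.EQ u0 M q k i' (Z ω)} := by
      ext ω; simp [and_assoc]
    rw [this]
    refine @Finset.measurableSet_biUnion _ _ (FA Z A) _ _ fun i' hi' => ?_
    refine FA_mono (X.isClosed_EQ ..) ?_ _ ((X.einc_EQ u0 M q k i').em.fa hS.closed)
    exact subset_union_of_subset_right (subset_biUnion_of_mem (u := fun i' => X.reg (gb u0 M q k i') (Icc (-rr q (k+1)) (rr q (k+1)))) hi') _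
  have hmain := hS.condFKG hAc hAB (inc_GE hS.toPerc u0 M q s η₀ k i) (fa_GE hS.toPerc (by omega))
    ((hEinc i).inc (X.isClosed_EQ ..) hS.closed) hx'
  calc _ ≤ _ := mul_le_mul_of_nonneg_right (hGE k i) measureReal_nonneg
    _ ≤ _ := hmain
    _ ≤ _ := by
      refine measureReal_mono ?_
      rintro ω ⟨h1, h2, h3⟩
      exact ⟨hD ω ⟨k, i, hi, h2.2, h1⟩, h2, h3⟩

lemma Setup.T_io (hS : Setup P Z R₀ X f α c₁ c₂) (u0 : ℝ) {M q : ℕ} (hMq : q ≤ M) (hq : 2 ≤ q) (hqR : R₀ ≤ Real.log q)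
    {s : ℝ} (hs : 0 < s) (hsα : s < 1 - 2 * α) :
    ∀ᵐ ω ∂P, (∀ N, ∃ k ≥ N, X.TQ u0 M q k (Z ω)) → ENNReal.ofReal (1 + s) ≤ dimH (X.Lset (Z ω)) := by
  classical
  have hR := hS.R_pos
  have hM : 0 < M := by omega
  have hM' : (0:ℝ) < M := by exact_mod_cast hM
  have hq0 : 0 < q := by omega
  have hq' : (0:ℝ) < q := by exact_mod_cast hq0
  have hlogq : 0 ≤ Real.log q := by linarith
  have hrk : ∀ k, 0 ≤ rr q k := fun k => mul_nonneg (by positivity) hlogq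
  have hrmono : Monotone (rr q) := monotone_nat_of_le_succ fun k => by rw [rr_succ]; linarith
  obtain ⟨c, η₀, hc, hη₀, hFQ⟩ := hS.FQ_prob hs hsα (κ := q / M) (by positivity) (by
    rw [div_le_one hM']; exact_mod_cast hMq)
  have hGE : ∀ k i, c ≤ P.real {ω | X.GE u0 M q s η₀ k i (Z ω)} := by
    intro k i
    have e : (q:ℝ) / M * Real.exp (-rr q (k+1)) = gw M q k := by
      rw [Real.exp_neg, exp_rr hq0]; unfold gw; field_simp; ring
    have h := hFQ (rr q (k+1)) (u0 + i * gw M q k) (by rw [rr_succ]; linarith [hrk k])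
    rw [e] at h
    exact h
  let F : ℕ → MeasurableSpace Ω := fun k => FA Z (Metric.closedBall o (rr q k))
  have hF : Monotone F := fun k k' h => FA_mono Metric.isClosed_closedBall (Metric.closedBall_subset_closedBall (hrmono h))
  have hFm : ∀ k, F k ≤ mΩ := fun k => hS.FA_le Metric.isClosed_closedBall
  have hEF : ∀ k i, MeasurableSet[F (k+1)] {ω | X.EQ u0 M q k i (Z ω)} := fun k i =>
    FA_mono (X.isClosed_EQ ..) (X.EQ_ball ..) _ ((X.einc_EQ u0 M q k i).em.fa hS.closed)
  let T : ℕ → Set Ω := fun k => {ω | X.TQ u0 M q k (Z ω)}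
  have hT : ∀ k, MeasurableSet[F (k+1)] (T k) := by
    intro k
    have : T k = ⋃ i, ⋃ (_ : i < M * q ^ k), {ω | X.EQ u0 M q k i (Z ω)} := by ext; simp [T, Polar.TQ]
    rw [this]
    exact @MeasurableSet.iUnion _ _ (F (k+1)) _ _ fun i => @MeasurableSet.iUnion _ _ (F (k+1)) _ _ fun _ => hEF k i
  let D : Set Ω := {ω | X.DQ u0 M q s η₀ (Z ω)}
  have hD : MeasurableSet[⨆ k, F k] D := by
    have : D = ⋃ k, ⋃ i, ⋃ (_ : i < M * q ^ k), {ω | X.EQ u0 M q k i (Z ω)} ∩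
        ⋂ n : ℕ, {ω | X.FQ (gb u0 M q k i) (rr q (k+1)) s (η₀ * Real.exp (-rr q (k+1) * s)) n (Z ω)} := by
      ext; simp [D, Polar.DQ, Polar.GE]
      exact exists_congr fun k => exists_congr fun i => and_left_comm
    rw [this]
    refine @MeasurableSet.iUnion _ _ (⨆ k, F k) _ _ fun k => @MeasurableSet.iUnion _ _ (⨆ k, F k) _ _ fun i =>
      @MeasurableSet.iUnion _ _ (⨆ k, F k) _ _ fun _ => ?_
    refine @MeasurableSet.inter _ (⨆ k, F k) _ _ (le_iSup F (k+1) _ (hEF k i)) ?_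
    refine @MeasurableSet.iInter _ _ (⨆ k, F k) _ _ fun n => ?_
    have hlog : 0 < Real.log q := by linarith
    obtain ⟨k', hk'⟩ := exists_nat_ge ((n:ℝ) / Real.log q)
    have hk'' : (n:ℝ) ≤ rr q k' := by
      rw [div_le_iff₀ hlog] at hk'; exact hk'
    refine le_iSup F k' _ ?_
    refine FA_mono (X.isCompact_reg isCompact_gb (isCompact_tt _ _)).isClosed ?_ _ ((X.einc_FQ isCompact_gb _ _ _ n).em.fa hS.closed)
    apply X.reg_ball
    intro t ht
    exact ((mem_tt (hrk _)).1 ht).2.trans hk''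
  have hDm : MeasurableSet D := iSup_le hFm _ hD
  obtain ⟨Kc, hKc⟩ := exists_nat_ge (8 * Real.sinh R₀ * M + 1)
  have hs0 : 0 < Real.sinh R₀ := Real.sinh_pos_iff.2 hR
  have hKc0 : (0:ℝ) < Kc := by
    have : 0 < 8 * Real.sinh R₀ * M := by positivity
    linarith
  have hKcN : 0 < Kc := by exact_mod_cast hKc0
  have hstep : ∀ k x, MeasurableSet[F k] x → c / Kc * P.real (x ∩ T k) ≤ P.real (D ∩ (x ∩ T k)) := by
    intro k x hx
    let U : ℕ → Set Ω := fun cl => {ω | ∃ i < M * q ^ k, ω ∈ {ω | i % Kc = cl ∧ X.EQ u0 M q k i (Z ω)}}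
    have hUT : ∀ cl, U cl ⊆ T k := by
      rintro cl ω ⟨i, hi, h⟩
      exact ⟨i, hi, h.2⟩
    have h1 : ∀ cl, c * P.real (x ∩ U cl) ≤ P.real (D ∩ (x ∩ T k)) := by
      intro cl
      refine (hS.one_class hM hq hqR hGE hDm (fun ω h => h) (by linarith) cl k hx).trans ?_
      exact measureReal_mono (inter_subset_inter_right _ (inter_subset_inter_right _ (hUT cl)))
    have h2 : P.real (x ∩ T k) ≤ ∑ cl ∈ Finset.range Kc, P.real (x ∩ U cl) := by
      refine le_trans (measureReal_mono ?_ (measure_ne_top _ _)) (measureReal_biUnion_finset_le _ _)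
      rintro ω ⟨hx, i, hi, h⟩
      exact mem_iUnion₂.2 ⟨i % Kc, Finset.mem_range.2 (Nat.mod_lt _ hKcN), hx, i, hi, rfl, h⟩
    have h3 : c * P.real (x ∩ T k) ≤ Kc * P.real (D ∩ (x ∩ T k)) := by
      calc _ ≤ c * ∑ cl ∈ Finset.range Kc, P.real (x ∩ U cl) := by gcongr
        _ = ∑ cl ∈ Finset.range Kc, c * P.real (x ∩ U cl) := Finset.mul_sum ..
        _ ≤ ∑ cl ∈ Finset.range Kc, P.real (D ∩ (x ∩ T k)) := Finset.sum_le_sum fun cl _ => h1 cl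
        _ = _ := by simp
    rw [div_mul_eq_mul_div, div_le_iff₀ hKc0]; linarith
  filter_upwards [zero_one F hF hFm T hT D hD (div_pos hc hKc0) hstep] with ω hω hio
  obtain ⟨k, i, hi, h1, h2⟩ := hω hio
  refine X.dim_of_FQ (w := gw M q k) (u := u0 + i * gw M q k) (a := rr q (k+1)) ?_ (hrk _) hs (by positivity) (hS.closed ω) h2 h1
  have := gw_pos hM hq0 k
  have h3 : (1:ℝ) ≤ ((M * q ^ k : ℕ) : ℝ) := by
    exact_mod_cast Nat.one_le_iff_ne_zero.2 (by positivity)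
  have h4 := gw_total hM hq0 k
  nlinarith

end
end PL

set_option linter.unusedSectionVars false
namespace PL
open UpperHalfPlane

lemma gw_anc {M q k n : ℕ} (hM : 0 < M) (hq : 0 < q) (hkn : k ≤ n) : gw M q k = (q:ℝ) ^ (n - k) * gw M q n := by
  have : (0:ℝ) < M := by exact_mod_cast hM
  have : (0:ℝ) < q := by exact_mod_cast hq
  unfold gw
  have e : (q:ℝ) ^ n = (q:ℝ) ^ (n - k) * (q:ℝ) ^ k := by rw [← pow_add]; congr 1; omega
  rw [e]; field_simp

lemma gb_anc {u0 : ℝ} {M q k n : ℕ} (hM : 0 < M) (hq : 0 < q) (hkn : k ≤ n) (i : ℕ) :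
    gb u0 M q n i ⊆ gb u0 M q k (i / q ^ (n - k)) := by
  have hw := gw_pos hM hq n
  have hQ : 0 < q ^ (n - k) := by positivity
  have h1 : (i / q ^ (n - k)) * q ^ (n - k) ≤ i := Nat.div_mul_le_self _ _
  have h2 : i + 1 ≤ (i / q ^ (n - k) + 1) * q ^ (n - k) := by
    have := Nat.lt_div_mul_add (a := i) hQ
    rw [add_mul, one_mul]; omega
  have h1' : (((i / q ^ (n - k) : ℕ)):ℝ) * (q:ℝ) ^ (n - k) ≤ i := by exact_mod_cast h1
  have h2' : (i:ℝ) + 1 ≤ ((((i / q ^ (n - k) : ℕ)):ℝ) + 1) * (q:ℝ) ^ (n - k) := by exact_mod_cast h2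
  have h3 := mul_le_mul_of_nonneg_right h1' hw.le
  have h4 := mul_le_mul_of_nonneg_right h2' hw.le
  unfold gb
  rw [gw_anc hM hq hkn]
  apply Icc_subset_Icc
  · linarith
  · linarith

namespace Polar
variable {o : ℍ} (X : Polar o)

/-- the box is visible but no ancestor is fully visible -/
def AQ (u0 : ℝ) (M q k0 n i : ℕ) (z : Set ℍ) : Prop :=
  X.Vis (gb u0 M q n i) (Icc (-(rr q (n+1) + 3)) (rr q (n+1) + 3)) z ∧
    ∀ k, k0 ≤ k → k ≤ n → ¬ X.EQ u0 M q k (i / q ^ (n - k)) z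

lemma AQ_anc {u0 : ℝ} {M q k0 m n i : ℕ} (hM : 0 < M) (hq : 1 ≤ q) (hmn : m ≤ n) {z : Set ℍ}
    (h : X.AQ u0 M q k0 n i z) : X.AQ u0 M q k0 m (i / q ^ (n - m)) z := by
  have hlog : 0 ≤ Real.log q := Real.log_nonneg (by exact_mod_cast hq)
  have hr : rr q (m+1) ≤ rr q (n+1) := by
    unfold rr; gcongr
  refine ⟨h.1.mono (gb_anc hM (by omega) hmn i) (Icc_subset_Icc (by linarith) (by linarith)), fun k hk hkm => ?_⟩
  have := h.2 k hk (by omega)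
  rwa [Nat.div_div_eq_div_mul, ← pow_add, show n - m + (m - k) = n - k by omega]

lemma em_AQ {u0 : ℝ} {M q k0 n i : ℕ} (hq : 1 ≤ q) :
    EM (X.reg univ (Icc (-(rr q (n+1) + 3)) (rr q (n+1) + 3))) (X.AQ u0 M q k0 n i) := by
  have hlog : 0 ≤ Real.log q := Real.log_nonneg (by exact_mod_cast hq)
  refine EM.and ((X.einc_vis isCompact_gb _).em.mono (X.isCompact_reg isCompact_gb isCompact_Icc).isClosed (X.reg_mono (subset_univ _) subset_rfl)) ?_
  refine EM.forall fun k => ?_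
  by_cases hk : k0 ≤ k ∧ k ≤ n
  · refine EM.congr (Q := fun z => ¬ X.EQ u0 M q k (i / q ^ (n - k)) z) ?_ (fun s _ => by simp [hk.1, hk.2])
    refine EM.not ((X.einc_EQ ..).em.mono (X.isClosed_EQ ..) (X.reg_mono (subset_univ _) ?_))
    have hr : rr q (k+1) ≤ rr q (n+1) := by
      unfold rr; gcongr; exact hk.2
    exact Icc_subset_Icc (by linarith) (by linarith)
  · exact (einc_const _ True).em.congr fun s _ => by
      simp only [iff_true]; intro h1 h2; exact absurd ⟨h1, h2⟩ hk

end Polar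

lemma sum_exp_mul_le {a : ℝ} (ha : 0 < a) (N : ℕ) :
    ∑ j ∈ Finset.range (N+1), Real.exp (a * j) ≤ 1 / (1 - Real.exp (-a)) * Real.exp (a * N) := by
  have h1 : Real.exp (-a) < 1 := Real.exp_lt_one_iff.2 (by linarith)
  have h2 : 0 < 1 - Real.exp (-a) := by linarith
  induction N with
  | zero =>
    simp only [zero_add, Finset.range_one, Finset.sum_singleton, Nat.cast_zero, mul_zero, Real.exp_zero, mul_one]
    rw [le_div_iff₀ h2]; linarith [Real.exp_pos (-a)]
  | succ N ih =>
    rw [Finset.sum_range_succ]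
    have e : Real.exp (a * N) = Real.exp (-a) * Real.exp (a * (N+1:ℕ)) := by
      rw [← Real.exp_add]; congr 1; push_cast; ring
    refine (add_le_add_left ih _).trans (le_of_eq ?_)
    rw [e]; field_simp; ring

section
variable {Ω : Type*} {Z : Ω → Set ℍ}
variable [mΩ : MeasurableSpace Ω] {P : Measure Ω} [IsProbabilityMeasure P] {R₀ : ℝ}
variable {o : ℍ} {X : Polar o} {f : ℝ → ℝ} {α c₁ c₂ : ℝ}

set_option maxHeartbeats 1600000 in
lemma Setup.thin_step (hS : Setup P Z R₀ X f α c₁ c₂) (hα : 0 < α) {q : ℕ} (hq : 2 ≤ q) (hqR : R₀ ≤ Real.log q) :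
    ∃ M : ℕ, q ≤ M ∧ ∀ (u0 : ℝ) (k0 n i : ℕ), P.real {ω | X.AQ u0 M q k0 n i (Z ω)} ≤ Real.exp (-(1 + α) * (rr q n - rr q k0)) := by
  obtain ⟨ε, M₂, h0, h1, hM₂, -, hQ⟩ := hS.Q2_bound
  obtain ⟨C, hC, hG⟩ := hS.G_bound
  have hR := hS.R_pos
  have hα1 := hS.α1
  set ρ := Real.log q with hρ
  have hρ0 : 0 < ρ := by linarith
  set τ := 1 + α with hτ
  set S := 1 / (1 - Real.exp (-α)) with hSd
  have hS0 : 0 < S := by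
    have : Real.exp (-α) < 1 := Real.exp_lt_one_iff.2 (by linarith)
    rw [hSd]; apply one_div_pos.2; linarith
  set K := 2 * C * M₂ * Real.exp (τ * (4 + R₀ + 2 * ρ) + 2 * α * (2 + R₀)) * S with hK
  obtain ⟨M, hMb⟩ := exists_nat_ge (max (q / ε) K)
  have hM1 : q / ε ≤ M := (le_max_left _ _).trans hMb
  have hM2 : K ≤ M := (le_max_right _ _).trans hMb
  have hqM : (q:ℝ) ≤ ε * M := by rw [div_le_iff₀ h0] at hM1; linarith
  have hq0 : 0 < q := by omega
  have hq' : (0:ℝ) < q := by exact_mod_cast hq0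
  have hMq : q ≤ M := by
    have : (q:ℝ) ≤ M := by
      have : (0:ℝ) ≤ M := by positivity
      nlinarith
    exact_mod_cast this
  have hM : 0 < M := by omega
  have hM' : (0:ℝ) < M := by exact_mod_cast hM
  have hrk : ∀ k, 0 ≤ rr q k := fun k => mul_nonneg (by positivity) hρ0.le
  refine ⟨M, hMq, fun u0 k0 n => ?_⟩
  induction n using Nat.strong_induction_on with
  | _ n ih =>
  intro i
  rcases le_or_gt n k0 with hnk | hnk
  · refine measureReal_le_one.trans (Real.one_le_exp ?_)
    have : rr q n ≤ rr q k0 := by unfold rr; gcongr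
    nlinarith
  set r := rr q (n+1) with hr
  set u := u0 + i * gw M q n with hu
  set w := gw M q n with hw
  have hw0 : 0 < w := gw_pos hM hq0 n
  have hwe : w = Real.exp (-rr q n) / M := by rw [hw, gw, Real.exp_neg, exp_rr hq0]; field_simp
  have hr1 : r = rr q n + ρ := rr_succ q n
  have hgb : gb u0 M q n i = Icc u (u + w) := rfl
  have hwε : w ≤ ε * Real.exp (-r) := by
    rw [hwe, hr1, neg_add, Real.exp_add, Real.exp_neg ρ, hρ, Real.exp_log hq', div_le_iff₀ hM']
    have := Real.exp_pos (-rr q n)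
    calc Real.exp (-rr q n) = (q:ℝ) * (Real.exp (-rr q n) * (q:ℝ)⁻¹) := by field_simp
      _ ≤ (ε * M) * (Real.exp (-rr q n) * (q:ℝ)⁻¹) := by gcongr
      _ = _ := by ring
  have hw1 : w ≤ 1 := hwε.trans (by
    have : Real.exp (-r) ≤ 1 := Real.exp_le_one_iff.2 (by linarith [hrk (n+1)])
    nlinarith [Real.exp_pos (-r)])
  -- the bound for one scale
  let H : ℕ → ℝ := fun j => Real.exp (-τ * (j - 4 - R₀ - 2 * ρ - rr q k0))
  have hone : ∀ (v : ℝ) (j : ℕ), (j:ℝ) ≤ r → P.real {ω | X.GQ v w j (Z ω) ∧ X.AQ u0 M q k0 n i (Z ω)} ≤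
      C * w * Real.exp j * (H j * (M₂ * Real.exp (-2 * α * (r - (j + 2 + R₀))))) := by
    intro v j hj
    have hj0 : (0:ℝ) ≤ j := by positivity
    have hVis : P.real {ω | X.Vis (gb u0 M q n i) (tt (j + 2 + R₀) r) (Z ω)} ≤ M₂ * Real.exp (-2 * α * (r - (j + 2 + R₀))) := by
      rw [hgb]; exact hQ u w _ _ (by positivity) hw0 hw1 hwε
    have hGj := hG v w j hj0 hw0
    have hvsub : ∀ ω, X.AQ u0 M q k0 n i (Z ω) → X.Vis (gb u0 M q n i) (tt (j + 2 + R₀) r) (Z ω) := by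
      intro ω hω
      refine hω.1.mono subset_rfl fun t ht => ?_
      have := ((mem_tt (by positivity)).1 ht).2
      have h3 := abs_le.1 this
      exact ⟨by linarith [h3.1], by linarith [h3.2]⟩
    have hsepGV : ∀ a ∈ X.reg (Icc v (v+w)) (Icc ((j:ℝ)-1) (j+2)), ∀ b ∈ X.reg (gb u0 M q n i) (tt (j + 2 + R₀) r), R₀ ≤ dist a b := by
      apply X.reg_sep
      intro t ht t' ht'
      have h3 := ((mem_tt (by positivity)).1 ht').1
      have h4 : |t| ≤ j + 2 := abs_le.2 ⟨by linarith [ht.1], ht.2⟩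
      rw [abs_sub_comm]
      exact le_trans (by linarith) (le_abs_self _)
    have hVc : IsClosed (X.reg (gb u0 M q n i) (tt (j + 2 + R₀) r)) := (X.isCompact_reg isCompact_gb (isCompact_tt _ _)).isClosed
    rcases lt_or_ge (((j:ℝ) - 4 - R₀) / ρ) (k0 + 1) with hlt | hge
    · have hH1 : 1 ≤ H j := by
        apply Real.one_le_exp
        rw [div_lt_iff₀ hρ0] at hlt
        have : rr q k0 = k0 * ρ := rfl
        nlinarith
      calc P.real {ω | X.GQ v w j (Z ω) ∧ X.AQ u0 M q k0 n i (Z ω)}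
          ≤ P.real {ω | X.GQ v w j (Z ω) ∧ X.Vis (gb u0 M q n i) (tt (j + 2 + R₀) r) (Z ω)} :=
            measureReal_mono fun ω hω => ⟨hω.1, hvsub ω hω.2⟩
        _ = P.real {ω | X.GQ v w j (Z ω)} * P.real {ω | X.Vis (gb u0 M q n i) (tt (j + 2 + R₀) r) (Z ω)} :=
            hS.ind2 hsepGV (X.em_GQ v w j) (X.einc_vis isCompact_gb _).em
        _ ≤ C * w * Real.exp j * (M₂ * Real.exp (-2 * α * (r - (j + 2 + R₀)))) := by gcongr
        _ ≤ _ := mul_le_mul_of_nonneg_left (le_mul_of_one_le_left (by positivity) hH1) (by positivity)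
    · have hy0 : 0 ≤ ((j:ℝ) - 4 - R₀) / ρ := le_trans (by positivity) hge
      have hfl : k0 + 1 ≤ ⌊((j:ℝ) - 4 - R₀) / ρ⌋₊ := Nat.le_floor (by push_cast; exact hge)
      obtain ⟨m, hm⟩ : ∃ m, ⌊((j:ℝ) - 4 - R₀) / ρ⌋₊ = m + 1 := ⟨⌊((j:ℝ) - 4 - R₀) / ρ⌋₊ - 1, by omega⟩
      have hkm : k0 ≤ m := by omega
      have hf1 := Nat.floor_le hy0
      have hf2 := Nat.lt_floor_add_one (((j:ℝ) - 4 - R₀) / ρ)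
      rw [hm] at hf1 hf2
      rw [le_div_iff₀ hρ0] at hf1
      rw [div_lt_iff₀ hρ0] at hf2
      push_cast at hf2
      have hrm : rr q (m+1) ≤ j - 4 - R₀ := hf1
      have hrm2 : (j:ℝ) - 4 - R₀ ≤ rr q m + 2 * ρ := by
        have : rr q m = m * ρ := rfl
        rw [this]; linarith
      have hmn : m < n := by
        by_contra hcon
        push Not at hcon
        have : r ≤ rr q (m+1) := by rw [hr]; unfold rr; gcongr
        linarith
      have hAm : P.real {ω | X.AQ u0 M q k0 m (i / q ^ (n - m)) (Z ω)} ≤ H j := by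
        refine (ih m hmn _).trans (Real.exp_le_exp.2 ?_)
        nlinarith
      have hAem := X.em_AQ (u0 := u0) (M := M) (q := q) (k0 := k0) (n := m) (i := i / q ^ (n - m)) (by omega)
      calc P.real {ω | X.GQ v w j (Z ω) ∧ X.AQ u0 M q k0 n i (Z ω)}
          ≤ P.real {ω | X.AQ u0 M q k0 m (i / q ^ (n - m)) (Z ω) ∧ X.GQ v w j (Z ω) ∧ X.Vis (gb u0 M q n i) (tt (j + 2 + R₀) r) (Z ω)} :=
            measureReal_mono fun ω hω => ⟨X.AQ_anc hM (by omega) hmn.le hω.2, hω.1, hvsub ω hω.2⟩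
        _ = P.real {ω | X.AQ u0 M q k0 m (i / q ^ (n - m)) (Z ω)} * (P.real {ω | X.GQ v w j (Z ω)} *
              P.real {ω | X.Vis (gb u0 M q n i) (tt (j + 2 + R₀) r) (Z ω)}) := by
            refine hS.ind3 (X.isClosed_reg isCompact_Icc isCompact_Icc) hVc ?_ ?_ hsepGV hAem (X.em_GQ v w j) (X.einc_vis isCompact_gb _).em
            · apply X.reg_sep
              intro t ht t' ht'
              have h3 := abs_le.2 ht
              have h4 : (j:ℝ) - 1 ≤ |t'| := ht'.1.trans (le_abs_self _)
              rw [abs_sub_comm]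
              exact le_trans (by linarith) (le_abs_self _)
            · apply X.reg_sep
              intro t ht t' ht'
              have h3 := abs_le.2 ht
              have h4 := ((mem_tt (by positivity)).1 ht').1
              rw [abs_sub_comm]
              exact le_trans (by linarith) (le_abs_self _)
        _ ≤ H j * ((C * w * Real.exp j) * (M₂ * Real.exp (-2 * α * (r - (j + 2 + R₀))))) := by gcongr
        _ = _ := by ring
  set N := ⌊r⌋₊ with hN
  have hr0 : 0 ≤ r := hrk _
  have hNr : (N:ℝ) ≤ r := Nat.floor_le hr0
  have hcov : {ω | X.AQ u0 M q k0 n i (Z ω)} ⊆ ⋃ j ∈ Finset.range (N+1),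
      ({ω | X.GQ u w j (Z ω) ∧ X.AQ u0 M q k0 n i (Z ω)} ∪ {ω | X.GQ (u + Real.pi) w j (Z ω) ∧ X.AQ u0 M q k0 n i (Z ω)}) := by
    intro ω hω
    have hne := hω.2 n hnk.le le_rfl
    rw [Nat.sub_self, pow_zero, Nat.div_one] at hne
    obtain ⟨_, ⟨⟨φ, t⟩, ⟨hφ, ht⟩, rfl⟩, hz⟩ := Set.not_subset.1 hne
    simp only at hφ ht hz
    have hta : |t| ≤ r := abs_le.2 ht
    have hf1 := Nat.floor_le (abs_nonneg t)
    have hf2 := Nat.lt_floor_add_one |t|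
    refine mem_iUnion₂.2 ⟨⌊|t|⌋₊, Finset.mem_range.2 (Nat.lt_succ_of_le (Nat.floor_mono hta)), ?_⟩
    set j := ⌊|t|⌋₊
    have hj0 : (0:ℝ) ≤ j := by positivity
    rcases le_total 0 t with ht0 | ht0
    · rw [abs_of_nonneg ht0] at hf1 hf2 hta
      refine Or.inl ⟨⟨hω.1.mono subset_rfl (Icc_subset_Icc (by linarith) (by linarith)), fun hsub => ?_⟩, hω⟩
      exact hz (hsub (X.mem_reg hφ ⟨hf1, hf2.le⟩))
    · rw [abs_of_nonpos ht0] at hf1 hf2 hta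
      refine Or.inr ⟨⟨?_, fun hsub => ?_⟩, hω⟩
      · rw [← vis_neg]
        exact hω.1.mono subset_rfl (Icc_subset_Icc (by linarith) (by linarith))
      · apply hz
        have e : X.p φ t = X.p (φ + Real.pi) (-t) := by rw [← X.neg, neg_neg]
        rw [e]
        exact hsub (X.mem_reg ⟨by linarith [hφ.1], by linarith [hφ.2]⟩ ⟨hf1, hf2.le⟩)
  have hbd : ∀ j ∈ Finset.range (N+1), P.real ({ω | X.GQ u w j (Z ω) ∧ X.AQ u0 M q k0 n i (Z ω)} ∪
      {ω | X.GQ (u + Real.pi) w j (Z ω) ∧ X.AQ u0 M q k0 n i (Z ω)}) ≤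
      2 * C * M₂ * Real.exp (τ * (4 + R₀ + 2 * ρ) + 2 * α * (2 + R₀)) * (w * Real.exp (τ * rr q k0 - 2 * α * r)) * Real.exp (α * j) := by
    intro j hj
    have hjr : (j:ℝ) ≤ r := by
      have : (j:ℝ) ≤ N := by exact_mod_cast Nat.lt_succ_iff.1 (Finset.mem_range.1 hj)
      linarith
    refine (measureReal_union_le _ _).trans ((add_le_add (hone _ j hjr) (hone _ j hjr)).trans (le_of_eq ?_))
    have e : Real.exp j * H j * Real.exp (-2 * α * (r - (j + 2 + R₀))) =
        Real.exp (τ * (4 + R₀ + 2 * ρ) + 2 * α * (2 + R₀)) * Real.exp (τ * rr q k0 - 2 * α * r) * Real.exp (α * j) := by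
      simp only [H, ← Real.exp_add]; congr 1; rw [hτ]; ring
    linear_combination (2 * C * w * M₂) * e
  calc P.real {ω | X.AQ u0 M q k0 n i (Z ω)} ≤ _ := measureReal_mono hcov (measure_ne_top _ _)
    _ ≤ _ := measureReal_biUnion_finset_le _ _
    _ ≤ _ := Finset.sum_le_sum hbd
    _ = 2 * C * M₂ * Real.exp (τ * (4 + R₀ + 2 * ρ) + 2 * α * (2 + R₀)) * (w * Real.exp (τ * rr q k0 - 2 * α * r)) * ∑ j ∈ Finset.range (N+1), Real.exp (α * j) := by
      rw [Finset.mul_sum]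
    _ ≤ 2 * C * M₂ * Real.exp (τ * (4 + R₀ + 2 * ρ) + 2 * α * (2 + R₀)) * (w * Real.exp (τ * rr q k0 - 2 * α * r)) * (S * Real.exp (α * r)) := by
      gcongr
      refine (sum_exp_mul_le hα N).trans ?_
      gcongr
    _ = K / M * (Real.exp (-rr q n) * Real.exp (τ * rr q k0 - 2 * α * r) * Real.exp (α * r)) := by
      rw [hK, hwe]; field_simp
    _ ≤ 1 * (Real.exp (-rr q n) * Real.exp (τ * rr q k0 - 2 * α * r) * Real.exp (α * r)) := by
      gcongr
      rw [div_le_one hM']; exact hM2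
    _ ≤ Real.exp (-τ * (rr q n - rr q k0)) := by
      rw [one_mul, ← Real.exp_add, ← Real.exp_add]
      apply Real.exp_le_exp.2
      rw [hr1, hτ]
      nlinarith [mul_pos hα hρ0]

lemma Setup.thin (hS : Setup P Z R₀ X f α c₁ c₂) (hα : 0 < α) {q : ℕ} (hq : 2 ≤ q) (hqR : R₀ ≤ Real.log q) :
    ∃ M : ℕ, q ≤ M ∧ ∀ (u0 : ℝ), ∀ᵐ ω ∂P, (∃ φ ∈ Ico u0 (u0 + 1), ∀ t, X.p φ t ∈ Z ω) → ∀ N, ∃ k ≥ N, X.TQ u0 M q k (Z ω) := by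
  obtain ⟨M, hMq, hA⟩ := hS.thin_step hα hq hqR
  have hR := hS.R_pos
  refine ⟨M, hMq, fun u0 => ?_⟩
  have hq0 : 0 < q := by omega
  have hM : 0 < M := by omega
  have hlog : 0 < Real.log q := by linarith
  have hz : ∀ k0, P {ω | (∃ φ ∈ Ico u0 (u0 + 1), ∀ t, X.p φ t ∈ Z ω) ∧ ∀ k ≥ k0, ¬ X.TQ u0 M q k (Z ω)} = 0 := by
    intro k0
    rw [← measureReal_eq_zero_iff]
    apply le_antisymm _ measureReal_nonneg
    set B := {ω | (∃ φ ∈ Ico u0 (u0 + 1), ∀ t, X.p φ t ∈ Z ω) ∧ ∀ k ≥ k0, ¬ X.TQ u0 M q k (Z ω)}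
    have hn : ∀ n : ℕ, P.real B ≤ (M * Real.exp ((1 + α) * rr q k0)) * Real.exp (-(α * Real.log q)) ^ n := by
      intro n
      have hw0 := gw_pos hM hq0 n
      have hsub : B ⊆ ⋃ i ∈ Finset.range (M * q ^ n), {ω | X.AQ u0 M q k0 n i (Z ω)} := by
        rintro ω ⟨⟨φ, hφ, h⟩, hT⟩
        have hx0 : 0 ≤ (φ - u0) / gw M q n := div_nonneg (by linarith [hφ.1]) hw0.le
        have hf1 := Nat.floor_le hx0
        have hf2 := Nat.lt_floor_add_one ((φ - u0) / gw M q n)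
        set i := ⌊(φ - u0) / gw M q n⌋₊
        rw [le_div_iff₀ hw0] at hf1
        rw [div_lt_iff₀ hw0] at hf2
        have hi : i < M * q ^ n := by
          have h1 : (i:ℝ) * gw M q n < ((M * q ^ n : ℕ) : ℝ) * gw M q n := by
            rw [gw_total hM hq0]; linarith [hφ.2]
          exact_mod_cast lt_of_mul_lt_mul_right h1 hw0.le
        refine mem_iUnion₂.2 ⟨i, Finset.mem_range.2 hi, ⟨φ, ⟨by linarith, by linarith⟩, fun t _ => h t⟩, fun k hk hkn hE => ?_⟩
        refine hT k hk ⟨_, Nat.div_lt_of_lt_mul ?_, hE⟩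
        calc i < M * q ^ n := hi
          _ = q ^ (n - k) * (M * q ^ k) := by
            rw [mul_left_comm, ← pow_add, show n - k + k = n by omega]
      calc P.real B ≤ _ := measureReal_mono hsub (measure_ne_top _ _)
        _ ≤ _ := measureReal_biUnion_finset_le _ _
        _ ≤ ∑ i ∈ Finset.range (M * q ^ n), Real.exp (-(1 + α) * (rr q n - rr q k0)) := Finset.sum_le_sum fun i _ => hA u0 k0 n i
        _ = M * Real.exp (rr q n) * Real.exp (-(1 + α) * (rr q n - rr q k0)) := by
          rw [exp_rr hq0]; simp
        _ = _ := by
          rw [← Real.exp_nat_mul, mul_assoc, mul_assoc, ← Real.exp_add, ← Real.exp_add]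
          congr 2
          simp only [rr]; ring
    have hlim : Filter.Tendsto (fun n : ℕ => (M * Real.exp ((1 + α) * rr q k0)) * Real.exp (-(α * Real.log q)) ^ n) Filter.atTop (nhds ((M * Real.exp ((1 + α) * rr q k0)) * 0)) := by
      refine Filter.Tendsto.const_mul _ (tendsto_pow_atTop_nhds_zero_of_lt_one (Real.exp_pos _).le (Real.exp_lt_one_iff.2 ?_))
      have := mul_pos hα hlog
      linarith
    rw [mul_zero] at hlim
    exact ge_of_tendsto' hlim hn
  have := ae_all_iff.2 fun k0 => measure_eq_zero_iff_ae_notMem.1 (hz k0)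
  filter_upwards [this] with ω hω hφ N
  by_contra hcon
  push Not at hcon
  exact hω N ⟨hφ, hcon⟩

end
end PL

set_option linter.unusedSectionVars false
namespace PL
open UpperHalfPlane

section
variable {Ω : Type*} {Z : Ω → Set ℍ}
variable [mΩ : MeasurableSpace Ω] {P : Measure Ω} [IsProbabilityMeasure P] {R₀ : ℝ}
variable {o : ℍ} {X : Polar o} {f : ℝ → ℝ} {α c₁ c₂ : ℝ}

lemma Setup.seg' (hS : Setup P Z R₀ X f α c₁ c₂) (φ : ℝ) {a b : ℝ} (hab : a < b) :
    P.real {ω | X.Vis {φ} (Icc a b) (Z ω)} = f (b - a) := by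
  rw [← hS.seg φ a b hab]; congr 1; ext ω; simp [Polar.Vis]

lemma Setup.f_le_one (hS : Setup P Z R₀ X f α c₁ c₂) {r : ℝ} (hr : 0 < r) : f r ≤ 1 := by
  have := hS.seg 0 0 r hr
  rw [sub_zero] at this
  rw [← this]; exact measureReal_le_one

lemma Setup.f_one (hS : Setup P Z R₀ X f α c₁ c₂) (hα : α = 0) {r : ℝ} (hr : 0 < r) : f r = 1 := by
  have hR := hS.R_pos
  have hf0 : 0 ≤ f r := by
    have := hS.seg 0 0 r hr
    rw [sub_zero] at this
    rw [← this]; exact measureReal_nonneg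
  refine le_antisymm (hS.f_le_one hr) (le_of_not_gt fun hlt => ?_)
  set L := r + R₀ with hL
  have hL0 : 0 < L := by linarith
  have hstep : ∀ n : ℕ, f ((n + 1) * L) ≤ f r ^ n := by
    intro n
    induction n with
    | zero => simpa using hS.f_le_one hL0
    | succ n ih =>
      have hn : 0 < (n + 1 : ℝ) * L := by positivity
      have e1 := hS.seg' 0 hn
      have e2 := hS.seg' 0 (a := (n+1) * L + R₀) (b := (n + 1) * L + L) (by linarith)
      have e3 := hS.seg' 0 (a := 0) (b := (n + 1) * L + L) (by linarith)
      have hi := hS.ind2 (A := X.reg {0} (Icc 0 ((n+1) * L))) (B := X.reg {0} (Icc ((n+1) * L + R₀) ((n + 1) * L + L))) ?_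
        (X.einc_vis isCompact_singleton _).em (X.einc_vis isCompact_singleton _).em
      · rw [sub_zero] at e1 e3
        rw [show (n + 1) * L + L - ((n+1) * L + R₀) = r by rw [hL]; ring] at e2
        rw [show ((n + 1 : ℕ) + 1 : ℝ) * L = (n + 1) * L + L by push_cast; ring, ← e3, pow_succ]
        calc _ ≤ P.real {ω | X.Vis {0} (Icc 0 ((n+1) * L)) (Z ω) ∧ X.Vis {0} (Icc ((n+1) * L + R₀) ((n + 1) * L + L)) (Z ω)} := by
              refine measureReal_mono (fun ω hω => ⟨hω.mono subset_rfl ?_, hω.mono subset_rfl ?_⟩)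
              · exact Icc_subset_Icc le_rfl (by linarith)
              · exact Icc_subset_Icc (by linarith) le_rfl
          _ = f ((n+1) * L) * f r := by rw [hi, e1, e2]
          _ ≤ _ := by gcongr
      · apply X.reg_sep
        intro t ht t' ht'
        rw [abs_of_nonneg ht.1, abs_of_nonneg (by linarith [ht'.1] : 0 ≤ t'), abs_sub_comm]
        exact le_trans (by linarith [ht.2, ht'.1]) (le_abs_self _)
  have hlim := tendsto_pow_atTop_nhds_zero_of_lt_one hf0 hlt
  obtain ⟨n0, hn0⟩ := exists_nat_ge (1 / L)
  have hev : ∀ᶠ n : ℕ in Filter.atTop, c₁ ≤ f r ^ n := by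
    filter_upwards [Filter.eventually_ge_atTop n0] with n hn
    refine le_trans ?_ (hstep n)
    have h1 : 1 ≤ ((n:ℝ) + 1) * L := by
      rw [div_le_iff₀ hL0] at hn0
      have : (n0:ℝ) ≤ n := by exact_mod_cast hn
      nlinarith
    have := hS.lo _ h1
    simpa [hα] using this
  exact absurd (ge_of_tendsto hlim hev) (not_le.2 hS.c1)

lemma Setup.univ_of_zero (hS : Setup P Z R₀ X f α c₁ c₂) (hα : α = 0) : ∀ᵐ ω ∂P, Z ω = univ := by
  have h : ∀ᵐ ω ∂P, ∀ (φ : ℚ) (N : ℕ), X.Vis {(φ:ℝ)} (Icc 0 ((N:ℝ)+1)) (Z ω) := by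
    simp only [ae_all_iff]
    intro φ N
    have h1 := hS.seg' φ (a := 0) (b := (N:ℝ)+1) (by positivity)
    rw [hS.f_one hα (by rw [sub_zero]; positivity)] at h1
    have hm := hS.ms (X.einc_vis (isCompact_singleton (x := (φ:ℝ))) (Icc 0 ((N:ℝ)+1))).em (X.isClosed_reg isCompact_singleton isCompact_Icc)
    have := (prob_compl_eq_zero_iff hm).2 (by rw [measureReal_def] at h1; exact (ENNReal.toReal_eq_one_iff _).1 h1)
    exact this
  filter_upwards [h] with ω hω
  refine eq_univ_of_forall fun z => ?_
  obtain ⟨φ, t, ht, rfl⟩ := X.surj z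
  have hcl : IsClosed {x : ℝ | X.p x t ∈ Z ω} := (hS.closed ω).preimage (X.cont_left t)
  have hd : Dense (range ((↑) : ℚ → ℝ)) := Rat.denseRange_cast
  have : closure (range ((↑) : ℚ → ℝ)) ⊆ {x : ℝ | X.p x t ∈ Z ω} := by
    refine closure_minimal ?_ hcl
    rintro _ ⟨x, rfl⟩
    obtain ⟨N, hN⟩ := exists_nat_ge t
    obtain ⟨y, rfl, h⟩ := hω x N
    exact h t ⟨ht, by linarith⟩
  rw [hd.closure_eq] at this
  exact this (mem_univ φ)

lemma Setup.lower (hS : Setup P Z R₀ X f α c₁ c₂) :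
    ∀ᵐ ω ∂P, (∃ φ, ∀ t, X.p φ t ∈ Z ω) → ENNReal.ofReal (2 - 2 * α) ≤ dimH (X.Lset (Z ω)) := by
  have hα1 := hS.α1
  obtain ⟨q0, hq0⟩ := exists_nat_ge (Real.exp R₀)
  obtain ⟨q, hq, hqR⟩ : ∃ q : ℕ, 2 ≤ q ∧ R₀ ≤ Real.log q := by
    refine ⟨max 2 q0, le_max_left _ _, ?_⟩
    rw [Real.le_log_iff_exp_le (by positivity)]
    exact hq0.trans (by exact_mod_cast le_max_right _ _)
  obtain ⟨M, hMq, hT⟩ : ∃ M, q ≤ M ∧ ∀ u0 : ℝ, ∀ᵐ ω ∂P, (∃ φ ∈ Ico u0 (u0+1), ∀ t, X.p φ t ∈ Z ω) → ∀ N, ∃ k ≥ N, X.TQ u0 M q k (Z ω) := by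
    rcases hS.α0.eq_or_lt with h0 | h0
    · refine ⟨q, le_rfl, fun u0 => ?_⟩
      filter_upwards [hS.univ_of_zero h0.symm] with ω hω _ N
      refine ⟨N, le_rfl, 0, by positivity, ?_⟩
      rw [hω]; exact subset_univ _
    · exact hS.thin h0 hq hqR
  have hall : ∀ᵐ ω ∂P, ∀ (u : ℤ) (m : ℕ), ((∃ φ ∈ Ico (u:ℝ) (u+1), ∀ t, X.p φ t ∈ Z ω) →
      ENNReal.ofReal (1 + (1 - 2 * α) * (1 - 1 / ((m:ℝ) + 2))) ≤ dimH (X.Lset (Z ω))) := by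
    simp only [ae_all_iff]
    intro u m
    have hm : 0 < 1 / ((m:ℝ) + 2) := by positivity
    have hm1 : 1 / ((m:ℝ) + 2) < 1 := by
      rw [div_lt_one (by positivity)]; linarith [(Nat.cast_nonneg m : (0:ℝ) ≤ m)]
    filter_upwards [hT u, hS.T_io u hMq hq hqR (s := (1 - 2 * α) * (1 - 1 / ((m:ℝ) + 2)))
      (mul_pos (by linarith) (by linarith)) (by nlinarith)] with ω h1 h2 h3
    exact h2 (h1 h3)
  filter_upwards [hall] with ω hω
  rintro ⟨φ, hφ⟩
  have hlim : Filter.Tendsto (fun m : ℕ => ENNReal.ofReal (1 + (1 - 2 * α) * (1 - 1 / ((m:ℝ) + 2)))) Filter.atTop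
      (nhds (ENNReal.ofReal (1 + (1 - 2 * α) * (1 - 0)))) := by
    refine ENNReal.tendsto_ofReal (Filter.Tendsto.const_add _ (Filter.Tendsto.const_mul _ (Filter.Tendsto.const_sub _ ?_)))
    have := (Filter.tendsto_add_atTop_iff_nat 1).2 (tendsto_one_div_add_atTop_nhds_zero_nat (𝕜 := ℝ))
    refine this.congr fun m => ?_
    push_cast; ring
  rw [show 1 + (1 - 2 * α) * (1 - 0) = 2 - 2 * α by ring] at hlim
  exact le_of_tendsto' hlim fun m => hω ⌊φ⌋ m ⟨φ, ⟨Int.floor_le φ, Int.lt_floor_add_one φ⟩, hφ⟩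

end
end PL

set_option linter.unusedSectionVars false
namespace PL
open UpperHalfPlane
namespace Polar
variable {o : ℍ} (X : Polar o)

lemma eq_of_opp {φ ψ : ℝ} (h : ∀ t, 0 ≤ t → dist (X.p φ t) (X.p ψ t) = t + t) (t : ℝ) :
    X.p ψ t = X.p (φ + Real.pi) t := by
  have h1 := X.cosh_dist φ ψ 1 1
  rw [h 1 zero_le_one, Real.cosh_add] at h1
  have hs : 0 < Real.sinh 1 := Real.sinh_pos_iff.2 one_pos
  have h2 : Real.cos (φ - ψ) = -1 := by
    have h3 : (Real.sinh 1 * Real.sinh 1) * (Real.cos (φ - ψ) + 1) = 0 := by linarith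
    rcases mul_eq_zero.1 h3 with h4 | h4
    · exact absurd h4 (by positivity)
    · linarith
  rw [Real.cos_sub] at h2
  have h3 := Real.sin_sq_add_cos_sq φ
  have h4 := Real.sin_sq_add_cos_sq ψ
  have hc : Real.cos φ + Real.cos ψ = 0 := by
    nlinarith [sq_nonneg (Real.cos φ + Real.cos ψ), sq_nonneg (Real.sin φ + Real.sin ψ)]
  have hsn : Real.sin φ + Real.sin ψ = 0 := by
    nlinarith [sq_nonneg (Real.cos φ + Real.cos ψ), sq_nonneg (Real.sin φ + Real.sin ψ)]
  apply X.eq_of_coords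
  · rw [Real.cos_add_pi, show Real.cos ψ = - Real.cos φ by linarith]
  · rw [Real.sin_add_pi, show Real.sin ψ = - Real.sin φ by linarith]

lemma neg_eq_of {φ ψ : ℝ} (h : ∀ t, 0 ≤ t → X.p φ t = X.p ψ t) (t : ℝ) :
    X.p ψ (-t) = X.p φ (-t) := by
  have hs : Real.sinh 1 ≠ 0 := (Real.sinh_pos_iff.2 one_pos).ne'
  have h1 := congrArg X.C (h 1 zero_le_one)
  have h2 := congrArg X.S (h 1 zero_le_one)
  rw [X.C_p, X.C_p] at h1
  rw [X.S_p, X.S_p] at h2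
  apply X.eq_of_coords
  · rw [mul_left_cancel₀ hs h1]
  · rw [mul_left_cancel₀ hs h2]

end Polar
end PL

/-- for a well-behaved percolation `Z` in the hyperbolic plane with
`α`-value `α ∈ [0, 1/2)` and visibility set `𝔙` from `o` of Hausdorff dimension
`1 − α` a.s. on nonemptiness, the hyperbolic lines through `o` contained in `Z`
correspond to directions in `𝔙 ∩ (−𝔙)`, and if this set of lines is nonempty with
positive probability, then conditionally on nonemptiness the union `L_o` of all
such lines has Hausdorff dimension `2 − 2α` almost surely. -/
theorem dimH_union_of_lines
    [MeasurableSpace UpperHalfPlane] [BorelSpace UpperHalfPlane]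
    {Ω : Type*} [MeasurableSpace Ω] (P : Measure Ω) [IsProbabilityMeasure P]
    (Z : Ω → Set UpperHalfPlane)
    (hZclosed : ∀ ω, IsClosed (Z ω))
    (hZmeas : @Measurable Ω (Set UpperHalfPlane) _ (effrosSigma UpperHalfPlane) Z)
    (hinv : ∀ (φ : UpperHalfPlane ≃ᵢ UpperHalfPlane) (K : Set UpperHalfPlane),
      IsCompact K → P {ω | (Z ω ∩ K).Nonempty} = P {ω | (Z ω ∩ φ '' K).Nonempty})
    (hFKG : ∀ g h : Set UpperHalfPlane → ℝ,
      Monotone g → Monotone h →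
      @Measurable (Set UpperHalfPlane) ℝ (effrosSigma UpperHalfPlane) _ g →
      @Measurable (Set UpperHalfPlane) ℝ (effrosSigma UpperHalfPlane) _ h →
      (∃ M, ∀ s, |g s| ≤ M) → (∃ M, ∀ s, |h s| ≤ M) →
      (∫ ω, g (Z ω) ∂P) * (∫ ω, h (Z ω) ∂P) ≤ ∫ ω, g (Z ω) * h (Z ω) ∂P)
    (R₀ : ℝ) (hR₀ : 0 < R₀)
    (hindep : ∀ A B : Set UpperHalfPlane, (∀ a ∈ A, ∀ b ∈ B, R₀ ≤ dist a b) →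
      Indep ((effrosSigma UpperHalfPlane).comap fun ω => Z ω ∩ A)
        ((effrosSigma UpperHalfPlane).comap fun ω => Z ω ∩ B) P)
    (o : UpperHalfPlane)
    (hcomp : ∀ᵐ ω ∂P, Finite (ConnectedComponents ↥(Metric.closedBall o 1 \ Z ω)))
    (hcompExp : ∫⁻ ω, (Nat.card (ConnectedComponents ↥(Metric.closedBall o 1 \ Z ω)) : ℝ≥0∞) ∂P < ∞)
    (hlen : ∫⁻ ω, μH[1] (Metric.closedBall o 1 ∩ frontier (Z ω)) ∂P < ∞)
    (hfull : 0 < P {ω | Metric.closedBall o 1 ⊆ Z ω})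
    (γ : ℝ → UpperHalfPlane) (hγ : Isometry γ)
    (f : ℝ → ℝ) (hfdef : ∀ r > (0 : ℝ), f r = (P {ω | γ '' Icc 0 r ⊆ Z ω}).toReal)
    -- the α-value, here with α ∈ [0, 1/2)
    (α : ℝ) (hα : α ∈ Ico (0 : ℝ) (1 / 2))
    (hαval : ∃ c₁ c₂ : ℝ, 0 < c₁ ∧ 0 < c₂ ∧ ∀ r : ℝ, 1 ≤ r →
      c₁ * Real.exp (-α * r) ≤ f r ∧ f r ≤ c₂ * Real.exp (-α * r))
    -- geodesic rays from o indexed by directions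
    (ray : (Metric.sphere (0 : EuclideanSpace ℝ (Fin 2)) 1) → ℝ → UpperHalfPlane)
    (hray0 : ∀ θ, ray θ 0 = o)
    (hraygeo : ∀ θ, ∀ s t : ℝ, 0 ≤ s → 0 ≤ t → dist (ray θ s) (ray θ t) = |s - t|)
    (hrayAll : ∀ g : ℝ → UpperHalfPlane, g 0 = o →
      (∀ s t : ℝ, 0 ≤ s → 0 ≤ t → dist (g s) (g t) = |s - t|) →
      ∃ θ, ∀ t : ℝ, 0 ≤ t → g t = ray θ t)
    -- opposite rays concatenate to hyperbolic lines through o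
    (hline : ∀ θ, ∀ s t : ℝ, 0 ≤ s → 0 ≤ t →
      dist (ray θ s) (ray (antipode θ) t) = s + t)
    -- the visibility set 𝔙 and its dimension
    (𝔙 : Ω → Set (Metric.sphere (0 : EuclideanSpace ℝ (Fin 2)) 1))
    (h𝔙 : ∀ ω, 𝔙 ω = {θ | ∀ t : ℝ, 0 ≤ t → ray θ t ∈ Z ω})
    (hdim𝔙 : ∀ᵐ ω ∂P, (𝔙 ω).Nonempty → dimH (𝔙 ω) = ENNReal.ofReal (1 - α))
    -- directions of full lines through o contained in Z: 𝔙 ∩ (−𝔙)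
    (lineDirs : Ω → Set (Metric.sphere (0 : EuclideanSpace ℝ (Fin 2)) 1))
    (hlineDirs : ∀ ω, lineDirs ω = 𝔙 ω ∩ (antipode ⁻¹' 𝔙 ω))
    -- L_o: the union of all hyperbolic lines through o contained in Z
    (L : Ω → Set UpperHalfPlane)
    (hL : ∀ ω, L ω = ⋃ θ ∈ lineDirs ω, (ray θ '' Ici 0 ∪ ray (antipode θ) '' Ici 0))
    (hpos : 0 < P {ω | (lineDirs ω).Nonempty}) :
    ∀ᵐ ω ∂P, (lineDirs ω).Nonempty → dimH (L ω) = ENNReal.ofReal (2 - 2 * α) := by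
  obtain ⟨c₁, c₂, hc1, hc2, hlohi⟩ := hαval
  obtain ⟨X⟩ := PL.exists_polar o
  have hP : PL.Perc P Z R₀ := ⟨hZclosed, hZmeas, hinv, hFKG, hR₀, hindep⟩
  have hseg : ∀ φ a b, a < b → P.real {ω | ∀ t ∈ Icc a b, X.p φ t ∈ Z ω} = f (b - a) := by
    intro φ a b hab
    obtain ⟨Φ, hΦ⟩ := X.geodesic hγ φ a
    have hem : PL.EM univ (fun z => ∀ t ∈ Icc a b, X.p φ t ∈ z) := by
      refine ((X.einc_vis (isCompact_singleton (x := φ)) (Icc a b)).em.mono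
        (X.isClosed_reg isCompact_singleton isCompact_Icc) (subset_univ _)).congr fun s _ => ?_
      simp [PL.Polar.Vis]
    rw [hfdef _ (by linarith), hP.law hem Φ, measureReal_def]
    congr 2
    ext ω
    constructor
    · rintro h _ ⟨t, ht, rfl⟩
      obtain ⟨y, hy, he⟩ := h (a + t) ⟨by linarith [ht.1], by linarith [ht.2]⟩
      rw [← hΦ t ht.1] at he
      rwa [← Φ.injective he]
    · intro h t ht
      refine ⟨γ (t - a), h ⟨t - a, ⟨by linarith [ht.1], by linarith [ht.2]⟩, rfl⟩, ?_⟩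
      rw [hΦ _ (by linarith [ht.1])]; congr 1; ring
  have hS : PL.Setup P Z R₀ X f α c₁ c₂ :=
    { toPerc := hP, α0 := hα.1, α1 := hα.2, c1 := hc1, c2 := hc2, seg := hseg,
      lo := fun r hr => (hlohi r hr).1, hi := fun r hr => (hlohi r hr).2,
      comp := hcomp, compExp := hcompExp }
  -- every direction corresponds to an angle
  have hdir : ∀ θ, ∃ φ, (∀ t, 0 ≤ t → ray θ t = X.p φ t) ∧
      ∀ t, 0 ≤ t → ray (antipode θ) t = X.p φ (-t) := by
    intro θ
    obtain ⟨φ, hφ⟩ := X.classify (hray0 θ) (hraygeo θ)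
    obtain ⟨ψ, hψ⟩ := X.classify (hray0 (antipode θ)) (hraygeo (antipode θ))
    refine ⟨φ, hφ, fun t ht => ?_⟩
    rw [hψ t ht, X.neg]
    exact X.eq_of_opp (fun t ht => by rw [← hφ t ht, ← hψ t ht, hline θ t t ht ht]) t
  have hang : ∀ φ, ∃ θ, (∀ t, 0 ≤ t → ray θ t = X.p φ t) ∧
      ∀ t, 0 ≤ t → ray (antipode θ) t = X.p φ (-t) := by
    intro φ
    obtain ⟨θ, hθ⟩ := hrayAll (X.p φ) (X.zero φ) (fun s t _ _ => X.dist_same φ s t)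
    obtain ⟨ψ, h1, h2⟩ := hdir θ
    refine ⟨θ, fun t ht => (hθ t ht).symm, fun t ht => ?_⟩
    rw [h2 t ht]
    exact X.neg_eq_of (fun t ht => by rw [hθ t ht, h1 t ht]) t
  have hmem : ∀ ω θ, θ ∈ lineDirs ω ↔ (∀ t, 0 ≤ t → ray θ t ∈ Z ω) ∧ ∀ t, 0 ≤ t → ray (antipode θ) t ∈ Z ω := by
    intro ω θ
    rw [hlineDirs, h𝔙]; rfl
  have hsplit : ∀ (ω : Ω) (θ) (φ : ℝ), (∀ t, 0 ≤ t → ray θ t = X.p φ t) →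
      (∀ t, 0 ≤ t → ray (antipode θ) t = X.p φ (-t)) → (θ ∈ lineDirs ω ↔ ∀ t, X.p φ t ∈ Z ω) := by
    intro ω θ φ h1 h2
    rw [hmem]
    constructor
    · rintro ⟨h3, h4⟩ t
      rcases le_total 0 t with ht | ht
      · rw [← h1 t ht]; exact h3 t ht
      · have := h4 (-t) (by linarith)
        rwa [h2 (-t) (by linarith), neg_neg] at this
    · intro h
      exact ⟨fun t ht => by rw [h1 t ht]; exact h t, fun t ht => by rw [h2 t ht]; exact h _⟩
  have hLset : ∀ ω, L ω = X.Lset (Z ω) := by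
    intro ω
    rw [hL]
    ext x
    simp only [mem_iUnion]
    constructor
    · rintro ⟨θ, hθ, hx⟩
      obtain ⟨φ, h1, h2⟩ := hdir θ
      have h := (hsplit ω θ φ h1 h2).1 hθ
      rcases hx with ⟨t, ht, rfl⟩ | ⟨t, ht, rfl⟩
      · exact ⟨φ, t, h1 t ht, h⟩
      · exact ⟨φ, -t, h2 t ht, h⟩
    · rintro ⟨φ, t, rfl, h⟩
      obtain ⟨θ, h1, h2⟩ := hang φ
      refine ⟨θ, (hsplit ω θ φ h1 h2).2 h, ?_⟩
      rcases le_total 0 t with ht | ht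
      · exact Or.inl ⟨t, ht, h1 t ht⟩
      · refine Or.inr ⟨-t, (by simpa using ht : 0 ≤ -t), ?_⟩
        rw [h2 (-t) (by linarith), neg_neg]
  filter_upwards [hS.upper, hS.lower] with ω hup hlo hne
  rw [hLset]
  refine le_antisymm hup (hlo ?_)
  obtain ⟨θ, hθ⟩ := hne
  obtain ⟨φ, h1, h2⟩ := hdir θ
  exact ⟨φ, (hsplit ω θ φ h1 h2).1 hθ⟩
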